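/- Let n ≥ 1. Let g be a random 2n×2n real matrix whose law has a factorizing density P_G with weight σ, and let h be the determinant density of σ with 0 < Mh(2j−1) < ∞ for j = 1,…,n. Let x be an independent random 2n×2n real antisymmetric matrix such that for every invariant test function φ, E[φ(x)] = C · ∫_{(0,∞)ⁿ} φ(D(a)) · Δ_n(a²) · det[w_b(a_c)]_{b,c=1..n} da, where w_1,…,w_n : (0,∞) → [0,∞) are measurable with ∫₀^∞ t^{u−1} w_b(t) dt < ∞ for all u ∈ [1,2n−1], and C > 0 is the normalization constant. Then, for every invariant test function φ, E[φ(g x gᵀ)] = (C / ∏_{j=1}^n Mh(2j−1)) · ∫_{(0,∞)ⁿ} φ(D(a)) · Δ_n(a²) · det[(h ⊛ w_b)(a_c)]_{b,c=1..n} da, where (h ⊛ w)(y) := ∫₀^∞ h(t)·w(y/t)·dt/t is the Mellin convolution. -/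

import Mathlib

open MeasureTheory Matrix
open scoped BigOperators

noncomputable section

instance matrixMeasurableSpace {l : Type*} [Fintype l] : MeasurableSpace (Matrix l l ℝ) :=
  inferInstanceAs (MeasurableSpace (l → l → ℝ))

/-- The orthogonal group `O(m)` as a subtype of `m × m` real matrices. -/
abbrev OG (m : ℕ) := Matrix.orthogonalGroup (Fin m) ℝ

/-- `t ^ w` for a real `t ≥ 0` and complex `w`, with the convention `0 ^ w = 0`. -/
def cpw (t : ℝ) (w : ℂ) : ℂ := if t = 0 then 0 else Complex.exp (w * Real.log t)

/-- The `2n × 2n` real antisymmetric matrix `D(a) = diag(a₁ J, …, aₙ J)`,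
`J = [[0,1],[-1,0]]`. -/
def Dmat {n : ℕ} (a : Fin n → ℝ) : Matrix (Fin (2 * n)) (Fin (2 * n)) ℝ :=
  Matrix.of fun i j =>
    if i.val / 2 = j.val / 2 then
      a ⟨i.val / 2, by have := i.isLt; omega⟩ *
        (if i.val % 2 = 0 ∧ j.val % 2 = 1 then 1
          else if i.val % 2 = 1 ∧ j.val % 2 = 0 then -1 else 0)
    else 0

/-- `s_{n+1} := -n-1` convention: the `j`-th exponent `(s_j - s_{j+1})/2 - 1`. -/
def expo (n : ℕ) (s : Fin n → ℂ) (j : Fin n) : ℂ :=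
  (s j - (if h : j.val + 1 < n then s ⟨j.val + 1, h⟩ else -(n : ℂ) - 1)) / 2 - 1

/-- The spherical-type group integral
`f_n(s,X) = ∫_{O(2n)} ∏_j det((kXkᵀ)_{[2j]})^{(s_j-s_{j+1})/2-1} d*k`. -/
def sphInt (n : ℕ) (μ : Measure (OG (2 * n))) (s : Fin n → ℂ)
    (X : Matrix (Fin (2 * n)) (Fin (2 * n)) ℝ) : ℂ :=
  ∫ k : OG (2 * n), ∏ j : Fin n,
    cpw ((((k : Matrix (Fin (2 * n)) (Fin (2 * n)) ℝ) * X *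
        (k : Matrix (Fin (2 * n)) (Fin (2 * n)) ℝ)ᵀ).submatrix
          (Fin.castLE (by have := j.isLt; omega : 2 * (j.val + 1) ≤ 2 * n))
          (Fin.castLE (by have := j.isLt; omega : 2 * (j.val + 1) ≤ 2 * n))).det)
      (expo n s j) ∂μ


/-- The block lower-triangular matrix in `T` with `2×2` identity diagonal blocks
built from its strictly-lower `2×2` blocks. -/
def Tmat {n : ℕ} (c : {ij : Fin n × Fin n // ij.2 < ij.1} → Fin 2 → Fin 2 → ℝ) :
    Matrix (Fin (2 * n)) (Fin (2 * n)) ℝ :=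
  Matrix.of fun i j =>
    if h : j.val / 2 < i.val / 2 then
      c ⟨(⟨i.val / 2, by have := i.isLt; omega⟩, ⟨j.val / 2, by have := j.isLt; omega⟩),
          Fin.mk_lt_mk.mpr h⟩ ⟨i.val % 2, by omega⟩ ⟨j.val % 2, by omega⟩
    else if i.val / 2 = j.val / 2 then (if i.val % 2 = j.val % 2 then 1 else 0) else 0

/-- The `2×2` block-diagonal matrix `diag(z₁,…,zₙ)` built from its blocks. -/
def Zmat {n : ℕ} (zc : Fin n → Fin 2 → Fin 2 → ℝ) : Matrix (Fin (2 * n)) (Fin (2 * n)) ℝ :=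
  Matrix.of fun i j =>
    if i.val / 2 = j.val / 2 then
      zc ⟨i.val / 2, by have := i.isLt; omega⟩ ⟨i.val % 2, by omega⟩ ⟨j.val % 2, by omega⟩
    else 0

/-- A factorizing ensemble on `Gl_ℝ(2n)`: a `K`-bi-invariant probability density whose
block-triangular decomposition density factorizes with weight `σw`. -/
structure IsFactorizing (n : ℕ) (P : Matrix (Fin (2 * n)) (Fin (2 * n)) ℝ → ℝ)
    (σw : Matrix (Fin 2) (Fin 2) ℝ → ℝ) : Prop where
  nonneg : ∀ g, 0 ≤ P g
  integrable : Integrable (fun u : Fin (2 * n) → Fin (2 * n) → ℝ => P (Matrix.of u))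
  prob : (∫ u : Fin (2 * n) → Fin (2 * n) → ℝ, P (Matrix.of u)) = 1
  invariant : ∀ g, ∀ k₁ ∈ Matrix.orthogonalGroup (Fin (2 * n)) ℝ,
      ∀ k₂ ∈ Matrix.orthogonalGroup (Fin (2 * n)) ℝ, P (k₁ * g * k₂) = P g
  wnonneg : ∀ z, 0 ≤ σw z
  factor : ∀ᵐ zc : Fin n → Fin 2 → Fin 2 → ℝ,
    (∏ j : Fin n, ((Matrix.of (zc j)) * (Matrix.of (zc j))ᵀ).det ^ (n - 1 - j.val)) *
        (∫ c : {ij : Fin n × Fin n // ij.2 < ij.1} → Fin 2 → Fin 2 → ℝ,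
          P (Tmat c * Zmat zc)) =
      ∏ j : Fin n, σw (Matrix.of (zc j))

/-- Vandermonde product `Δ_m(x) = ∏_{j<k} (x_k - x_j)`. -/
def vdm {m : ℕ} {R : Type*} [CommRing R] (x : Fin m → R) : R :=
  ∏ p ∈ Finset.univ.filter (fun p : Fin m × Fin m => p.1 < p.2), (x p.2 - x p.1)

/-- A bounded measurable `O(m)`-invariant test function on antisymmetric matrices. -/
def IsInvTest (m : ℕ) (φ : Matrix (Fin m) (Fin m) ℝ → ℝ) : Prop :=
  Measurable φ ∧ (∃ C, ∀ X, |φ X| ≤ C) ∧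
    ∀ X : Matrix (Fin m) (Fin m) ℝ, Xᵀ = -X →
      ∀ k ∈ Matrix.orthogonalGroup (Fin m) ℝ, φ (k * X * kᵀ) = φ X

/-- `h` is the density of `|det z|` under the weight `σw` on `M₂(ℝ)`. -/
def IsDetDensity (σw : Matrix (Fin 2) (Fin 2) ℝ → ℝ) (h : ℝ → ℝ) : Prop :=
  (∀ t : ℝ, 0 < t → 0 ≤ h t) ∧
    ∀ ψ : ℝ → ℝ, Measurable ψ → (∃ C, ∀ t, |ψ t| ≤ C) →
      (∫ z : Fin 2 → Fin 2 → ℝ, σw (Matrix.of z) * ψ |(Matrix.of z).det|) =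
        ∫ t in Set.Ioi (0 : ℝ), h t * ψ t

/-- Mellin transform `Mh(u) = ∫₀^∞ h(t) t^{u-1} dt`. -/
def mellH (h : ℝ → ℝ) (u : ℝ) : ℝ := ∫ t in Set.Ioi (0 : ℝ), h t * t ^ (u - 1)

/-- Mellin convolution `(h ⊛ w)(y) = ∫₀^∞ h(t) w(y/t) dt/t`. -/
def mconv (h w : ℝ → ℝ) (y : ℝ) : ℝ := ∫ t in Set.Ioi (0 : ℝ), h t * w (y / t) / t

namespace FPE
open scoped ENNReal
local notation "Mx" N:max => Matrix (Fin N) (Fin N) ℝ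
local notation "Og" N:max => Matrix.orthogonalGroup (Fin N) ℝ
local notation "evf" => Filter.Eventually.of_forall
local notation "eR" => ENNReal.ofReal
variable {n m N M : ℕ}

instance matBorel {l : Type*} [Fintype l] : BorelSpace (Matrix l l ℝ) :=
  inferInstanceAs (BorelSpace (l → l → ℝ))

instance matSC {l : Type*} [Fintype l] : SecondCountableTopology (Matrix l l ℝ) :=
  inferInstanceAs (SecondCountableTopology (l → l → ℝ))

lemma og_entry_le (k : OG N) (i j : Fin N) : |k.1 i j| ≤ 1 := by
  have h := k.2
  rw [Matrix.mem_orthogonalGroup_iff] at h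
  have h1 := congrFun (congrFun h i) i
  rw [Matrix.mul_apply, Matrix.one_apply_eq] at h1
  have h2 : k.1 i j * k.1 i j ≤ 1 := by
    rw [← h1]
    exact Finset.single_le_sum (f := fun l => k.1 i l * k.1ᵀ l i)
      (fun l _ => mul_self_nonneg _) (Finset.mem_univ j)
  rw [← abs_mul_abs_self] at h2
  nlinarith [abs_nonneg (k.1 i j)]

instance ogCompact (N : ℕ) : CompactSpace (OG N) := by
  refine (isCompact_iff_compactSpace
    (s := (Og N : Set (Mx N)))).mp ?_
  have hc : IsCompact (Set.pi Set.univ fun _ : Fin N => Set.pi Set.univ fun _ : Fin N =>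
      Set.Icc (-1 : ℝ) 1) :=
    isCompact_univ_pi fun _ => isCompact_univ_pi fun _ => isCompact_Icc
  refine IsCompact.of_isClosed_subset (s := (Set.pi Set.univ fun _ : Fin N => Set.pi Set.univ fun _ : Fin N =>
      Set.Icc (-1 : ℝ) 1)) hc ?_ ?_
  · have : (Og N : Set (Mx N))
        = {A | A * Aᵀ = 1} := by
      ext A; exact Matrix.mem_orthogonalGroup_iff (Fin N) ℝ
    change IsClosed (Og N : Set (Mx N))
    rw [this]
    exact isClosed_eq (by fun_prop) continuous_const
  · intro A hA i _ j _
    exact abs_le.mp (og_entry_le ⟨A, hA⟩ i j)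

def hK (N : ℕ) : Measure (OG N) := Measure.haarMeasure ⊤

instance hK_prob (N : ℕ) : IsProbabilityMeasure (hK N) := ⟨by
  have := Measure.haarMeasure_self (K₀ := (⊤ : TopologicalSpace.PositiveCompacts (OG N)))
  simpa [hK] using this⟩

instance hK_haar (N : ℕ) : (hK N).IsHaarMeasure := by unfold hK; infer_instance
instance hK_left (N : ℕ) : (hK N).IsMulLeftInvariant := by unfold hK; infer_instance
instance hK_right (N : ℕ) : (hK N).IsMulRightInvariant := by
  refine ⟨fun g => ?_⟩
  have : IsProbabilityMeasure (Measure.map (· * g) (hK N)) :=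
    Measure.isProbabilityMeasure_map (by fun_prop)
  exact Measure.isHaarMeasure_eq_of_isProbabilityMeasure _ _


def DN (N : ℕ) (a : ℕ → ℝ) : Mx N :=
  of fun i j =>
    if i.val / 2 = j.val / 2 then
      a (i.val / 2) *
        (if i.val % 2 = 0 ∧ j.val % 2 = 1 then 1
          else if i.val % 2 = 1 ∧ j.val % 2 = 0 then -1 else 0)
    else 0

def e2 (N : ℕ) : Fin 2 ⊕ Fin N ≃ Fin (N + 2) := finSumFinEquiv.trans (finCongr (by omega))

@[simp] lemma e2_inl (N : ℕ) (i : Fin 2) : (e2 N (Sum.inl i)).val = i.val := by simp [e2]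
@[simp] lemma e2_inr (N : ℕ) (i : Fin N) : (e2 N (Sum.inr i)).val = i.val + 2 := by
  simp [e2]

def Jm (α : ℝ) : Mx 2 := !![0, α; -α, 0]

lemma DN_blocks (N : ℕ) (α : ℝ) (a : ℕ → ℝ) :
    (DN (N + 2) (fun i => Nat.casesOn i α a)).submatrix (e2 N) (e2 N)
      = fromBlocks (Jm α) 0 0 (DN N a) := by
  ext i j
  rcases i with i | i <;> rcases j with j | j
  · fin_cases i <;> fin_cases j <;> simp [DN, Jm]
  · have : ¬ (i.val / 2 = (j.val + 2) / 2) := by have := i.2; omega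
    simp [DN, -Nat.add_div_right, this]
  · have : ¬ ((i.val + 2) / 2 = j.val / 2) := by have := j.2; omega
    simp [DN, -Nat.add_div_right, this]
  · simp [DN]

lemma og_conj_trans {X Y Z : Mx N}
    (h1 : ∃ k ∈ Og N, X = k * Y * kᵀ)
    (h2 : ∃ k ∈ Og N, Y = k * Z * kᵀ) :
    ∃ k ∈ Og N, X = k * Z * kᵀ := by
  obtain ⟨k, hk, rfl⟩ := h1
  obtain ⟨l, hl, rfl⟩ := h2
  refine ⟨k * l, mul_mem hk hl, ?_⟩
  rw [transpose_mul]; simp only [Matrix.mul_assoc]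

lemma og_transpose {ι : Type*} [Fintype ι] [DecidableEq ι] {k : Matrix ι ι ℝ}
    (hk : k ∈ orthogonalGroup ι ℝ) : kᵀ ∈ orthogonalGroup ι ℝ := by
  rw [mem_orthogonalGroup_iff] at *
  rw [transpose_transpose]
  exact mul_eq_one_comm.mp hk

lemma og_conj_symm {X Y : Mx N}
    (h1 : ∃ k ∈ Og N, X = k * Y * kᵀ) :
    ∃ k ∈ Og N, Y = k * X * kᵀ := by
  obtain ⟨k, hk, rfl⟩ := h1
  refine ⟨kᵀ, og_transpose hk, ?_⟩
  have h := (mem_orthogonalGroup_iff' _ _).mp hk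
  rw [transpose_transpose]
  calc Y = (kᵀ * k) * Y * (kᵀ * k) := by rw [h]; simp
    _ = _ := by simp only [Matrix.mul_assoc]

lemma exists_og_rows {ι : Type*} [Fintype ι] [DecidableEq ι] (s : Set ι) (v : ι → ι → ℝ)
    (hv : ∀ i ∈ s, ∀ j ∈ s, v i ⬝ᵥ v j = if i = j then 1 else 0) :
    ∃ k ∈ orthogonalGroup ι ℝ, ∀ i ∈ s, k i = v i := by
  classical
  let w : ι → EuclideanSpace ℝ ι := fun i => WithLp.toLp 2 (v i)
  have hw : Orthonormal ℝ (s.domRestrict w) := by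
    rw [orthonormal_iff_ite]
    rintro ⟨i, hi⟩ ⟨j, hj⟩
    change inner ℝ (w i) (w j) = _
    rw [EuclideanSpace.inner_eq_star_dotProduct, star_trivial]
    change v j ⬝ᵥ v i = _
    rw [hv j hj i hi]
    simp only [eq_comm, Subtype.mk.injEq]
  obtain ⟨b, hb⟩ := hw.exists_orthonormalBasis_extension_of_card_eq (by simp)
  refine ⟨of fun i => (b i).ofLp, ?_, ?_⟩
  · rw [mem_orthogonalGroup_iff]
    ext i j
    have := orthonormal_iff_ite.mp b.orthonormal j i
    rw [EuclideanSpace.inner_eq_star_dotProduct, star_trivial] at this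
    rw [Matrix.mul_apply, Matrix.one_apply]
    simp only [dotProduct] at this
    simp only [of_apply, transpose_apply]
    rw [this]; simp only [eq_comm]
  · intro i hi
    have := hb i hi
    ext j
    simp [this, w]

lemma exists_skew_pair (X : Mx N) (hX : Xᵀ = -X) (h0 : X ≠ 0) :
    ∃ α : ℝ, 0 < α ∧ ∃ u v : Fin N → ℝ, u ⬝ᵥ u = 1 ∧ v ⬝ᵥ v = 1 ∧ u ⬝ᵥ v = 0 ∧
      X *ᵥ u = -(α • v) ∧ X *ᵥ v = α • u := by
  have hps : (Xᵀ * X).PosSemidef := by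
    simpa using Matrix.posSemidef_conjTranspose_mul_self X
  have hS := hps.1
  have hne : ∃ i, hS.eigenvalues i ≠ 0 := by
    by_contra! hcon
    apply h0
    have : hS.eigenvalues = 0 := funext hcon
    rw [hS.eigenvalues_eq_zero_iff] at this
    have h3 : Xᴴ * X = 0 := by simpa using this
    exact Matrix.conjTranspose_mul_self_eq_zero.mp h3
  obtain ⟨i, hi⟩ := hne
  have hpos : 0 < hS.eigenvalues i := lt_of_le_of_ne (hps.eigenvalues_nonneg i) (Ne.symm hi)
  set l := hS.eigenvalues i
  let u : Fin N → ℝ := (hS.eigenvectorBasis i).ofLp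
  have hu : (Xᵀ * X) *ᵥ u = l • u := hS.mulVec_eigenvectorBasis i
  have huu : u ⬝ᵥ u = 1 := by
    have := orthonormal_iff_ite.mp hS.eigenvectorBasis.orthonormal i i
    rw [EuclideanSpace.inner_eq_star_dotProduct, star_trivial] at this
    simpa using this
  set α := Real.sqrt l
  have hα : 0 < α := Real.sqrt_pos.mpr hpos
  have hαα : α * α = l := Real.mul_self_sqrt hpos.le
  have hskew : ∀ a b : Fin N → ℝ, a ⬝ᵥ (X *ᵥ b) = - ((X *ᵥ a) ⬝ᵥ b) := by
    intro a b
    rw [dotProduct_mulVec, ← mulVec_transpose, hX, neg_mulVec, neg_dotProduct]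
  have hXX : X *ᵥ (X *ᵥ u) = -(l • u) := by
    rw [hX, neg_mul, neg_mulVec, ← mulVec_mulVec] at hu
    rw [← hu]; simp
  refine ⟨α, hα, u, -(α⁻¹ • (X *ᵥ u)), huu, ?_, ?_, ?_, ?_⟩
  · have : (X *ᵥ u) ⬝ᵥ (X *ᵥ u) = l := by
      have h1 := hskew u (X *ᵥ u)
      rw [hXX] at h1
      simp [huu] at h1
      linarith
    simp only [neg_dotProduct, dotProduct_neg, smul_dotProduct, dotProduct_smul, this, smul_eq_mul,
      ← hαα]
    field_simp
  · have h1 := hskew u u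
    rw [dotProduct_comm (X *ᵥ u) u] at h1
    have : u ⬝ᵥ (X *ᵥ u) = 0 := by linarith
    simp [this]
  · rw [smul_neg, smul_smul, mul_inv_cancel₀ hα.ne', one_smul, neg_neg]
  · rw [mulVec_neg, mulVec_smul, hXX, smul_neg, neg_neg, smul_smul, ← hαα]
    congr 1
    field_simp

lemma fromBlocks_og {k : Mx N} (hk : k ∈ Og N) :
    (fromBlocks 1 0 0 k : Matrix (Fin 2 ⊕ Fin N) (Fin 2 ⊕ Fin N) ℝ) ∈ orthogonalGroup _ ℝ := by
  rw [mem_orthogonalGroup_iff] at *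
  rw [fromBlocks_transpose, fromBlocks_multiply]
  simp [hk]

lemma og_reindex {ι κ : Type*} [Fintype ι] [DecidableEq ι] [Fintype κ] [DecidableEq κ]
    (e : ι ≃ κ) {k : Matrix κ κ ℝ} (hk : k ∈ orthogonalGroup κ ℝ) :
    k.submatrix e e ∈ orthogonalGroup ι ℝ := by
  rw [mem_orthogonalGroup_iff] at *
  rw [transpose_submatrix, submatrix_mul_equiv, hk]
  simp

lemma normal_form_unsorted : ∀ (N : ℕ) (X : Mx N), Xᵀ = -X →
    ∃ a : ℕ → ℝ, (∀ i, 0 ≤ a i) ∧ ∃ k ∈ Og N, X = k * DN N a * kᵀ := by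
  intro N
  induction N using Nat.twoStepInduction with
  | zero => intro X _; exact ⟨0, fun _ => le_rfl, 1, one_mem _, Subsingleton.elim _ _⟩
  | one =>
    intro X hX
    refine ⟨0, fun _ => le_rfl, 1, one_mem _, ?_⟩
    have h00 : X 0 0 = 0 := by
      have : X 0 0 = - X 0 0 := congrFun (congrFun hX 0) 0
      linarith
    ext i j
    fin_cases i; fin_cases j
    simpa [DN] using h00
  | more N ih _ =>
    intro X hX
    by_cases h0 : X = 0
    · refine ⟨0, fun _ => le_rfl, 1, one_mem _, ?_⟩
      ext i j; simp [h0, DN]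
    obtain ⟨α, hα, u, v, huu, hvv, huv, hXu, hXv⟩ := exists_skew_pair X hX h0
    obtain ⟨k, hk, hkr⟩ := exists_og_rows ({e2 N (Sum.inl 0), e2 N (Sum.inl 1)} : Set (Fin (N+2)))
      (fun i => if i = e2 N (Sum.inl 0) then u else v) (by
        intro i hi j hj
        have h01 : e2 N (Sum.inl 1) ≠ e2 N (Sum.inl 0) := by simp
        rcases hi with rfl | rfl <;> rcases hj with rfl | rfl <;>
          simp [huu, hvv, huv, dotProduct_comm v u])
    have hk0 : k (e2 N (Sum.inl 0)) = u := by simpa using hkr (e2 N (Sum.inl 0)) (by simp)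
    have hk1 : k (e2 N (Sum.inl 1)) = v := by simpa using hkr (e2 N (Sum.inl 1)) (by simp)
    have hkk := (mem_orthogonalGroup_iff _ _).mp hk
    have hdot : ∀ i j, k i ⬝ᵥ k j = if i = j then 1 else 0 := by
      intro i j
      have := congrFun (congrFun hkk i) j
      rw [Matrix.mul_apply, Matrix.one_apply] at this
      exact this
    have hent : ∀ i j, (k * X * kᵀ) i j = k i ⬝ᵥ (X *ᵥ k j) := by
      intro i j
      rw [Matrix.mul_assoc, Matrix.mul_apply]
      rfl
    set Y := k * X * kᵀ with hY
    have hYt : Yᵀ = -Y := by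
      rw [hY, transpose_mul, transpose_mul, transpose_transpose, hX]
      simp [Matrix.mul_assoc]
    have hY0 : ∀ i, Y i (e2 N (Sum.inl 0)) = if i = e2 N (Sum.inl 1) then -α else 0 := by
      intro i
      rw [hent, hk0, hXu, ← hk1, dotProduct_neg, dotProduct_smul, hdot]
      split_ifs <;> simp
    have hY1 : ∀ i, Y i (e2 N (Sum.inl 1)) = if i = e2 N (Sum.inl 0) then α else 0 := by
      intro i
      rw [hent, hk1, hXv, ← hk0, dotProduct_smul, hdot]
      split_ifs <;> simp
    have hYr : ∀ i j, Y i j = - Y j i := fun i j => by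
      have := congrFun (congrFun hYt j) i
      simpa using this
    let Y' : Mx N := Y.submatrix (fun i => e2 N (Sum.inr i)) (fun i => e2 N (Sum.inr i))
    obtain ⟨a, ha, l, hl, hYl⟩ := ih Y' (by
      ext i j; exact hYr _ _)
    have hYb : Y.submatrix (e2 N) (e2 N) = fromBlocks (Jm α) 0 0 Y' := by
      ext i j
      rcases i with i | i <;> rcases j with j | j
      · fin_cases i <;> fin_cases j <;> simp [hY0, hY1, Jm]
      · rw [submatrix_apply, hYr]
        fin_cases i <;> simp [hY0, hY1]
      · fin_cases j <;> simp [hY0, hY1]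
      · rfl
    refine ⟨fun i => Nat.casesOn i α a, ?_, ?_⟩
    · intro i; cases i with
      | zero => exact hα.le
      | succ i => exact ha i
    refine og_conj_trans (Y := Y) (og_conj_symm ⟨k, hk, hY⟩) ?_
    refine ⟨(fromBlocks 1 0 0 l).submatrix (e2 N).symm (e2 N).symm,
      og_reindex (e2 N).symm (fromBlocks_og hl), ?_⟩
    have h1 : Y = (Y.submatrix (e2 N) (e2 N)).submatrix (e2 N).symm (e2 N).symm := by simp
    have h2 : ∀ Z : Mx (N+2),
      Z = (Z.submatrix (e2 N) (e2 N)).submatrix (e2 N).symm (e2 N).symm := by simp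
    rw [h2 (DN (N+2) _), DN_blocks, transpose_submatrix, submatrix_mul_equiv, submatrix_mul_equiv,
      h1, hYb, hYl, fromBlocks_transpose, fromBlocks_multiply, fromBlocks_multiply]
    simp


def ex (a : Fin m → ℝ) (i : ℕ) : ℝ := if h : i < m then a ⟨i, h⟩ else 0

lemma ex_lt (a : Fin m → ℝ) {i : ℕ} (h : i < m) : ex a i = a ⟨i, h⟩ := by simp [ex, h]

@[simp] lemma ex_fin (a : Fin m → ℝ) (i : Fin m) : ex a i = a i := by simp [ex]

lemma Dmat_eq (a : Fin n → ℝ) : Dmat a = DN (2 * n) (ex a) := by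
  ext i j
  have : i.val / 2 < n := by have := i.2; omega
  simp only [Dmat, DN, of_apply, ex_lt a this]

lemma DN_congr {a b : ℕ → ℝ} (h : ∀ i < N / 2, a i = b i) : DN N a = DN N b := by
  ext i j
  simp only [DN, of_apply]
  split_ifs with h1 h2 h3
  · rw [h]; have := i.2; have := j.2; omega
  · rw [h]; have := i.2; have := j.2; omega
  · simp
  · rfl

lemma DN_restrict (N : ℕ) (a : ℕ → ℝ) : DN N a = DN N (ex (fun i : Fin (N / 2) => a i)) :=
  DN_congr fun i hi => by rw [ex_lt _ hi]

lemma DN_transpose (N : ℕ) (a : ℕ → ℝ) : (DN N a)ᵀ = - DN N a := by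
  ext i j
  simp only [DN, transpose_apply, of_apply, Matrix.neg_apply]
  rcases Nat.mod_two_eq_zero_or_one i.val with hi | hi <;>
  rcases Nat.mod_two_eq_zero_or_one j.val with hj | hj <;>
  by_cases h : i.val / 2 = j.val / 2 <;> simp [hi, hj, h, eq_comm]

lemma submatrix_conj {ι : Type*} [Fintype ι] [DecidableEq ι] (π : ι ≃ ι) (A : Matrix ι ι ℝ) :
    ∃ k ∈ orthogonalGroup ι ℝ, A.submatrix π π = k * A * kᵀ := by
  refine ⟨(1 : Matrix ι ι ℝ).submatrix π id, ?_, ?_⟩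
  · rw [mem_orthogonalGroup_iff, transpose_submatrix, transpose_one]
    ext i j
    simp [Matrix.mul_apply, Matrix.one_apply]
  · ext i j
    simp [Matrix.mul_apply, Matrix.one_apply]

lemma DN_perm (hm : N / 2 = m) (a : Fin m → ℝ) (σ : Equiv.Perm (Fin m)) :
    ∃ k ∈ Og N, DN N (ex (a ∘ σ)) = k * DN N (ex a) * kᵀ := by
  let π0 : Fin N → Fin N := fun i => if h : i.val / 2 < m then
      ⟨2 * (σ ⟨i.val / 2, h⟩).val + i.val % 2, by have := (σ ⟨i.val / 2, h⟩).2; omega⟩ else i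
  have hinj : Function.Injective π0 := by
    intro i j hij
    have hij' := congrArg Fin.val hij
    have hi := i.2
    have hj := j.2
    by_cases h1 : i.val / 2 < m <;> by_cases h2 : j.val / 2 < m <;> simp only [π0, h1, h2, dite_true, dite_false] at hij'
    · have h3 : (σ ⟨i.val / 2, h1⟩) = (σ ⟨j.val / 2, h2⟩) := by ext; omega
      have h4 := σ.injective h3
      have h5 : i.val / 2 = j.val / 2 := congrArg Fin.val h4
      ext; rw [h3] at hij'; omega
    · have := (σ ⟨i.val / 2, h1⟩).2; omega
    · have := (σ ⟨j.val / 2, h2⟩).2; omega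
    · exact Fin.ext hij'
  let π : Fin N ≃ Fin N := Equiv.ofBijective π0 (Finite.injective_iff_bijective.mp hinj)
  have hπ : ∀ i : Fin N, π i = π0 i := fun _ => rfl
  obtain ⟨k, hk, hA⟩ := submatrix_conj π (DN N (ex a))
  refine ⟨k, hk, ?_⟩
  rw [← hA]
  ext i j
  have hi := i.2
  have hj := j.2
  simp only [submatrix_apply, DN, of_apply, hπ]
  have hmod : ∀ i : Fin N, (π0 i).val % 2 = i.val % 2 := by
    intro i
    by_cases h1 : i.val / 2 < m <;> simp [π0, h1]
  have hdiv : ∀ i : Fin N, ∀ h : i.val / 2 < m, (π0 i).val / 2 = (σ ⟨i.val / 2, h⟩).val := by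
    intro i h1
    simp only [π0, h1, dite_true]; omega
  have hdiv' : ∀ i : Fin N, ¬ i.val / 2 < m → (π0 i).val / 2 = i.val / 2 := by
    intro i h1
    simp only [π0, h1, dite_false]
  rw [hmod, hmod]
  by_cases h1 : i.val / 2 < m <;> by_cases h2 : j.val / 2 < m
  · have e1 : (i.val / 2 = j.val / 2) ↔ (π0 i).val / 2 = (π0 j).val / 2 := by
      rw [hdiv _ h1, hdiv _ h2]
      constructor
      · intro h; congr 2; ext; exact h
      · intro h; have := σ.injective (Fin.ext h); exact congrArg Fin.val this
    have e2 : ex (a ∘ σ) (i.val / 2) = ex a ((π0 i).val / 2) := by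
      rw [hdiv _ h1, ex_lt _ h1, ex_fin]; rfl
    simp only [e1, e2]
  · have e1 : ¬ (i.val / 2 = j.val / 2) := by omega
    have e2 : ¬ ((π0 i).val / 2 = (π0 j).val / 2) := by
      rw [hdiv _ h1, hdiv' _ h2]; have := (σ ⟨i.val / 2, h1⟩).2; omega
    simp [e1, e2]
  · have e1 : ¬ (i.val / 2 = j.val / 2) := by omega
    have e2 : ¬ ((π0 i).val / 2 = (π0 j).val / 2) := by
      rw [hdiv' _ h1, hdiv _ h2]; have := (σ ⟨j.val / 2, h2⟩).2; omega
    simp [e1, e2]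
  · have : i = j := by ext; omega
    subst this
    rcases Nat.mod_two_eq_zero_or_one i.val with hi | hi <;> simp [hi]

lemma normal_form (N m : ℕ) (hm : N / 2 = m) (X : Mx N) (hX : Xᵀ = -X) :
    ∃ a : Fin m → ℝ, Antitone a ∧ (∀ i, 0 ≤ a i) ∧
      ∃ k ∈ Og N, X = k * DN N (ex a) * kᵀ := by
  subst hm
  obtain ⟨a, ha, hk⟩ := normal_form_unsorted N X hX
  rw [DN_restrict] at hk
  set b := (fun i : Fin (N / 2) => a i)
  let σ := Tuple.sort (fun i => - b i)
  have hmono : Monotone ((fun i => - b i) ∘ σ) := Tuple.monotone_sort _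
  refine ⟨b ∘ σ, ?_, fun i => ha _, ?_⟩
  · intro i j hij
    have := hmono hij
    simp only [Function.comp] at this ⊢
    linarith
  · exact og_conj_trans hk (og_conj_symm (DN_perm rfl b σ))

def spec (X : Mx N) (x : ℝ) : ℝ := (x • (1 : Mx N) - X).det

lemma spec_conj {k : Mx N} (hk : k ∈ Og N)
    (X : Mx N) (x : ℝ) : spec (k * X * kᵀ) x = spec X x := by
  have h := (mem_orthogonalGroup_iff _ _).mp hk
  have : x • (1 : Mx N) - k * X * kᵀ = k * (x • 1 - X) * kᵀ := by
    rw [mul_sub, sub_mul, mul_smul_comm, smul_mul_assoc, mul_one, h]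
  rw [spec, spec, this, det_mul, det_mul, mul_right_comm, ← det_mul, h, det_one, one_mul]

lemma spec_DN : ∀ (N : ℕ) (a : ℕ → ℝ) (x : ℝ),
    spec (DN N a) x = (∏ j ∈ Finset.range (N / 2), (x ^ 2 + a j ^ 2)) * x ^ (N % 2) := by
  intro N
  induction N using Nat.twoStepInduction with
  | zero => intro a x; simp [spec]
  | one => intro a x; simp [spec, DN]
  | more N ih _ =>
    intro a x
    have ha : a = (fun i => Nat.casesOn i (a 0) (fun i => a (i + 1))) := by
      funext i; cases i <;> rfl
    have h1 : (N + 2) / 2 = N / 2 + 1 := by omega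
    have h2 : (N + 2) % 2 = N % 2 := by omega
    rw [h1, h2, Finset.prod_range_succ', mul_right_comm, ← ih (fun i => a (i + 1)) x]
    unfold spec
    have e0 : (x • (1 : Mx (N + 2)) - DN (N + 2) a).submatrix (e2 N) (e2 N)
        = x • (1 : Mx (N + 2)).submatrix (e2 N) (e2 N)
          - (DN (N + 2) a).submatrix (e2 N) (e2 N) := rfl
    have e1 : (DN (N + 2) a).submatrix (e2 N) (e2 N)
        = fromBlocks (Jm (a 0)) 0 0 (DN N fun i => a (i + 1)) := by
      rw [← DN_blocks, ← ha]
    rw [← det_submatrix_equiv_self (e2 N), e0, e1, submatrix_one_equiv,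
      ← fromBlocks_one, fromBlocks_smul, sub_eq_add_neg, fromBlocks_neg, fromBlocks_add]
    simp only [smul_zero, neg_zero, add_zero]
    rw [det_fromBlocks_zero₂₁, mul_comm, ← sub_eq_add_neg]
    congr 1
    rw [det_fin_two]
    simp [Jm]
    ring

lemma spec_DN_ex (hm : N / 2 = m) (a : Fin m → ℝ) (x : ℝ) :
    spec (DN N (ex a)) x = (∏ j, (x ^ 2 + a j ^ 2)) * x ^ (N % 2) := by
  subst hm
  rw [spec_DN, Finset.prod_range]
  simp

lemma sorted_unique {a b : Fin m → ℝ} (ha : Antitone a) (hb : Antitone b)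
    (ha0 : ∀ i, 0 ≤ a i) (hb0 : ∀ i, 0 ≤ b i)
    (h : ∀ l : ℕ, 0 < l → ∏ j, ((l : ℝ) ^ 2 + a j ^ 2) = ∏ j, ((l : ℝ) ^ 2 + b j ^ 2)) : a = b := by
  have hp : ∏ j, (Polynomial.X - Polynomial.C (-(a j ^ 2)))
      = ∏ j, (Polynomial.X - Polynomial.C (-(b j ^ 2))) := by
    refine Polynomial.eq_of_infinite_eval_eq _ _ ?_
    refine Set.Infinite.mono (s := Set.range (fun l : ℕ => ((l + 1 : ℕ) : ℝ) ^ 2)) ?_ ?_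
    · rintro _ ⟨l, rfl⟩
      have := h (l + 1) (by omega)
      simpa [Polynomial.eval_prod] using this
    · apply Set.infinite_range_of_injective
      intro x y hxy
      have := (sq_eq_sq₀ (by positivity) (by positivity)).mp hxy
      simpa using this
  have hr := congrArg Polynomial.roots hp
  have key : ∀ c : Fin m → ℝ, (∏ j, (Polynomial.X - Polynomial.C (-(c j ^ 2)))).roots
      = Finset.univ.val.map (fun j => -(c j ^ 2)) := by
    intro c
    rw [← Polynomial.roots_multiset_prod_X_sub_C (Finset.univ.val.map (fun j => -(c j ^ 2))),
      Multiset.map_map]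
    rfl
  rw [key, key, Fin.univ_val_map, Fin.univ_val_map, Multiset.coe_eq_coe] at hr
  have hs : ∀ c : Fin m → ℝ, Antitone c → (∀ i, 0 ≤ c i) →
      (List.ofFn fun j => -(c j ^ 2)).SortedLE := by
    intro c hc hc0
    rw [List.sortedLE_ofFn_iff]
    intro i j hij
    have := pow_le_pow_left₀ (hc0 j) (hc hij) 2
    simpa using this
  have := hr.eq_of_sortedLE (hs a ha ha0) (hs b hb hb0)
  rw [List.ofFn_inj] at this
  funext i
  have := congrFun this i
  have h2 : a i ^ 2 = b i ^ 2 := by linarith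
  exact (sq_eq_sq₀ (ha0 i) (hb0 i)).mp h2

open Polynomial

def wd (β : Fin (m + 1) → ℝ) (j : Fin (m + 1)) : ℝ := ∏ k ∈ Finset.univ.erase j, (β j - β k)

def GG (β : Fin (m + 1) → ℝ) (v : Fin (m + 1) → ℝ) (j : Fin (m + 1)) : ℝ :=
  v 0 * (∏ i : Fin m, (β j - v i.succ)) / wd β j

def BB (β : Fin (m + 1) → ℝ) : Set (Fin (m + 1) → ℝ) :=
  {v | 0 < v 0 ∧ ∀ i : Fin m, β i.succ < v i.succ ∧ v i.succ < β i.castSucc}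

lemma wd_ne {β : Fin (m + 1) → ℝ} (hβ : StrictAnti β) (j : Fin (m + 1)) : wd β j ≠ 0 := by
  refine Finset.prod_ne_zero_iff.mpr fun k hk => ?_
  rw [sub_ne_zero]
  exact fun h => (Finset.ne_of_mem_erase hk) (hβ.injective h).symm

def qq (v : Fin (m + 1) → ℝ) (i : Fin (m + 1)) : ℝ[X] :=
  Fin.cases (∏ l : Fin m, (X - C (v l.succ)))
    (fun i => C (-(v 0)) * ∏ l ∈ Finset.univ.erase i, (X - C (v l.succ))) i

def JJ (β : Fin (m + 1) → ℝ) (v : Fin (m + 1) → ℝ) : Mx (m + 1) :=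
  of fun j i => (wd β j)⁻¹ * (qq v i).eval (β j)

lemma GG_deriv (β v : Fin (m + 1) → ℝ) :
    HasFDerivAt (GG β) (LinearMap.toContinuousLinearMap (Matrix.toLin' (JJ β v))) v := by
  rw [hasFDerivAt_pi']
  intro j
  have h1 : ∀ i : Fin (m + 1), HasFDerivAt (fun v : Fin (m + 1) → ℝ => v i)
    (ContinuousLinearMap.proj i) v := fun i => (ContinuousLinearMap.proj (R := ℝ) (φ := fun _ : Fin (m+1) => ℝ) i).hasFDerivAt
  have h2 := HasFDerivAt.finsetProd (u := Finset.univ) (g := fun (i : Fin m) (v : Fin (m + 1) → ℝ) => β j - v i.succ)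
    (x := v) (fun i _ => (h1 i.succ).const_sub (β j))
  have h3 := ((h1 0).mul h2).mul_const (wd β j)⁻¹
  refine h3.congr_fderiv ?_
  ext w
  simp only [ContinuousLinearMap.coe_comp, Function.comp, ContinuousLinearMap.proj_apply,
    LinearMap.coe_toContinuousLinearMap', Matrix.toLin'_apply, mulVec, dotProduct, Fin.sum_univ_succ,
    JJ, of_apply, qq, Fin.cases_zero, Fin.cases_succ, eval_mul, eval_prod, eval_sub, eval_X, eval_C]
  simp only [_root_.smul_apply, _root_.add_apply, _root_.neg_apply, smul_eq_mul,
    _root_.sum_apply, ContinuousLinearMap.proj_apply]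
  rw [Finset.mul_sum, mul_add, Finset.mul_sum, add_comm]
  congr 1
  · ring
  · refine Finset.sum_congr rfl fun i _ => ?_
    ring

lemma qq_natDegree (v : Fin (m + 1) → ℝ) (i : Fin (m + 1)) : (qq v i).natDegree < m + 1 := by
  cases i using Fin.cases with
  | zero => simp [qq]
  | succ i =>
    simp only [qq, Fin.cases_succ]
    refine lt_of_le_of_lt (natDegree_C_mul_le _ _) ?_
    rw [natDegree_finsetProd_X_sub_C_eq_card]
    have := Finset.card_erase_le (s := (Finset.univ : Finset (Fin m))) (a := i)
    simp at this ⊢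

lemma JJ_det {β v : Fin (m + 1) → ℝ} (hβ : StrictAnti β) (hμ : Function.Injective fun i : Fin m => v i.succ) :
    |(JJ β v).det| = |v 0| ^ m * |(vandermonde fun i : Fin m => v i.succ).det| / |(vandermonde β).det| := by
  let Cm : Mx (m + 1) := of fun l i => (qq v i).coeff l
  let U : Mx (m + 1) := of fun i l =>
    Fin.cases (if l = Fin.last m then 1 else 0) (fun i => v i.succ ^ (l : ℕ)) i
  have hJ : JJ β v = diagonal (fun j => (wd β j)⁻¹) * (vandermonde β * Cm) := by
    ext j i
    rw [diagonal_mul, Matrix.mul_apply]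
    simp only [JJ, of_apply, vandermonde_apply, Cm]
    rw [eval_eq_sum_range' (qq_natDegree v i), Finset.sum_range]
    congr 1
    exact Finset.sum_congr rfl fun _ _ => mul_comm _ _
  have hUC : U * Cm = diagonal (Fin.cases 1 fun i => -(v 0) * ∏ l ∈ Finset.univ.erase i, (v i.succ - v l.succ)) := by
    ext a i
    rw [Matrix.mul_apply]
    cases a using Fin.cases with
    | zero =>
      simp only [U, Cm, of_apply, Fin.cases_zero, ite_mul, one_mul, zero_mul, Finset.sum_ite_eq', Finset.mem_univ, if_true, Fin.val_last]
      cases i using Fin.cases with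
      | zero =>
        simp only [qq, Fin.cases_zero, diagonal_apply_eq]
        have := (monic_prod_X_sub_C (fun l : Fin m => v l.succ) Finset.univ).coeff_natDegree
        rwa [natDegree_finsetProd_X_sub_C_eq_card, Finset.card_univ, Fintype.card_fin] at this
      | succ i =>
        rw [diagonal_apply_ne _ (Fin.succ_ne_zero i).symm]
        apply coeff_eq_zero_of_natDegree_lt
        simp only [qq, Fin.cases_succ]
        refine lt_of_le_of_lt (natDegree_C_mul_le _ _) ?_
        rw [natDegree_finsetProd_X_sub_C_eq_card, Finset.card_erase_of_mem (Finset.mem_univ _)]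
        have := i.pos
        simp; omega
    | succ a =>
      have : ∑ l, U a.succ l * Cm l i = (qq v i).eval (v a.succ) := by
        rw [eval_eq_sum_range' (qq_natDegree v i), Finset.sum_range]
        exact Finset.sum_congr rfl fun _ _ => mul_comm _ _
      rw [this]
      cases i using Fin.cases with
      | zero =>
        rw [diagonal_apply_ne _ (Fin.succ_ne_zero a)]
        simp only [qq, Fin.cases_zero, eval_prod]
        exact Finset.prod_eq_zero (Finset.mem_univ a) (by simp)
      | succ i =>
        simp only [qq, Fin.cases_succ, eval_mul, eval_prod, eval_C]
        by_cases h : a = i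
        · subst h; simp
        · rw [diagonal_apply_ne _ (fun h' => h (Fin.succ_injective _ h'))]
          rw [Finset.prod_eq_zero (Finset.mem_erase.mpr ⟨h, Finset.mem_univ a⟩) (by simp), mul_zero]
  have hU : |U.det| = |(vandermonde fun i : Fin m => v i.succ).det| := by
    rw [det_succ_row_zero]
    simp only [U, of_apply, Fin.cases_zero]
    rw [Finset.sum_eq_single (Fin.last m)]
    · simp only [if_true, mul_one, abs_mul, abs_pow, abs_neg, abs_one, one_pow, one_mul]
      congr 2
      ext i j
      simp [vandermonde_apply, Fin.succAbove_last]
    · intro b _ hb; simp [hb]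
    · simp
  have hdV : ∀ {k : ℕ} (x : Fin k → ℝ), |∏ j, ∏ l ∈ Finset.univ.erase j, (x j - x l)| = |(vandermonde x).det| ^ 2 := by
    intro k x
    rw [det_vandermonde, Finset.abs_prod, Finset.abs_prod, sq]
    have e1 : ∀ j, |∏ l ∈ Finset.univ.erase j, (x j - x l)|
       = (∏ l ∈ Finset.Ioi j, |x l - x j|) * ∏ l ∈ Finset.Iio j, |x l - x j| := by
      intro j
      rw [Finset.abs_prod, ← Finset.prod_union]
      · apply Finset.prod_congr
        · ext l; simp [eq_comm]
        · intro l _; exact abs_sub_comm _ _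
      · rw [Finset.disjoint_left]; intro l h1 h2
        simp at h1 h2; omega
    simp only [e1, Finset.prod_mul_distrib, Finset.abs_prod]
    congr 1
    rw [Finset.prod_sigma', Finset.prod_sigma']
    refine Finset.prod_bij' (fun p _ => ⟨p.2, p.1⟩) (fun p _ => ⟨p.2, p.1⟩) ?_ ?_ ?_ ?_ ?_ <;>
      simp [abs_sub_comm]
  have hdet := congrArg (fun M => |Matrix.det M|) hUC
  simp only [det_mul, abs_mul, hU, det_diagonal, Fin.prod_univ_succ, Fin.cases_zero, Fin.cases_succ, one_mul,
    Finset.prod_mul_distrib, Finset.prod_const, Finset.card_univ, Fintype.card_fin, abs_pow, abs_neg, hdV] at hdet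
  have hne : |(vandermonde fun i : Fin m => v i.succ).det| ≠ 0 := by
    rw [abs_ne_zero]; exact det_vandermonde_ne_zero_iff.mpr hμ
  have hne2 : |(vandermonde β).det| ≠ 0 := by
    rw [abs_ne_zero]; exact det_vandermonde_ne_zero_iff.mpr hβ.injective
  have hC : |Cm.det| = |v 0| ^ m * |(vandermonde fun i : Fin m => v i.succ).det| := by
    field_simp at hdet
    rw [hdet, mul_comm]
  rw [hJ, det_mul, det_mul, det_diagonal, abs_mul, abs_mul, hC, Finset.prod_inv_distrib, abs_inv]
  have := hdV β
  simp only [wd]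
  rw [this]
  field_simp

def QQ (β p : Fin (m + 1) → ℝ) : ℝ[X] := ∑ j, C (p j) * ∏ k ∈ Finset.univ.erase j, (X - C (β k))

lemma QQ_degree (β p : Fin (m + 1) → ℝ) : (QQ β p).degree < ((m + 1 : ℕ) : WithBot ℕ) := by
  have : (QQ β p).natDegree ≤ m := by
    refine natDegree_sum_le_of_forall_le _ _ fun j _ => ?_
    refine (natDegree_C_mul_le _ _).trans ?_
    rw [natDegree_finsetProd_X_sub_C_eq_card, Finset.card_erase_of_mem (Finset.mem_univ _)]
    simp
  refine lt_of_le_of_lt (degree_le_natDegree) ?_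
  exact_mod_cast Nat.lt_succ_of_le this

lemma QQ_eval_node (β p : Fin (m + 1) → ℝ) (j : Fin (m + 1)) :
    (QQ β p).eval (β j) = p j * wd β j := by
  simp only [QQ, eval_finsetSum, eval_mul, eval_C, eval_prod, eval_sub, eval_X]
  rw [Finset.sum_eq_single j]
  · rfl
  · intro b _ hb
    rw [Finset.prod_eq_zero (Finset.mem_erase.mpr ⟨hb.symm, Finset.mem_univ j⟩) (sub_self _), mul_zero]
  · simp

lemma RP_degree (R : ℝ) (μ : Fin m → ℝ) :
    (C R * ∏ i, (X - C (μ i))).degree < ((m + 1 : ℕ) : WithBot ℕ) := by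
  have : (C R * ∏ i, (X - C (μ i))).natDegree ≤ m := by
    refine (natDegree_C_mul_le _ _).trans ?_
    rw [natDegree_finsetProd_X_sub_C_eq_card]
    simp
  refine lt_of_le_of_lt (degree_le_natDegree) ?_
  exact_mod_cast Nat.lt_succ_of_le this

lemma QQ_GG {β : Fin (m + 1) → ℝ} (hβ : StrictAnti β) (v : Fin (m + 1) → ℝ) :
    QQ β (GG β v) = C (v 0) * ∏ i : Fin m, (X - C (v i.succ)) := by
  refine eq_of_degrees_lt_of_eval_index_eq Finset.univ (hβ.injective.injOn) ?_ ?_ (v := β) ?_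
  · simpa using QQ_degree β (GG β v)
  · simpa using RP_degree (v 0) (fun i => v i.succ)
  · intro j _
    rw [QQ_eval_node, GG, div_mul_cancel₀ _ (wd_ne hβ j)]
    simp [eval_prod]

lemma eq_GG_of_QQ {β : Fin (m + 1) → ℝ} (hβ : StrictAnti β) (v p : Fin (m + 1) → ℝ)
    (h : QQ β p = C (v 0) * ∏ i : Fin m, (X - C (v i.succ))) : p = GG β v := by
  funext j
  have := QQ_eval_node β p j
  rw [h] at this
  simp only [eval_mul, eval_C, eval_prod, eval_sub, eval_X] at this
  rw [GG, this, mul_div_cancel_right₀ _ (wd_ne hβ j)]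

lemma QQ_coeff (β p : Fin (m + 1) → ℝ) : (QQ β p).coeff m = ∑ j, p j := by
  simp only [QQ, finsetSum_coeff, coeff_C_mul]
  refine Finset.sum_congr rfl fun j _ => ?_
  have := (monic_prod_X_sub_C β (Finset.univ.erase j)).coeff_natDegree
  rw [natDegree_finsetProd_X_sub_C_eq_card, Finset.card_erase_of_mem (Finset.mem_univ _)] at this
  simp only [Finset.card_univ, Fintype.card_fin, Nat.add_sub_cancel] at this
  rw [this, mul_one]

lemma GG_sum {β : Fin (m + 1) → ℝ} (hβ : StrictAnti β) (v : Fin (m + 1) → ℝ) :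
    ∑ j, GG β v j = v 0 := by
  rw [← QQ_coeff β, QQ_GG hβ, coeff_C_mul]
  have := (monic_prod_X_sub_C (fun i : Fin m => v i.succ) Finset.univ).coeff_natDegree
  rw [natDegree_finsetProd_X_sub_C_eq_card] at this
  simp only [Finset.card_univ, Fintype.card_fin] at this
  rw [this, mul_one]

lemma box_disjoint {β : Fin (m + 1) → ℝ} (hβ : StrictAnti β) {i l : Fin m} {x : ℝ}
    (h1 : β i.succ < x ∧ x < β i.castSucc) (h2 : β l.succ < x ∧ x < β l.castSucc) : i = l := by
  rcases lt_trichotomy i l with h | h | h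
  · have : β l.castSucc ≤ β i.succ := hβ.antitone (by rw [Fin.le_def]; simp; omega)
    linarith [h1.1, h2.2]
  · exact h
  · have : β i.castSucc ≤ β l.succ := hβ.antitone (by rw [Fin.le_def]; simp; omega)
    linarith [h2.1, h1.2]

lemma BB_mu_anti {β : Fin (m + 1) → ℝ} (hβ : StrictAnti β) {v : Fin (m + 1) → ℝ}
    (hv : v ∈ BB β) : StrictAnti (fun i : Fin m => v i.succ) := by
  intro i l h
  have : β l.castSucc ≤ β i.succ := hβ.antitone (by rw [Fin.le_def]; simp; omega)
  have h1 := (hv.2 i).1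
  have h2 := (hv.2 l).2
  show v l.succ < v i.succ
  linarith

lemma GG_injOn {β : Fin (m + 1) → ℝ} (hβ : StrictAnti β) : Set.InjOn (GG β) (BB β) := by
  intro v hv v' hv' h
  have h0 : v 0 = v' 0 := by rw [← GG_sum hβ v, ← GG_sum hβ v', h]
  have hQ := QQ_GG hβ v
  rw [h, QQ_GG hβ v'] at hQ
  replace hQ := hQ.symm
  funext j
  cases j using Fin.cases with
  | zero => exact h0
  | succ i =>
    have := congrArg (eval (v i.succ)) hQ
    simp only [eval_mul, eval_C, eval_prod, eval_sub, eval_X] at this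
    rw [Finset.prod_eq_zero (Finset.mem_univ i) (sub_self (v i.succ)), mul_zero] at this
    rcases mul_eq_zero.mp this.symm with h2 | h2
    · exact absurd h2 hv'.1.ne'
    · obtain ⟨l, _, hl⟩ := Finset.prod_eq_zero_iff.mp h2
      have hl' : v i.succ = v' l.succ := sub_eq_zero.mp hl
      have : i = l := box_disjoint hβ (hv.2 i) (hl' ▸ hv'.2 l)
      rw [hl', this]

lemma prod_sign {ι : Type*} (s : Finset ι) (f : ι → ℝ) (t : Finset ι) [DecidableEq ι] (ht : t ⊆ s)
    (hneg : ∀ i ∈ t, f i < 0) (hpos : ∀ i ∈ s, i ∉ t → 0 < f i) :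
    0 < (-1) ^ t.card * ∏ i ∈ s, f i := by
  rw [← Finset.prod_sdiff ht, mul_left_comm, ← Finset.prod_const, ← Finset.prod_mul_distrib]
  refine mul_pos (Finset.prod_pos fun i hi => ?_) (Finset.prod_pos fun i hi => ?_)
  · rw [Finset.mem_sdiff] at hi; exact hpos i hi.1 hi.2
  · linarith [hneg i hi]

lemma wd_sign {β : Fin (m + 1) → ℝ} (hβ : StrictAnti β) (j : Fin (m + 1)) :
    0 < (-1) ^ (j : ℕ) * wd β j := by
  have := prod_sign (Finset.univ.erase j) (fun k => β j - β k) (Finset.Iio j)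
    (by intro k hk; simp at hk ⊢; exact hk.ne) (by
      intro k hk; have := hβ (Finset.mem_Iio.mp hk); linarith)
    (by
      intro k hk hk2
      have h1 : j < k := by
        have := (Finset.mem_erase.mp hk).1
        simp at hk2; exact lt_of_le_of_ne hk2 this.symm
      have := hβ h1; linarith)
  rwa [Fin.card_Iio] at this

lemma GG_image {β : Fin (m + 1) → ℝ} (hβ : StrictAnti β) :
    GG β '' BB β = {p | ∀ j, 0 < p j} := by
  ext p
  constructor
  · rintro ⟨v, hv, rfl⟩ j
    have h1 := prod_sign Finset.univ (fun i : Fin m => β j - v i.succ)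
      (Finset.univ.filter fun i : Fin m => i.val < j.val) (Finset.subset_univ _) (by
        intro i hi
        have hi : i.val < j.val := by simpa using hi
        have : β j ≤ β i.succ := hβ.antitone (by rw [Fin.le_def]; simp; omega)
        linarith [(hv.2 i).1]) (by
        intro i _ hi
        have hi : j.val ≤ i.val := by simpa using hi
        have : β i.castSucc ≤ β j := hβ.antitone (by rw [Fin.le_def]; simpa using hi)
        linarith [(hv.2 i).2])
    have hcard : (Finset.univ.filter fun i : Fin m => i.val < j.val).card = j.val := by
      rw [Fin.card_filter_val_lt]; have := j.2; omega
    rw [hcard] at h1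
    have h2 := wd_sign hβ j
    have h3 : GG β v j = v 0 * (((-1) ^ (j : ℕ) * ∏ i : Fin m, (β j - v i.succ)) / ((-1) ^ (j : ℕ) * wd β j)) := by
      rw [GG, mul_div_mul_left _ _ (by positivity), mul_div_assoc]
    rw [h3]
    exact mul_pos hv.1 (div_pos h1 h2)
  · intro hp
    have hroot : ∀ i : Fin m, ∃ x, (β i.succ < x ∧ x < β i.castSucc) ∧ (QQ β p).eval x = 0 := by
      intro i
      have hlt : β i.succ < β i.castSucc := hβ (by simp [Fin.lt_def])
      have s1 : 0 < (-1) ^ (i : ℕ) * (QQ β p).eval (β i.castSucc) := by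
        rw [QQ_eval_node, mul_left_comm]
        exact mul_pos (hp _) (by simpa using wd_sign hβ i.castSucc)
      have s2 : (-1) ^ (i : ℕ) * (QQ β p).eval (β i.succ) < 0 := by
        rw [QQ_eval_node, mul_left_comm]
        have := wd_sign hβ i.succ
        rw [Fin.val_succ, pow_succ] at this
        have h2 := mul_pos (hp i.succ) this
        linarith
      obtain ⟨x, hx, hx0⟩ := intermediate_value_Ioo hlt.le
        (f := fun x => (-1) ^ (i : ℕ) * (QQ β p).eval x)
        (Continuous.continuousOn (by fun_prop)) (show (0 : ℝ) ∈ Set.Ioo _ _ from ⟨s2, s1⟩)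
      refine ⟨x, hx, ?_⟩
      simpa using hx0
    choose μ hμ hμ0 using hroot
    let v : Fin (m + 1) → ℝ := Fin.cons (∑ j, p j) μ
    have hv : v ∈ BB β := ⟨Finset.sum_pos (fun j _ => hp j) Finset.univ_nonempty, fun i => hμ i⟩
    have hinj : Function.Injective μ := fun i l h => box_disjoint hβ (hμ i) (h ▸ hμ l)
    refine ⟨v, hv, (eq_GG_of_QQ hβ v p ?_).symm⟩
    show QQ β p = C (∑ j, p j) * ∏ i, (X - C (μ i))
    refine eq_of_degree_sub_lt_of_eval_finset_eq (Finset.univ.image μ) ?_ ?_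
    · rw [Finset.card_image_of_injective _ hinj, Finset.card_univ, Fintype.card_fin]
      rw [degree_lt_iff_coeff_zero]
      intro k hk
      rcases hk.eq_or_lt with rfl | hk
      · rw [coeff_sub, QQ_coeff, coeff_C_mul]
        have := (monic_prod_X_sub_C μ Finset.univ).coeff_natDegree
        rw [natDegree_finsetProd_X_sub_C_eq_card] at this
        simp only [Finset.card_univ, Fintype.card_fin] at this
        rw [this, mul_one, sub_self]
      · rw [coeff_sub, coeff_eq_zero_of_degree_lt, coeff_eq_zero_of_degree_lt, sub_zero]
        · exact lt_of_lt_of_le (RP_degree _ _) (by exact_mod_cast hk)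
        · exact lt_of_lt_of_le (QQ_degree _ _) (by exact_mod_cast hk)
    · intro x hx
      obtain ⟨i, _, rfl⟩ := Finset.mem_image.mp hx
      rw [hμ0]
      simp only [eval_mul, eval_C, eval_prod, eval_sub, eval_X]
      rw [Finset.prod_eq_zero (Finset.mem_univ i) (sub_self (μ i)), mul_zero]

lemma BB_measurable (β : Fin (m + 1) → ℝ) : MeasurableSet (BB β) := by
  refine IsOpen.measurableSet ?_
  have : BB β = {v | 0 < v 0} ∩ ⋂ i : Fin m, {v | β i.succ < v i.succ ∧ v i.succ < β i.castSucc} := by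
    ext v; simp [BB]
  rw [this]
  refine (isOpen_lt continuous_const (continuous_apply _)).inter (isOpen_iInter_of_finite fun i => ?_)
  exact (isOpen_lt continuous_const (continuous_apply i.succ)).inter
    (isOpen_lt (continuous_apply i.succ) continuous_const)

lemma GG_continuous (β : Fin (m + 1) → ℝ) : Continuous (GG β) := by
  unfold GG; fun_prop

lemma cv_integral {β : Fin (m + 1) → ℝ} (hβ : StrictAnti β) (H : (Fin (m + 1) → ℝ) → ℂ) :
    ∫ p in {p | ∀ j, 0 < p j}, H p = ∫ v in BB β,
      (v 0 ^ m * |(vandermonde fun i : Fin m => v i.succ).det| / |(vandermonde β).det|) • H (GG β v) := by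
  rw [← GG_image hβ, integral_image_eq_integral_abs_det_fderiv_smul volume (BB_measurable β)
    (fun v _ => (GG_deriv β v).hasFDerivWithinAt) (GG_injOn hβ)]
  refine setIntegral_congr_fun (BB_measurable β) fun v hv => ?_
  congr 1
  have : (LinearMap.toContinuousLinearMap (Matrix.toLin' (JJ β v))).det = (JJ β v).det := by
    rw [ContinuousLinearMap.det]; simp
  rw [this, JJ_det hβ (BB_mu_anti hβ hv).injective, abs_of_pos hv.1]


lemma DN_sq : ∀ (N : ℕ) (a : ℕ → ℝ), (N % 2 = 1 → a (N / 2) = 0) →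
    DN N a * DN N a = - diagonal (fun i => a (i.val / 2) ^ 2) := by
  intro N
  induction N using Nat.twoStepInduction with
  | zero => intro a _; exact Subsingleton.elim _ _
  | one =>
    intro a h
    ext i j; fin_cases i; fin_cases j; simp [DN, Matrix.mul_apply] at h ⊢; exact h
  | more N ih _ =>
    intro a h
    have ha : a = (fun i => Nat.casesOn i (a 0) (fun i => a (i + 1))) := by
      funext i; cases i <;> rfl
    have e1 : (DN (N + 2) a).submatrix (e2 N) (e2 N)
        = fromBlocks (Jm (a 0)) 0 0 (DN N fun i => a (i + 1)) := by
      rw [← DN_blocks, ← ha]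
    have e3 := ih (fun i => a (i + 1)) (fun h1 => by
      have := h (by omega)
      rwa [show (N + 2) / 2 = N / 2 + 1 by omega] at this)
    have : (DN (N + 2) a * DN (N + 2) a).submatrix (e2 N) (e2 N)
        = (- diagonal (fun i : Fin (N + 2) => a (i.val / 2) ^ 2)).submatrix (e2 N) (e2 N) := by
      rw [← submatrix_mul_equiv _ _ _ (e2 N), e1, fromBlocks_multiply]
      simp only [Matrix.mul_zero, Matrix.zero_mul, add_zero, zero_add]
      rw [e3]
      ext i j
      rcases i with i | i <;> rcases j with j | j
      · fin_cases i <;> fin_cases j <;> simp [Jm, diagonal_apply, sq]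
      · simp [diagonal_apply]
      · simp [diagonal_apply]
      · simp [diagonal_apply]
    have h2 := congrArg (fun M => M.submatrix (e2 N).symm (e2 N).symm) this
    simp only [submatrix_submatrix, Equiv.self_comp_symm, submatrix_id_id] at h2
    exact h2

def EE (N : ℕ) (a : ℕ → ℝ) (x : ℝ) : Mx N :=
  (x • 1 + DN N a) * diagonal (fun i => (x ^ 2 + a (i.val / 2) ^ 2)⁻¹)

lemma EE_inv (N : ℕ) (a : ℕ → ℝ) (h : N % 2 = 1 → a (N / 2) = 0) {x : ℝ} (hx : 0 < x) :
    (x • 1 - DN N a) * EE N a x = 1 := by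
  have h1 : (x • (1 : Mx N) - DN N a) * (x • 1 + DN N a)
      = diagonal (fun i => x ^ 2 + a (i.val / 2) ^ 2) := by
    rw [sub_mul, mul_add, mul_add, DN_sq N a h]
    simp only [smul_mul_assoc, mul_smul_comm, one_mul, mul_one, sub_neg_eq_add]
    ext i j
    by_cases hij : i = j
    · subst hij; simp; ring
    · simp [hij]
  rw [EE, ← Matrix.mul_assoc, h1, diagonal_mul_diagonal, ← diagonal_one]
  congr 1
  funext i
  exact mul_inv_cancel₀ (by positivity)

lemma EE_quad (N : ℕ) (a : ℕ → ℝ) (x : ℝ) (u : Fin N → ℝ) :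
    u ⬝ᵥ (EE N a x *ᵥ u) = ∑ i, u i ^ 2 * (x * (x ^ 2 + a (i.val / 2) ^ 2)⁻¹) := by
  set d : ℕ → ℝ := fun i => (x ^ 2 + a i ^ 2)⁻¹
  have h0 : u ⬝ᵥ ((DN N a * diagonal (fun i : Fin N => d (i.val / 2))) *ᵥ u) = 0 := by
    have : u ⬝ᵥ ((DN N a * diagonal (fun i : Fin N => d (i.val / 2))) *ᵥ u)
       = - (u ⬝ᵥ ((DN N a * diagonal (fun i : Fin N => d (i.val / 2))) *ᵥ u)) := by
      simp only [dotProduct, mulVec, Finset.mul_sum]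
      conv_lhs => rw [Finset.sum_comm]
      rw [← Finset.sum_neg_distrib]
      refine Finset.sum_congr rfl fun i _ => ?_
      rw [← Finset.sum_neg_distrib]
      refine Finset.sum_congr rfl fun j _ => ?_
      rw [mul_diagonal, mul_diagonal]
      have h1 : DN N a j i = - DN N a i j := by
        have := congrFun (congrFun (DN_transpose N a) i) j
        simpa using this
      by_cases h : i.val / 2 = j.val / 2
      · rw [h1, h]; ring
      · have : DN N a i j = 0 := by simp [DN, h]
        rw [h1, this]; ring
    linarith
  rw [EE, add_mul, add_mulVec, dotProduct_add, h0, add_zero, smul_mul_assoc, one_mul]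
  simp only [dotProduct, smul_mulVec, mulVec_diagonal, Pi.smul_apply, smul_eq_mul]
  refine Finset.sum_congr rfl fun i _ => ?_
  ring

def del (X : Mx (N + 1)) : Mx N :=
  X.submatrix Fin.castSucc Fin.castSucc

lemma spec_del (a : ℕ → ℝ) (h : (N + 1) % 2 = 1 → a ((N + 1) / 2) = 0)
    {k : Mx (N + 1)} (hk : k ∈ Og (N + 1))
    {x : ℝ} (hx : 0 < x) :
    spec (del (k * DN (N + 1) a * kᵀ)) x = spec (DN (N + 1) a) x *
      ∑ i, k (Fin.last N) i ^ 2 * (x * (x ^ 2 + a (i.val / 2) ^ 2)⁻¹) := by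
  have hkk := (mem_orthogonalGroup_iff _ _).mp hk
  have hkk' := (mem_orthogonalGroup_iff' _ _).mp hk
  set Y := k * DN (N + 1) a * kᵀ with hY
  set A := x • (1 : Mx (N + 1)) - Y with hA
  have h1 : spec (del Y) x = A.adjugate (Fin.last N) (Fin.last N) := by
    rw [adjugate_fin_succ_eq_det_submatrix]
    have : (-1 : ℝ) ^ ((Fin.last N : ℕ) + (Fin.last N : ℕ)) = 1 := by
      rw [← two_mul]; simp
    rw [this, one_mul, spec]
    congr 1
    ext i j
    simp [hA, del, Fin.succAbove_last, Matrix.one_apply]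
  have hAk : A = k * (x • 1 - DN (N + 1) a) * kᵀ := by
    rw [mul_sub, sub_mul, mul_smul_comm, smul_mul_assoc, mul_one, hkk]
  have h2 : A * (k * EE (N + 1) a x * kᵀ) = 1 := by
    calc A * (k * EE (N + 1) a x * kᵀ) = k * (x • 1 - DN (N + 1) a) * (kᵀ * k) * EE (N + 1) a x * kᵀ := by
          rw [hAk]; simp only [Matrix.mul_assoc]
      _ = 1 := by rw [hkk', Matrix.mul_one, Matrix.mul_assoc k, EE_inv _ _ h hx, Matrix.mul_one, hkk]
  have h3 : A.adjugate = A.det • (k * EE (N + 1) a x * kᵀ) := by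
    calc A.adjugate = A.adjugate * (A * (k * EE (N + 1) a x * kᵀ)) := by rw [h2, Matrix.mul_one]
      _ = _ := by rw [← Matrix.mul_assoc, adjugate_mul, smul_mul_assoc, Matrix.one_mul]
  have h4 : A.det = spec (DN (N + 1) a) x := by
    rw [← spec_conj hk]; rfl
  rw [h1, h3, h4, Matrix.smul_apply, smul_eq_mul, ← EE_quad]
  congr 1
  rw [Matrix.mul_assoc, Matrix.mul_apply]
  rfl

def pw (m : ℕ) (u : Fin N → ℝ) (j : Fin (m + 1)) : ℝ :=
  ∑ i, if i.val / 2 = j.val then u i ^ 2 else 0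

lemma spec_del_pw (hm : N / 2 = m) (a : Fin (m + 1) → ℝ) (h : N % 2 = 0 → a (Fin.last m) = 0)
    {k : Mx (N + 1)} (hk : k ∈ Og (N + 1))
    {x : ℝ} (hx : 0 < x) :
    spec (del (k * DN (N + 1) (ex a) * kᵀ)) x =
      x ^ (N % 2) * ∑ j, pw m (k (Fin.last N)) j * ∏ l ∈ Finset.univ.erase j, (x ^ 2 + a l ^ 2) := by
  have hD : spec (DN (N + 1) (ex a)) x * x = x ^ (N % 2) * ∏ j, (x ^ 2 + a j ^ 2) := by
    rw [spec_DN, Finset.prod_range]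
    rcases Nat.mod_two_eq_zero_or_one N with h0 | h0
    · have h1 : (N + 1) / 2 = m := by omega
      have h2 : (N + 1) % 2 = 1 := by omega
      rw [h2, h0, Fin.prod_univ_castSucc, h h0, pow_zero, pow_one, one_mul, zero_pow two_ne_zero, add_zero, mul_assoc, ← sq]
      congr 1
      subst h1
      refine Finset.prod_congr rfl fun i _ => ?_
      rw [ex_lt a (show i.val < (N + 1) / 2 + 1 by have := i.2; omega)]
      rfl
    · have h1 : (N + 1) / 2 = m + 1 := by omega
      have h2 : (N + 1) % 2 = 0 := by omega
      rw [h2, h0, pow_zero, mul_one, pow_one, mul_comm x]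
      congr 1
      have : ∀ K, K = m + 1 → ∏ i : Fin K, (x ^ 2 + ex a i ^ 2) = ∏ j, (x ^ 2 + a j ^ 2) := by
        rintro K rfl; simp
      exact this _ h1
  rw [spec_del (ex a) (fun h1 => by
    have h2 : (N + 1) / 2 = m := by omega
    have h3 := ex_fin a (Fin.last m)
    rw [h2]; rw [Fin.val_last] at h3; rw [h3]; exact h (by omega)) hk hx]
  have hsum : ∑ i, k (Fin.last N) i ^ 2 * (x * (x ^ 2 + ex a (i.val / 2) ^ 2)⁻¹)
      = x * ∑ j, pw m (k (Fin.last N)) j * (x ^ 2 + a j ^ 2)⁻¹ := by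
    simp only [pw, Finset.sum_mul, Finset.mul_sum]
    rw [Finset.sum_comm]
    refine Finset.sum_congr rfl fun i _ => ?_
    have hi : i.val / 2 < m + 1 := by have := i.2; omega
    rw [Finset.sum_eq_single (⟨i.val / 2, hi⟩ : Fin (m + 1))]
    · simp only [if_true, ex_lt a hi]; ring
    · intro b _ hb
      rw [if_neg]
      · simp
      · intro h1; exact hb (Fin.ext h1.symm)
    · simp
  rw [hsum, ← mul_assoc, hD, mul_assoc, Finset.mul_sum]
  congr 1
  refine Finset.sum_congr rfl fun j _ => ?_
  rw [← Finset.mul_prod_erase _ _ (Finset.mem_univ j)]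
  have : x ^ 2 + a j ^ 2 ≠ 0 := by positivity
  field_simp

lemma del_conj (hm : N / 2 = m) (a : Fin (m + 1) → ℝ) (ha : StrictAnti a) (ha0 : ∀ i, 0 ≤ a i)
    (h : N % 2 = 0 → a (Fin.last m) = 0)
    {k : Mx (N + 1)} (hk : k ∈ Og (N + 1))
    {c : ℝ} (hc : 0 < c) (v : Fin (m + 1) → ℝ) (hv : v ∈ BB (fun j => a j ^ 2))
    (hcv : ∀ j, c * pw m (k (Fin.last N)) j = GG (fun j => a j ^ 2) v j) :
    ∃ l ∈ Og N, del (k * DN (N + 1) (ex a) * kᵀ)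
      = l * DN N (ex (fun i : Fin m => √(v i.succ))) * lᵀ := by
  have hβ : StrictAnti (fun j => a j ^ 2) := fun i j hij => by
    have := ha hij
    exact pow_lt_pow_left₀ this (ha0 j) two_ne_zero
  have hanti : (del (k * DN (N + 1) (ex a) * kᵀ))ᵀ = - del (k * DN (N + 1) (ex a) * kᵀ) := by
    have : (k * DN (N + 1) (ex a) * kᵀ)ᵀ = - (k * DN (N + 1) (ex a) * kᵀ) := by
      rw [transpose_mul, transpose_mul, transpose_transpose, DN_transpose]
      simp [Matrix.mul_assoc]
    rw [del, transpose_submatrix, this]; rfl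
  obtain ⟨b, hb, hb0, l, hl, hX⟩ := normal_form N m hm _ hanti
  have hμpos : ∀ i : Fin m, 0 ≤ v i.succ := fun i => le_of_lt (lt_of_le_of_lt (sq_nonneg _) (hv.2 i).1)
  have hb' : b = fun i : Fin m => √(v i.succ) := by
    refine sorted_unique hb ?_ hb0 (fun i => Real.sqrt_nonneg _) ?_
    · intro i j hij
      exact Real.sqrt_le_sqrt ((BB_mu_anti hβ hv).antitone hij)
    · intro x hx
      have hx' : (0 : ℝ) < x := by exact_mod_cast hx
      have h1 := spec_del_pw hm a h hk hx'
      rw [hX, spec_conj hl, spec_DN_ex hm, mul_comm] at h1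
      have h2 := mul_left_cancel₀ (by positivity) h1
      have h3 : ∀ p : Fin (m + 1) → ℝ, ∑ j, p j * ∏ l ∈ Finset.univ.erase j, ((x : ℝ) ^ 2 + a l ^ 2)
          = (-1) ^ m * (QQ (fun j => a j ^ 2) p).eval (-(x : ℝ) ^ 2) := by
        intro p
        simp only [QQ, Polynomial.eval_finsetSum, Polynomial.eval_mul, Polynomial.eval_C, Polynomial.eval_prod,
          Polynomial.eval_sub, Polynomial.eval_X, Finset.mul_sum]
        refine Finset.sum_congr rfl fun j _ => ?_
        have : (-1 : ℝ) ^ m = ∏ _l ∈ Finset.univ.erase j, (-1 : ℝ) := by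
          rw [Finset.prod_const, Finset.card_erase_of_mem (Finset.mem_univ _)]; simp
        rw [this, mul_left_comm, ← Finset.prod_mul_distrib]
        congr 1
        refine Finset.prod_congr rfl fun l _ => by ring
      have h4 : c * ∏ i, ((x : ℝ) ^ 2 + b i ^ 2) = v 0 * ∏ i : Fin m, ((x : ℝ) ^ 2 + v i.succ) := by
        rw [h2, Finset.mul_sum]
        simp only [← mul_assoc, hcv]
        rw [h3, QQ_GG hβ]
        simp only [Polynomial.eval_mul, Polynomial.eval_C, Polynomial.eval_prod,
          Polynomial.eval_sub, Polynomial.eval_X]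
        rw [mul_left_comm]
        congr 1
        have : (-1 : ℝ) ^ m = ∏ _i : Fin m, (-1 : ℝ) := by simp
        rw [this, ← Finset.prod_mul_distrib]
        refine Finset.prod_congr rfl fun l _ => by ring
      have h5 : v 0 = c := by
        rw [← GG_sum hβ v]
        simp only [← hcv, ← Finset.mul_sum]
        have : ∑ j, pw m (k (Fin.last N)) j = 1 := by
          simp only [pw]
          rw [Finset.sum_comm]
          have hkk := congrFun (congrFun ((mem_orthogonalGroup_iff _ _).mp hk) (Fin.last N)) (Fin.last N)
          rw [Matrix.mul_apply, Matrix.one_apply_eq] at hkk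
          rw [← hkk]
          refine Finset.sum_congr rfl fun i _ => ?_
          have hi : i.val / 2 < m + 1 := by have := i.2; omega
          rw [Finset.sum_eq_single (⟨i.val / 2, hi⟩ : Fin (m + 1))]
          · simp [sq]
          · intro b _ hb
            rw [if_neg]
            intro h1; exact hb (Fin.ext h1.symm)
          · simp
        rw [this, mul_one]
      rw [h5] at h4
      rw [mul_left_cancel₀ hc.ne' h4]
      refine Finset.prod_congr rfl fun i _ => ?_
      rw [Real.sq_sqrt (hμpos i)]
  exact ⟨l, hl, by rw [← hb']; exact hX⟩


lemma lint_cons (F : (Fin (n+1) → ℝ) → ℝ≥0∞) (hF : Measurable F) :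
    ∫⁻ r, F r = ∫⁻ x : ℝ, ∫⁻ r : Fin n → ℝ, F (Fin.cons x r) := by
  have h := (volume_preserving_piFinSuccAbove (fun _ : Fin (n+1) => ℝ) 0).symm
  rw [← h.lintegral_comp hF, Measure.volume_eq_prod, lintegral_prod]
  · simp [MeasurableEquiv.piFinSuccAbove, Fin.insertNth_zero']
    rfl
  · exact (hF.comp (MeasurableEquiv.measurable _)).aemeasurable

lemma lint_sq (f : ℝ → ℝ≥0∞) :
    ∫⁻ x in Set.Ioi (0:ℝ), f (x^2) = ∫⁻ t in Set.Ioi (0:ℝ), eR (1/2 * t ^ (-1/2 : ℝ)) * f t := by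
  have himg : (fun t : ℝ => √t) '' Set.Ioi 0 = Set.Ioi 0 := by
    ext x; constructor
    · rintro ⟨t, ht, rfl⟩; exact Real.sqrt_pos.mpr ht
    · intro hx; exact ⟨x^2, by have : 0 < x := hx; exact Set.mem_Ioi.mpr (by positivity), Real.sqrt_sq (le_of_lt hx)⟩
  have h := lintegral_image_eq_lintegral_abs_deriv_mul (s := Set.Ioi (0:ℝ)) (f := fun t => √t)
    (f' := fun t => 1 / (2 * √t)) measurableSet_Ioi
    (fun x hx => (Real.hasDerivAt_sqrt (ne_of_gt hx)).hasDerivWithinAt)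
    (fun x hx y hy hxy => (Real.sqrt_inj (le_of_lt hx) (le_of_lt hy)).mp hxy) (fun x => f (x^2))
  rw [himg] at h
  rw [h]
  refine setLIntegral_congr_fun measurableSet_Ioi fun t ht => ?_
  have ht : 0 < t := ht
  simp only [Real.sq_sqrt ht.le]
  congr 2
  rw [abs_of_nonneg (by positivity), show (-1/2:ℝ) = -(1/2) by norm_num, Real.rpow_neg ht.le, ← Real.sqrt_eq_rpow]
  field_simp

lemma lint_sq_full (f : ℝ → ℝ≥0∞) (hf : Measurable f) :
    ∫⁻ x : ℝ, f (x^2) = ∫⁻ t in Set.Ioi (0:ℝ), eR (t ^ (-1/2 : ℝ)) * f t := by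
  rw [← lintegral_add_compl _ (measurableSet_Ioi (a := (0:ℝ))), Set.compl_Ioi,
    setLIntegral_congr (Iio_ae_eq_Iic (a := (0:ℝ))).symm]
  have h2 : ∫⁻ x in Set.Iio (0:ℝ), f (x^2) = ∫⁻ x in Set.Ioi (0:ℝ), f (x^2) := by
    have := (Measure.measurePreserving_neg (volume : Measure ℝ)).setLIntegral_comp_preimage
      (measurableSet_Ioi (a := (0:ℝ))) (f := fun x => f (x^2)) (by fun_prop)
    rw [← this]
    simp
  rw [h2, lint_sq, ← lintegral_add_left]
  · refine setLIntegral_congr_fun measurableSet_Ioi fun t ht => ?_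
    try dsimp only
    rw [← add_mul, ← ENNReal.ofReal_add (by have : (0:ℝ) < t := ht; positivity) (by have : (0:ℝ) < t := ht; positivity)]
    congr 2; ring
  · fun_prop

lemma lint_polar (G : ℝ → ℝ≥0∞) (hG : Measurable G) :
    ∫⁻ x : ℝ, ∫⁻ y : ℝ, G (x^2 + y^2) = eR Real.pi * ∫⁻ t in Set.Ioi (0:ℝ), G t := by
  have h := lintegral_comp_polarCoord_symm (fun p : ℝ × ℝ => G (p.1^2 + p.2^2))
  rw [Measure.volume_eq_prod, lintegral_prod _ (by fun_prop)] at h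
  rw [← h]
  have e1 : ∀ p ∈ polarCoord.target, eR p.1 • G ((polarCoord.symm p).1^2 + (polarCoord.symm p).2^2)
      = eR p.1 * G (p.1^2) := by
    intro p _
    rw [polarCoord_symm_apply, smul_eq_mul]
    congr 2
    try dsimp only
    nlinarith [Real.sin_sq_add_cos_sq p.2]
  rw [setLIntegral_congr_fun polarCoord.open_target.measurableSet e1, polarCoord_target,
    ← Measure.prod_restrict, lintegral_prod _ (by fun_prop)]
  simp only [lintegral_const, Measure.restrict_apply MeasurableSet.univ, Set.univ_inter, Real.volume_Ioo]
  rw [lintegral_mul_const _ (by fun_prop)]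
  have h3 := lint_sq (fun t => eR (√t) * G t)
  have h4 : ∫⁻ x in Set.Ioi (0:ℝ), eR (√(x^2)) * G (x^2) = ∫⁻ x in Set.Ioi (0:ℝ), eR x * G (x^2) := by
    refine setLIntegral_congr_fun measurableSet_Ioi fun t ht => ?_
    simp only [Real.sqrt_sq (le_of_lt ht : (0:ℝ) ≤ t)]
  rw [← h4, h3]
  have h5 : ∫⁻ t in Set.Ioi (0:ℝ), eR (1/2 * t ^ (-1/2 : ℝ)) * (eR (√t) * G t)
      = ∫⁻ t in Set.Ioi (0:ℝ), eR (1/2) * G t := by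
    refine setLIntegral_congr_fun measurableSet_Ioi fun t ht => ?_
    have ht : (0:ℝ) < t := ht
    try dsimp only
    rw [← mul_assoc, ← ENNReal.ofReal_mul (by positivity)]
    congr 2
    rw [Real.sqrt_eq_rpow, mul_assoc, ← Real.rpow_add ht]; norm_num
  rw [h5, lintegral_const_mul _ hG, mul_comm, ← mul_assoc, ← ENNReal.ofReal_mul (by linarith [Real.pi_pos])]
  congr 2; ring

def wt (b : Bool) (t : ℝ) : ℝ≥0∞ :=
  (Set.Ioi (0:ℝ)).indicator (fun t => eR (if b then Real.exp (-t) else t ^ (-1/2:ℝ) * Real.exp (-t))) t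

lemma wt_meas (b : Bool) : Measurable (wt b) := by
  unfold wt
  refine Measurable.indicator ?_ measurableSet_Ioi
  cases b <;> simp <;> fun_prop

def Wt (b : Bool) (m : ℕ) (p : Fin (m+1) → ℝ) : ℝ≥0∞ :=
  (∏ i : Fin m, wt true (p i.castSucc)) * wt b (p (Fin.last m))

lemma Wt_meas (b : Bool) (m : ℕ) : Measurable (Wt b m) := by
  have := wt_meas b
  have := wt_meas true
  unfold Wt
  fun_prop

def gd (r : Fin M → ℝ) : ℝ≥0∞ := eR (Real.exp (-∑ i, r i ^ 2))

lemma gd_meas : Measurable (gd (M := M)) := by unfold gd; fun_prop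

lemma pw_meas (m : ℕ) : Measurable (pw (N := M) m) := by
  unfold pw
  refine measurable_pi_lambda _ fun j => Finset.measurable_fun_sum _ fun i _ => ?_
  split_ifs <;> fun_prop

lemma gd_cons (x : ℝ) (r : Fin M → ℝ) :
    gd (Fin.cons x r : Fin (M+1) → ℝ) = eR (Real.exp (-x^2)) * gd r := by
  unfold gd
  rw [← ENNReal.ofReal_mul (Real.exp_nonneg _), ← Real.exp_add]
  simp [Fin.sum_univ_succ]
  ring_nf

lemma pw_cons (m : ℕ) (x y : ℝ) (r : Fin M → ℝ) :
    pw (m+1) (Fin.cons x (Fin.cons y r) : Fin (M+2) → ℝ) = Fin.cons (x^2+y^2) (pw m r) := by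
  ext j
  unfold pw
  rw [Fin.sum_univ_succ, Fin.sum_univ_succ]
  have h1 : ∀ i : Fin M, (i.val + 1 + 1) / 2 = i.val/2 + 1 := fun i => by omega
  refine Fin.cases ?_ (fun j => ?_) j
  · simp [h1]
  · simp [h1]

lemma Wt_cons (b : Bool) (m : ℕ) (s : ℝ) (p : Fin (m+1) → ℝ) :
    Wt b (m+1) (Fin.cons s p) = wt true s * Wt b m p := by
  unfold Wt
  rw [Fin.prod_univ_succ, mul_assoc]
  congr 1

lemma pw_law : ∀ (m : ℕ) (b : Bool) (M : ℕ), M = 2*m + (if b then 2 else 1) →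
    ∃ C : ℝ≥0∞, C ≠ 0 ∧ C ≠ ∞ ∧ ∀ F : (Fin (m+1) → ℝ) → ℝ≥0∞, Measurable F →
      ∫⁻ r : Fin M → ℝ, gd r * F (pw m r) = C * ∫⁻ p, Wt b m p * F p := by
  intro m
  induction m with
  | zero =>
    intro b M hM
    have hR : ∀ F : (Fin (0+1) → ℝ) → ℝ≥0∞, Measurable F → ∫⁻ p, Wt b 0 p * F p
        = ∫⁻ t in Set.Ioi (0:ℝ), eR (if b then Real.exp (-t) else t ^ (-1/2:ℝ) * Real.exp (-t)) * F (fun _ => t) := by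
      intro F hF
      rw [lint_cons _ (show Measurable fun p => Wt b 0 p * F p from (Wt_meas b 0).mul hF), ← lintegral_indicator measurableSet_Ioi]
      refine lintegral_congr fun t => ?_
      rw [Measure.volume_pi_eq_dirac 0, lintegral_dirac]
      have : (Fin.cons t (0 : Fin 0 → ℝ) : Fin (0+1) → ℝ) = fun _ => t := by
        ext i; fin_cases i; rfl
      rw [this]
      simp only [Wt, wt, Set.indicator]
      split_ifs <;> simp
    cases b with
    | true =>
      subst hM
      refine ⟨eR Real.pi, by simp [Real.pi_pos], by simp, fun F hF => ?_⟩
      rw [hR F hF]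
      have hm : Measurable fun r : Fin (2*0+2) → ℝ => gd r * F (pw 0 r) := gd_meas.mul (hF.comp (pw_meas 0))
      change ∫⁻ r : Fin (2*0+2) → ℝ, gd r * F (pw 0 r) = _
      rw [lint_cons _ hm]
      have := lint_polar (fun t => eR (Real.exp (-t)) * F (fun _ => t)) (by fun_prop)
      simp only [if_true]
      rw [← this]
      refine lintegral_congr fun x => ?_
      rw [lint_cons _ (by exact hm.comp (by fun_prop))]
      refine lintegral_congr fun y => ?_
      rw [Measure.volume_pi_eq_dirac 0, lintegral_dirac]
      have e1 : pw 0 (Fin.cons x (Fin.cons y (0 : Fin 0 → ℝ) : Fin (0+1) → ℝ) : Fin (0+2) → ℝ) = fun _ => x^2+y^2 := by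
        ext j; fin_cases j
        simp [pw, Fin.sum_univ_succ]
      rw [gd_cons, gd_cons]
      erw [e1]
      simp only [gd]
      rw [← mul_assoc, ← ENNReal.ofReal_mul (by positivity), ← ENNReal.ofReal_mul (by positivity), ← Real.exp_add]
      simp
      ring_nf
    | false =>
      subst hM
      refine ⟨1, by simp, by simp, fun F hF => ?_⟩
      rw [hR F hF]
      have hm : Measurable fun r : Fin (2*0+1) → ℝ => gd r * F (pw 0 r) := gd_meas.mul (hF.comp (pw_meas 0))
      change ∫⁻ r : Fin (2*0+1) → ℝ, gd r * F (pw 0 r) = _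
      rw [lint_cons _ hm, one_mul]
      have := lint_sq_full (fun t => eR (Real.exp (-t)) * F (fun _ => t)) (by fun_prop)
      simp only [Bool.false_eq_true, if_false]
      have e2 : ∫⁻ t in Set.Ioi (0:ℝ), eR (t ^ (-1/2 : ℝ) * Real.exp (-t)) * F (fun _ => t)
          = ∫⁻ t in Set.Ioi (0:ℝ), eR (t ^ (-1/2 : ℝ)) * (eR (Real.exp (-t)) * F (fun _ => t)) := by
        refine setLIntegral_congr_fun measurableSet_Ioi fun t ht => ?_
        have ht : (0:ℝ) < t := ht
        try dsimp only
        rw [← mul_assoc, ← ENNReal.ofReal_mul (by positivity)]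
      rw [e2, ← this]
      refine lintegral_congr fun x => ?_
      change ∫⁻ r : Fin 0 → ℝ, _ = _
      rw [Measure.volume_pi_eq_dirac 0, lintegral_dirac]
      have e1 : pw 0 (Fin.cons x (0 : Fin 0 → ℝ) : Fin (0+1) → ℝ) = fun _ => x^2 := by
        ext j; fin_cases j
        simp [pw]
      rw [gd_cons]
      erw [e1]
      simp [gd]
  | succ m ih =>
    intro b M hM
    obtain ⟨C, hC0, hCt, hC⟩ := ih b (2*m + (if b then 2 else 1)) rfl
    obtain ⟨M', hM'⟩ : ∃ M', M' = 2*m + (if b then 2 else 1) := ⟨_, rfl⟩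
    rw [← hM'] at hC
    have : M = M' + 2 := by omega
    subst this
    refine ⟨C * eR Real.pi, by simp [Real.pi_pos, hC0], ENNReal.mul_ne_top hCt (by simp), fun F hF => ?_⟩
    have hm : Measurable fun r : Fin (M'+2) → ℝ => gd r * F (pw (m+1) r) := gd_meas.mul (hF.comp (pw_meas _))
    rw [lint_cons _ hm]
    have hG : Measurable fun t : ℝ => ∫⁻ p, Wt b m p * F (Fin.cons t p) := by
      refine Measurable.lintegral_prod_right' (f := fun q : ℝ × (Fin (m+1) → ℝ) => Wt b m q.2 * F (Fin.cons q.1 q.2)) ?_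
      exact ((Wt_meas b m).comp measurable_snd).mul (hF.comp (by fun_prop))
    have key : ∀ x y : ℝ, ∫⁻ r : Fin M' → ℝ, gd (Fin.cons x (Fin.cons y r) : Fin (M'+2) → ℝ) * F (pw (m+1) (Fin.cons x (Fin.cons y r) : Fin (M'+2) → ℝ))
        = C * (eR (Real.exp (-(x^2+y^2))) * ∫⁻ p, Wt b m p * F (Fin.cons (x^2+y^2) p)) := by
      intro x y
      have := hC (fun p => F (Fin.cons (x^2+y^2) p)) (hF.comp (by fun_prop))
      rw [mul_left_comm, ← this, ← lintegral_const_mul _ (show Measurable fun r : Fin M' → ℝ => gd r * F (Fin.cons (x^2+y^2) (pw m r)) from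
        gd_meas.mul (hF.comp (by have := pw_meas (M := M') m; fun_prop)))]
      refine lintegral_congr fun r => ?_
      rw [gd_cons, gd_cons, pw_cons, ← mul_assoc, ← mul_assoc, ← ENNReal.ofReal_mul (by positivity), ← Real.exp_add]
      ring_nf
    have := lint_polar (fun t => C * (eR (Real.exp (-t)) * ∫⁻ p, Wt b m p * F (Fin.cons t p))) (by fun_prop)
    have e1 : ∫⁻ x : ℝ, ∫⁻ r : Fin (M'+1) → ℝ, gd (Fin.cons x r : Fin (M'+2) → ℝ) * F (pw (m+1) (Fin.cons x r : Fin (M'+2) → ℝ))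
      = ∫⁻ x : ℝ, ∫⁻ y : ℝ, C * (eR (Real.exp (-(x^2+y^2))) * ∫⁻ p, Wt b m p * F (Fin.cons (x^2+y^2) p)) := by
      refine lintegral_congr fun x => ?_
      rw [lint_cons _ (by exact hm.comp (by fun_prop))]
      exact lintegral_congr fun y => key x y
    rw [e1, this, lintegral_const_mul _ (by fun_prop), lint_cons _ (show Measurable fun p => Wt b (m+1) p * F p from (Wt_meas b _).mul hF), ← mul_assoc, mul_comm C]
    congr 1
    rw [← lintegral_indicator measurableSet_Ioi]
    refine lintegral_congr fun t => ?_
    simp only [Wt_cons, mul_assoc]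
    rw [lintegral_const_mul _ (show Measurable fun p => Wt b m p * F (Fin.cons t p) from (Wt_meas b m).mul (hF.comp (by fun_prop)))]
    simp only [wt, Set.indicator, if_true]
    split_ifs <;> simp


lemma og_vec_sq {k : Mx M} (hk : k ∈ Og M) (r : Fin M → ℝ) :
    ∑ i, (r ᵥ* k) i ^ 2 = ∑ i, r i ^ 2 := by
  have h1 : ∀ u : Fin M → ℝ, ∑ i, u i ^ 2 = u ⬝ᵥ u := fun u => by simp [dotProduct, sq]
  rw [h1, h1]
  have hk' := (mem_orthogonalGroup_iff (Fin M) ℝ).mp hk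
  calc (r ᵥ* k) ⬝ᵥ (r ᵥ* k) = (r ᵥ* k) ⬝ᵥ (kᵀ *ᵥ r) := by rw [mulVec_transpose]
    _ = (r ᵥ* (k * kᵀ)) ⬝ᵥ r := by rw [dotProduct_mulVec, vecMul_vecMul]
    _ = _ := by rw [show k * kᵀ = 1 from hk', vecMul_one]

lemma og_abs_det {k : Mx M} (hk : k ∈ Og M) : |k.det| = 1 := by
  have hk' : k * kᵀ = 1 := (mem_orthogonalGroup_iff (Fin M) ℝ).mp hk
  have h := congrArg det hk'
  rw [det_mul, det_transpose, det_one, ← abs_mul_abs_self] at h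
  nlinarith [abs_nonneg k.det]

lemma gd_rot {k : Mx M} (hk : k ∈ Og M)
    (F : (Fin M → ℝ) → ℝ≥0∞) (hF : Measurable F) :
    ∫⁻ r, gd r * F (r ᵥ* k) = ∫⁻ r, gd r * F r := by
  have hd := og_abs_det hk
  have hd0 : kᵀ.det ≠ 0 := by rw [det_transpose]; intro h; simp [h] at hd
  have h := Real.map_matrix_volume_pi_eq_smul_volume_pi hd0
  rw [abs_inv, det_transpose, hd, inv_one, ENNReal.ofReal_one, one_smul] at h
  have hm : Measurable (toLin' kᵀ) := by
    exact (LinearMap.continuous_of_finiteDimensional _).measurable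
  conv_rhs => rw [← h, lintegral_map (show Measurable fun r => gd r * F r from gd_meas.mul hF) hm]
  refine lintegral_congr fun r => ?_
  rw [toLin'_apply, mulVec_transpose]
  congr 1
  simp only [gd, og_vec_sq hk]

def nz (r : Fin M → ℝ) : Fin M → ℝ := (√(∑ i, r i ^ 2))⁻¹ • r

lemma nz_meas : Measurable (nz (M := M)) := by unfold nz; fun_prop

lemma og_row_meas (i : Fin M) : Measurable fun k : OG M => k.1 i := by
  have : Measurable fun k : OG M => k.1 := measurable_subtype_coe
  exact (measurable_pi_apply i).comp this

lemma row_law (N : ℕ) : ∀ F : (Fin (N+1) → ℝ) → ℝ≥0∞, Measurable F →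
    ∫⁻ r : Fin (N+1) → ℝ, gd r * F (nz r) = (∫⁻ r : Fin (N+1) → ℝ, gd r) *
      ∫⁻ k, F (k.1 (Fin.last N)) ∂(hK (N+1)) := by
  intro F hF
  have hFn : Measurable fun r => F (nz r) := hF.comp nz_meas
  have hvm : Measurable fun q : OG (N+1) × (Fin (N+1) → ℝ) => q.2 ᵥ* q.1.1 := by
    have : Continuous fun q : OG (N+1) × (Fin (N+1) → ℝ) => q.2 ᵥ* q.1.1 := by fun_prop
    exact this.measurable
  have h1 : ∫⁻ k, (∫⁻ r, gd r * F (nz (r ᵥ* k.1))) ∂(hK (N+1)) = ∫⁻ r : Fin (N+1) → ℝ, gd r * F (nz r) := by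
    rw [lintegral_congr fun k : OG (N+1) => gd_rot k.2 _ hFn]
    simp
  rw [← h1, lintegral_lintegral_swap, ← lintegral_mul_const _ gd_meas]
  · refine lintegral_congr_ae ?_
    have h0 : ∀ᵐ r : Fin (N+1) → ℝ, r ≠ 0 := by
      have : (volume : Measure (Fin (N+1) → ℝ)) {0} = 0 := measure_singleton 0
      rw [← compl_mem_ae_iff] at this
      filter_upwards [this] with r hr using hr
    filter_upwards [h0] with r hr
    rw [lintegral_const_mul]
    · congr 1
      have hs : 0 < ∑ i, r i ^ 2 := by
        obtain ⟨i, hi⟩ := Function.ne_iff.mp hr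
        have : 0 < r i ^ 2 := by have : r i ≠ 0 := hi; positivity
        exact lt_of_lt_of_le this (Finset.single_le_sum (f := fun i => r i ^ 2) (fun _ _ => sq_nonneg _) (Finset.mem_univ i))
      obtain ⟨kr, hkr, hrow⟩ := exists_og_rows ({Fin.last N} : Set (Fin (N+1))) (fun _ => nz r) (by
        intro i hi j hj
        rw [Set.mem_singleton_iff] at hi hj
        subst hi; subst hj
        simp only [if_true, nz, smul_dotProduct, dotProduct_smul, smul_eq_mul]
        have : r ⬝ᵥ r = ∑ i, r i ^ 2 := by simp [dotProduct, sq]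
        rw [this]
        have h2 := Real.mul_self_sqrt hs.le
        have h3 := Real.sqrt_pos.mpr hs
        field_simp
        nlinarith)
      have hrow := hrow _ rfl
      rw [← lintegral_mul_left_eq_self (μ := hK (N+1)) (fun k => F (k.1 (Fin.last N))) ⟨kr, hkr⟩]
      refine lintegral_congr fun k => ?_
      congr 1
      have e1 : nz (r ᵥ* k.1) = nz r ᵥ* k.1 := by
        unfold nz
        rw [og_vec_sq k.2, smul_vecMul]
      rw [e1, ← hrow]
      rfl
    · exact hFn.comp (hvm.comp (measurable_id.prodMk measurable_const))
  · refine Measurable.aemeasurable ?_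
    exact (gd_meas.comp measurable_snd).mul (hFn.comp hvm)

def np (p : Fin (m+1) → ℝ) : Fin (m+1) → ℝ := (∑ j, p j)⁻¹ • p

lemma np_meas : Measurable (np (m := m)) := by unfold np; fun_prop

lemma pw_sum (hm : N / 2 = m) (u : Fin (N+1) → ℝ) : ∑ j, pw m u j = ∑ i, u i ^ 2 := by
  unfold pw
  rw [Finset.sum_comm]
  refine Finset.sum_congr rfl fun i _ => ?_
  have hi : i.val / 2 < m + 1 := by have := i.2; omega
  rw [Finset.sum_eq_single (⟨i.val/2, hi⟩ : Fin (m+1))]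
  · simp
  · intro j _ hj
    rw [if_neg]
    intro h
    exact hj (Fin.ext h.symm)
  · simp

lemma pw_smul (m : ℕ) (c : ℝ) (u : Fin N → ℝ) : pw m (c • u) = c^2 • pw m u := by
  ext j
  simp only [pw, Pi.smul_apply, smul_eq_mul, Finset.mul_sum, mul_ite, mul_zero, mul_pow]

lemma pw_nz (hm : N / 2 = m) (u : Fin (N+1) → ℝ) : pw m (nz u) = np (pw m u) := by
  unfold nz np
  rw [pw_smul, pw_sum hm, inv_pow, Real.sq_sqrt (Finset.sum_nonneg fun _ _ => sq_nonneg _)]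

lemma gd_pos (M : ℕ) : (∫⁻ r : Fin M → ℝ, gd r) ≠ 0 := by
  intro h
  rw [lintegral_eq_zero_iff gd_meas] at h
  have h2 : ∀ᵐ r : Fin M → ℝ, False := by
    filter_upwards [h] with r hr
    simp only [gd, Pi.zero_apply, ENNReal.ofReal_eq_zero] at hr
    exact absurd (Real.exp_pos (-∑ i, r i ^ 2)) (not_lt.mpr hr)
  simp [Filter.eventually_false_iff_eq_bot, ae_eq_bot] at h2
  have := (isOpen_univ (X := Fin M → ℝ)).measure_ne_zero volume Set.univ_nonempty
  simp [h2] at this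

lemma gd_fin (N : ℕ) : (∫⁻ r : Fin N → ℝ, gd r) ≠ ∞ := by
  have h : Integrable fun r : Fin N → ℝ => ∏ i, Real.exp (-1 * r i ^ 2) :=
    Integrable.fintype_prod (f := fun _ x => Real.exp (-1 * x^2)) fun _ => integrable_exp_neg_mul_sq one_pos
  have e : ∀ r : Fin N → ℝ, gd r = eR (∏ i, Real.exp (-1 * r i ^ 2)) := by
    intro r
    rw [gd, ← Real.exp_sum]
    simp
  simp_rw [e]
  exact (h.lintegral_lt_top).ne

lemma pwrow_meas (m : ℕ) : Measurable fun k : OG (N+1) => pw m (k.1 (Fin.last N)) :=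
  (pw_meas m).comp (og_row_meas _)

lemma rowpw_map (hm : N / 2 = m) : ∃ c : ℝ≥0∞, c ≠ 0 ∧ c ≠ ∞ ∧
    (hK (N+1)).map (fun k => pw m (k.1 (Fin.last N))) =
      c • (volume.withDensity (Wt (decide (N % 2 = 1)) m)).map np := by
  obtain ⟨C, hC0, hCt, hC⟩ := pw_law m (decide (N % 2 = 1)) (N+1) (by simp; split_ifs <;> omega)
  refine ⟨(∫⁻ r : Fin (N+1) → ℝ, gd r)⁻¹ * C, ?_, ?_, ?_⟩
  · exact mul_ne_zero (ENNReal.inv_ne_zero.mpr (gd_fin _)) hC0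
  · exact ENNReal.mul_ne_top (ENNReal.inv_ne_top.mpr (gd_pos _)) hCt
  · refine Measure.ext_of_lintegral _ fun F hF => ?_
    rw [lintegral_map hF (pwrow_meas m), lintegral_smul_measure,
      lintegral_map hF np_meas, lintegral_withDensity_eq_lintegral_mul _ (Wt_meas _ _)
        (show Measurable fun p => F (np p) from hF.comp np_meas)]
    have h1 := row_law N (fun u => F (pw m u)) (hF.comp (pw_meas m))
    simp_rw [pw_nz hm] at h1
    rw [hC (fun p => F (np p)) (hF.comp np_meas)] at h1
    rw [smul_eq_mul, mul_assoc]
    simp only [Pi.mul_apply, Function.comp]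
    rw [h1, ← mul_assoc, ENNReal.inv_mul_cancel (gd_pos _) (gd_fin _), one_mul]


def box (β : Fin (m+1) → ℝ) : Set (Fin m → ℝ) := {μ | ∀ i, β i.succ < μ i ∧ μ i < β i.castSucc}

lemma box_measurable (β : Fin (m+1) → ℝ) : MeasurableSet (box β) := by
  have : box β = Set.pi Set.univ fun i => Set.Ioo (β i.succ) (β i.castSucc) := by
    ext; simp [box]
  rw [this]
  exact MeasurableSet.univ_pi fun i => measurableSet_Ioo

def om (b : Bool) (β : Fin (m+1) → ℝ) (μ : Fin m → ℝ) : ℝ :=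
  if b then 1 else (∏ i, μ i) ^ (-1/2 : ℝ) * (∏ i : Fin m, β i.castSucc) ^ (1/2 : ℝ)

def fR (b : Bool) (m : ℕ) (R : ℝ) : ℝ := R ^ m * (Real.exp (-R) * if b then 1 else R ^ (-1/2 : ℝ))

lemma fR_int (b : Bool) (m : ℕ) : 0 < ∫ R in Set.Ioi (0:ℝ), fR b m R := by
  cases b with
  | true =>
    have h := Real.Gamma_eq_integral (s := (m:ℝ)+1) (by positivity)
    have : ∫ R in Set.Ioi (0:ℝ), fR true m R = Real.Gamma (m+1) := by
      rw [h]
      refine setIntegral_congr_fun measurableSet_Ioi fun R hR => ?_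
      simp [fR]; ring
    rw [this]; exact Real.Gamma_pos_of_pos (by positivity)
  | false =>
    have h := Real.Gamma_eq_integral (s := (m:ℝ)+1/2) (by positivity)
    have : ∫ R in Set.Ioi (0:ℝ), fR false m R = Real.Gamma (m+1/2) := by
      rw [h]
      refine setIntegral_congr_fun measurableSet_Ioi fun R hR => ?_
      have hR : (0:ℝ) < R := hR
      simp only [fR, Bool.false_eq_true, if_false]
      rw [show ((m:ℝ) + 1/2 - 1) = m + (-1/2) by ring, Real.rpow_add hR, Real.rpow_natCast]; ring
    rw [this]; exact Real.Gamma_pos_of_pos (by positivity)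

lemma Wt_toReal (b : Bool) (m : ℕ) {p : Fin (m+1) → ℝ} (hp : ∀ j, 0 < p j) :
    (Wt b m p).toReal = Real.exp (-∑ j, p j) * if b then 1 else p (Fin.last m) ^ (-1/2:ℝ) := by
  have h1 : ∀ j, (wt true (p j)).toReal = Real.exp (- p j) := by
    intro j
    rw [wt, Set.indicator_of_mem (show p j ∈ Set.Ioi 0 from hp j)]
    simp [Real.exp_nonneg]
  have h2 : (wt b (p (Fin.last m))).toReal = Real.exp (-p (Fin.last m)) * if b then 1 else p (Fin.last m) ^ (-1/2:ℝ) := by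
    rw [wt, Set.indicator_of_mem (show p (Fin.last m) ∈ Set.Ioi 0 from hp _)]
    have := hp (Fin.last m)
    rw [ENNReal.toReal_ofReal (by split_ifs <;> positivity)]
    split_ifs <;> ring
  rw [Wt, ENNReal.toReal_mul, ENNReal.toReal_prod, h2, Fin.sum_univ_castSucc]
  simp_rw [h1]
  rw [← Real.exp_sum, ← mul_assoc, ← Real.exp_add, neg_add]
  simp

lemma Wt_zero (b : Bool) (m : ℕ) {p : Fin (m+1) → ℝ} (hp : ¬ ∀ j, 0 < p j) : Wt b m p = 0 := by
  have h0 : ∀ b t, ¬ (0:ℝ) < t → wt b t = 0 := fun b t ht => Set.indicator_of_notMem (by simpa using ht) _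
  push Not at hp
  obtain ⟨j, hj⟩ := hp
  unfold Wt
  refine Fin.lastCases (fun hj => ?_) (fun i hj => ?_) j hj
  · rw [h0 b _ (not_lt.mpr hj), mul_zero]
  · rw [Finset.prod_eq_zero (Finset.mem_univ i) (h0 true _ (not_lt.mpr hj)), zero_mul]

lemma Wt_lt_top (b : Bool) (m : ℕ) (p : Fin (m+1) → ℝ) : Wt b m p < ∞ := by
  have h0 : ∀ b t, wt b t < ∞ := by
    intro b t
    unfold wt Set.indicator
    split_ifs <;> simp
  unfold Wt
  exact ENNReal.mul_lt_top (ENNReal.prod_lt_top fun i _ => h0 _ _) (h0 _ _)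

lemma GG_last {β : Fin (m+1) → ℝ} (h0 : β (Fin.last m) = 0) (v : Fin (m+1) → ℝ) :
    GG β v (Fin.last m) = v 0 * ((∏ i : Fin m, v i.succ) * (∏ i : Fin m, β i.castSucc)⁻¹) := by
  have h1 : wd β (Fin.last m) = ∏ i : Fin m, (- β i.castSucc) := by
    unfold wd
    rw [← Finset.prod_image (s := Finset.univ) (g := Fin.castSucc) (f := fun k => - β k)
      (by intro x _ y _ h; exact Fin.castSucc_injective m h)]
    refine Finset.prod_congr ?_ fun k _ => by rw [h0, zero_sub]
    ext k
    simp [Fin.exists_castSucc_eq]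
  rw [GG, h1, h0, Finset.prod_neg]
  simp only [zero_sub]
  rw [Finset.prod_neg]
  have : ((-1:ℝ)) ^ (Finset.univ : Finset (Fin m)).card ≠ 0 := by simp
  rw [mul_div_assoc, mul_div_mul_left _ _ this, div_eq_mul_inv]

lemma int_split (f : ℝ → ℂ) (g : (Fin m → ℝ) → ℂ) :
    ∫ v : Fin (m+1) → ℝ, f (v 0) * g (fun i => v i.succ) = (∫ x, f x) * ∫ μ, g μ := by
  have h := (volume_preserving_piFinSuccAbove (fun _ : Fin (m+1) => ℝ) 0)
  rw [← integral_prod_mul, ← Measure.volume_eq_prod, ← h.integral_comp' ]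
  rfl

lemma int_BB (β : Fin (m+1) → ℝ) (f : ℝ → ℂ) (g : (Fin m → ℝ) → ℂ) :
    ∫ v in BB β, f (v 0) * g (fun i => v i.succ) = (∫ x in Set.Ioi 0, f x) * ∫ μ in box β, g μ := by
  rw [← integral_indicator (BB_measurable β), ← integral_indicator measurableSet_Ioi,
    ← integral_indicator (box_measurable β), ← int_split]
  refine integral_congr_ae (evf fun v => ?_)
  simp only [Set.indicator, BB, box, Set.mem_setOf_eq, Set.mem_Ioi]
  by_cases h1 : 0 < v 0 <;> by_cases h2 : ∀ (i : Fin m), β i.succ < v i.succ ∧ v i.succ < β i.castSucc <;> simp [h1, h2]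

lemma step_int (hm : N / 2 = m) : ∃ c : ℝ, 0 < c ∧ ∀ a : Fin (m+1) → ℝ, StrictAnti a → (∀ i, 0 ≤ a i) →
    (N % 2 = 0 → a (Fin.last m) = 0) → ∀ H : Mx N → ℂ,
    (∀ X, ∀ l ∈ Og N, H (l * X * lᵀ) = H X) → ∀ h0 : (Fin m → ℝ) → ℂ, Measurable h0 →
    (∀ μ ∈ box (fun j => a j ^ 2), H (DN N (ex fun i => √(μ i))) = h0 μ) →
    ∫ k, H (del (k.1 * DN (N+1) (ex a) * k.1ᵀ)) ∂(hK (N+1)) =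
      c * ∫ μ in box (fun j => a j ^ 2), (((|(vandermonde μ).det| / |(vandermonde fun j => a j ^ 2).det|
        * om (decide (N % 2 = 1)) (fun j => a j ^ 2) μ : ℝ)) : ℂ) * h0 μ := by
  obtain ⟨c, hc0, hct, hc⟩ := rowpw_map hm
  refine ⟨c.toReal * ∫ R in Set.Ioi (0:ℝ), fR (decide (N % 2 = 1)) m R, mul_pos (ENNReal.toReal_pos hc0 hct) (fR_int _ _), ?_⟩
  intro a ha ha0 hlast H hH h0 hh0 hh
  set β : Fin (m+1) → ℝ := fun j => a j ^ 2 with hβdef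
  have hβ : StrictAnti β := fun i j hij => pow_lt_pow_left₀ (ha hij) (ha0 j) two_ne_zero
  have hemb := ContinuousOn.measurableEmbedding (BB_measurable β) (GG_continuous β).continuousOn (GG_injOn hβ)
  obtain ⟨Hp, hHpm, hHp⟩ := hemb.exists_measurable_extend (g := fun v : BB β => h0 (fun i => v.1 i.succ))
    (hh0.comp (measurable_pi_lambda _ fun i => (measurable_pi_apply _).comp measurable_subtype_coe)) (fun _ => ⟨0⟩)
  have hHp' : ∀ v ∈ BB β, Hp (GG β v) = h0 (fun i => v i.succ) := fun v hv => congrFun hHp ⟨v, hv⟩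
  have hpos : ∀ᵐ k ∂(hK (N+1)), ∀ j, 0 < pw m (k.1 (Fin.last N)) j := by
    have hS : MeasurableSet {p : Fin (m+1) → ℝ | ∀ j, 0 < p j} := by
      rw [Set.ofPred_forall]
      exact MeasurableSet.iInter fun j => measurableSet_lt measurable_const (measurable_pi_apply j)
    have h1 : ∀ᵐ p ∂((hK (N+1)).map (fun k => pw m (k.1 (Fin.last N)))), ∀ j, 0 < p j := by
      rw [hc]
      refine Measure.ae_smul_measure ?_ _
      rw [ae_map_iff np_meas.aemeasurable hS, ae_withDensity_iff (Wt_meas _ _)]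
      refine evf fun p hp => ?_
      have hp' : ∀ j, 0 < p j := by
        by_contra hcon
        exact hp (Wt_zero _ _ hcon)
      intro j
      have : 0 < ∑ j, p j := Finset.sum_pos (fun j _ => hp' j) Finset.univ_nonempty
      simp only [np, Pi.smul_apply, smul_eq_mul]
      exact mul_pos (inv_pos.mpr this) (hp' j)
    exact ae_of_ae_map (pwrow_meas m).aemeasurable h1
  have e1 : ∫ k, H (del (k.1 * DN (N+1) (ex a) * k.1ᵀ)) ∂(hK (N+1)) = ∫ k, Hp (pw m (k.1 (Fin.last N))) ∂(hK (N+1)) := by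
    refine integral_congr_ae ?_
    filter_upwards [hpos] with k hk
    have : pw m (k.1 (Fin.last N)) ∈ GG β '' BB β := by rw [GG_image hβ]; exact hk
    obtain ⟨v, hv, hvp⟩ := this
    obtain ⟨l, hl, hdel⟩ := del_conj hm a ha ha0 hlast k.2 one_pos v hv (fun j => by rw [one_mul, ← hvp])
    rw [hdel, hH _ _ hl, hh (fun i => v i.succ) (fun i => hv.2 i), ← hHp' v hv, hvp]
  have e2 : ∫ k, Hp (pw m (k.1 (Fin.last N))) ∂(hK (N+1)) =
      c.toReal • ∫ p, (Wt (decide (N % 2 = 1)) m p).toReal • Hp (np p) := by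
    have := integral_map (μ := hK (N+1)) (pwrow_meas m).aemeasurable (f := Hp) hHpm.aestronglyMeasurable
    rw [← this, hc, integral_smul_measure, integral_map np_meas.aemeasurable hHpm.aestronglyMeasurable,
      integral_withDensity_eq_integral_toReal_smul (Wt_meas _ _) (evf fun p => Wt_lt_top _ _ p)]
  have e3 : ∫ p, (Wt (decide (N % 2 = 1)) m p).toReal • Hp (np p) =
      ∫ p in {p : Fin (m+1) → ℝ | ∀ j, 0 < p j}, (Wt (decide (N % 2 = 1)) m p).toReal • Hp (np p) := by
    symm
    refine setIntegral_eq_integral_of_forall_compl_eq_zero fun p hp => ?_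
    rw [Wt_zero _ _ hp]; simp
  rw [e1, e2, e3, cv_integral hβ]
  have e4 : ∫ v in BB β, (v 0 ^ m * |(vandermonde fun i : Fin m => v i.succ).det| / |(vandermonde β).det|) •
      ((Wt (decide (N % 2 = 1)) m (GG β v)).toReal • Hp (np (GG β v))) =
      ∫ v in BB β, ((fR (decide (N % 2 = 1)) m (v 0) : ℝ) : ℂ) * ((((|(vandermonde fun i : Fin m => v i.succ).det| / |(vandermonde β).det|
        * om (decide (N % 2 = 1)) β (fun i : Fin m => v i.succ) : ℝ)) : ℂ) * h0 (fun i : Fin m => v i.succ)) := by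
    refine setIntegral_congr_fun (BB_measurable β) fun v hv => ?_
    have hG : ∀ j, 0 < GG β v j := by
      have : GG β v ∈ GG β '' BB β := ⟨v, hv, rfl⟩
      rw [GG_image hβ] at this; exact this
    have hnp : Hp (np (GG β v)) = h0 (fun i => v i.succ) := by
      have h1 : (Fin.cons 1 (fun i : Fin m => v i.succ) : Fin (m+1) → ℝ) ∈ BB β := by
        refine ⟨by simp, fun i => by simpa using hv.2 i⟩
      have h2 := hHp' _ h1
      simp only [Fin.cons_succ] at h2
      rw [← h2]
      congr 1
      ext j
      have := hv.1
      rw [np, GG_sum hβ]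
      simp only [Pi.smul_apply, smul_eq_mul, GG, Fin.cons_zero, Fin.cons_succ]
      field_simp
    have hW : (Wt (decide (N % 2 = 1)) m (GG β v)).toReal = (Real.exp (-v 0) * if decide (N % 2 = 1) then 1 else (v 0) ^ (-1/2 : ℝ)) *
        om (decide (N % 2 = 1)) β (fun i : Fin m => v i.succ) := by
      rw [Wt_toReal _ _ hG, GG_sum hβ, mul_assoc]
      congr 1
      by_cases hN : N % 2 = 1
      · simp [hN, om]
      · have hN0 : N % 2 = 0 := by omega
        have hb0 : β (Fin.last m) = 0 := by simp [hβdef, hlast hN0]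
        simp only [hN, decide_false, Bool.false_eq_true, if_false, om]
        rw [GG_last hb0]
        have hβn : ∀ i, 0 ≤ β i := fun i => sq_nonneg _
        have h1 : 0 ≤ ∏ i : Fin m, v i.succ := Finset.prod_nonneg fun i _ => (lt_of_le_of_lt (hβn _) (hv.2 i).1).le
        have h2 : 0 ≤ ∏ i : Fin m, β i.castSucc := Finset.prod_nonneg fun i _ => hβn _
        rw [Real.mul_rpow hv.1.le (by positivity), Real.mul_rpow h1 (by positivity), Real.inv_rpow h2, ← Real.rpow_neg h2]
        norm_num
    rw [hnp, hW]
    simp only [fR, Complex.real_smul]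
    push_cast
    ring
  rw [e4, int_BB (f := fun x => ((fR (decide (N % 2 = 1)) m x : ℝ) : ℂ))
    (g := fun μ => (((|(vandermonde μ).det| / |(vandermonde β).det|
        * om (decide (N % 2 = 1)) β μ : ℝ)) : ℂ) * h0 μ), integral_complex_ofReal, Complex.real_smul]
  push_cast
  ring


instance ogSC (N : ℕ) : SecondCountableTopology (OG N) :=
  TopologicalSpace.Subtype.secondCountableTopology _

lemma det_int (f : Fin m → ℝ → ℂ) (ν : Fin m → Measure ℝ) [∀ i, SigmaFinite (ν i)]
    (hf : ∀ i j, Integrable (f j) (ν i)) :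
    ∫ μ, (of fun i j => f j (μ i)).det ∂(Measure.pi ν) = (of fun i j => ∫ x, f j x ∂(ν i)).det := by
  simp_rw [← det_transpose (of fun i j => f j _), ← det_transpose (of fun i j => ∫ x, f j x ∂(ν i)), det_apply']
  simp only [transpose_apply, of_apply]
  rw [integral_finsetSum]
  · refine Finset.sum_congr rfl fun σ _ => ?_
    rw [integral_const_mul]
    congr 1
    rw [integral_fintype_prod_eq_prod (μ := ν) (f := fun i x => f (σ i) x)]
  · intro σ _
    refine Integrable.const_mul ?_ _
    exact Integrable.fintype_prod (f := fun i x => f (σ i) x) fun i => hf i (σ i)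

lemma det_diff (x : Fin (m+1) → Fin m → ℂ) :
    (of fun i j : Fin m => x i.castSucc j - x i.succ j).det =
      (of fun i j : Fin (m+1) => (Fin.snoc (x i) 1 : Fin (m+1) → ℂ) j).det := by
  let B : Matrix (Fin (m+1)) (Fin (m+1)) ℂ := of fun i j => Fin.cases ((Fin.snoc (x 0) 1 : Fin (m+1) → ℂ) j)
    (fun i => (Fin.snoc (fun j => x i.succ j - x i.castSucc j) 0 : Fin (m+1) → ℂ) j) i
  have h1 : (of fun i j : Fin (m+1) => (Fin.snoc (x i) 1 : Fin (m+1) → ℂ) j).det = B.det := by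
    refine det_eq_of_forall_row_eq_smul_add_pred (fun _ => 1) (fun j => by simp [B]) (fun i j => ?_)
    refine Fin.lastCases ?_ (fun j => ?_) j
    · simp [B]
    · simp [B]
  rw [h1, det_succ_column B (Fin.last m), Fin.sum_univ_succ]
  have h2 : ∀ i : Fin m, B i.succ (Fin.last m) = 0 := fun i => by simp [B]
  have h3 : B 0 (Fin.last m) = 1 := by simp [B]
  simp only [h2, h3, mul_zero, zero_mul, Finset.sum_const_zero, add_zero, mul_one]
  have h4 : B.submatrix (Fin.succAbove 0) (Fin.last m).succAbove = -(of fun i j : Fin m => x i.castSucc j - x i.succ j) := by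
    ext i j
    simp [B]
  rw [h4, det_neg, ← mul_assoc]
  simp [← mul_pow]

def mn (X : Mx N) (r : ℕ) : ℝ :=
  if h : r ≤ N then (X.submatrix (Fin.castLE h) (Fin.castLE h)).det else 1

def chi (e : ℕ → ℂ) (X : Mx N) : ℂ :=
  ∏ j ∈ Finset.range (N / 2), cpw (mn X (2 * (j + 1))) (e j)

lemma cpw_meas (w : ℂ) : Measurable fun t : ℝ => cpw t w := by
  unfold cpw
  refine Measurable.ite (measurableSet_singleton 0) measurable_const ?_
  fun_prop

lemma mn_cont (r : ℕ) : Continuous fun X : Mx N => mn X r := by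
  unfold mn
  split_ifs
  · exact Continuous.matrix_det (by fun_prop)
  · exact continuous_const

lemma chi_meas (e : ℕ → ℂ) : Measurable (chi (N := N) e) := by
  unfold chi
  exact Finset.measurable_fun_prod _ fun j _ => (cpw_meas _).comp (mn_cont _).measurable

lemma cpw_norm {w : ℂ} (hw : w.re = 0) (t : ℝ) : ‖cpw t w‖ ≤ 1 := by
  unfold cpw
  split_ifs
  · simp
  · rw [Complex.norm_exp]; simp [hw]

lemma chi_norm {e : ℕ → ℂ} (he : ∀ j, (e j).re = 0) (X : Mx N) : ‖chi e X‖ ≤ 1 := by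
  unfold chi
  rw [norm_prod]
  exact Finset.prod_le_one (fun _ _ => norm_nonneg _) fun j _ => cpw_norm (he j) _

def sph (e : ℕ → ℂ) (X : Mx N) : ℂ := ∫ k, chi e (k.1 * X * k.1ᵀ) ∂(hK N)

lemma conj_cont : Continuous fun q : OG N × Mx N => q.1.1 * q.2 * q.1.1ᵀ := by fun_prop

lemma sph_conj (e : ℕ → ℂ) (X : Mx N) {l : Mx N}
    (hl : l ∈ Og N) : sph e (l * X * lᵀ) = sph e X := by
  unfold sph
  rw [← integral_mul_right_eq_self (μ := hK N) (fun k => chi e (k.1 * X * k.1ᵀ)) ⟨l, hl⟩]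
  refine integral_congr_ae (evf fun k => ?_)
  simp [Matrix.mul_assoc]

lemma sph_norm {e : ℕ → ℂ} (he : ∀ j, (e j).re = 0) (X : Mx N) : ‖sph e X‖ ≤ 1 := by
  unfold sph
  have := norm_integral_le_of_norm_le_const (μ := hK N) (f := fun k => chi e (k.1 * X * k.1ᵀ)) (C := 1)
    (evf fun k => chi_norm he _)
  simpa using this

def up (l : Mx N) : Mx (N+1) :=
  (fromBlocks l 0 0 (1 : Mx 1)).submatrix finSumFinEquiv.symm finSumFinEquiv.symm

lemma up_og {l : Mx N} (hl : l ∈ Og N) :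
    up l ∈ Og (N+1) := by
  rw [mem_orthogonalGroup_iff] at hl ⊢
  change l * lᵀ = 1 at hl
  change up l * (up l)ᵀ = 1
  rw [up, transpose_submatrix, submatrix_mul_equiv, fromBlocks_transpose, fromBlocks_multiply]
  simp [hl]

lemma del_up (l : Mx N) (Y : Mx (N+1)) :
    del (up l * Y * (up l)ᵀ) = l * del Y * lᵀ := by
  let Y' := Y.submatrix (finSumFinEquiv (m := N) (n := 1)) finSumFinEquiv
  have hY : Y = Y'.submatrix finSumFinEquiv.symm finSumFinEquiv.symm := by
    simp [Y', submatrix_submatrix]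
  have hd : del Y = Y'.toBlocks₁₁ := by
    ext i j; simp [del, Y', toBlocks₁₁]; rfl
  rw [hd]
  conv_lhs => rw [hY, up, transpose_submatrix, submatrix_mul_equiv, submatrix_mul_equiv, ← fromBlocks_toBlocks Y', fromBlocks_transpose, fromBlocks_multiply, fromBlocks_multiply]
  ext i j
  have : ∀ i : Fin N, (finSumFinEquiv (m := N) (n := 1)).symm i.castSucc = Sum.inl i := fun i => by
    rw [Equiv.symm_apply_eq]; rfl
  simp [del, this]

lemma mn_del (Y : Mx (N+1)) {r : ℕ} (hr : r ≤ N) : mn (del Y) r = mn Y r := by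
  unfold mn
  rw [dif_pos hr, dif_pos (by omega)]
  rfl

lemma chi_succ_odd (hN : N % 2 = 0) (e : ℕ → ℂ) (Y : Mx (N+1)) :
    chi e Y = chi e (del Y) := by
  unfold chi
  rw [show (N+1)/2 = N/2 by omega]
  refine Finset.prod_congr rfl fun j hj => ?_
  rw [mn_del Y (by have := Finset.mem_range.mp hj; omega)]

lemma chi_succ_even (hN : N % 2 = 1) (e : ℕ → ℂ) (Y : Mx (N+1)) :
    chi e Y = chi e (del Y) * cpw Y.det (e (N/2)) := by
  unfold chi
  rw [show (N+1)/2 = N/2 + 1 by omega, Finset.prod_range_succ]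
  congr 1
  · refine Finset.prod_congr rfl fun j hj => ?_
    rw [mn_del Y (by have := Finset.mem_range.mp hj; omega)]
  · have h : 2 * (N/2 + 1) = N + 1 := by omega
    rw [h, mn, dif_pos le_rfl]
    rfl

lemma del_cont : Continuous (del (N := N)) := by unfold del; fun_prop

lemma sph_insert {e : ℕ → ℂ} (he : ∀ j, (e j).re = 0) (X : Mx (N+1)) :
    ∫ k, chi e (del (k.1 * X * k.1ᵀ)) ∂(hK (N+1)) = ∫ k, sph e (del (k.1 * X * k.1ᵀ)) ∂(hK (N+1)) := by
  have h1 : ∀ l : OG N, ∫ k, chi e (l.1 * del (k.1 * X * k.1ᵀ) * l.1ᵀ) ∂(hK (N+1)) = ∫ k, chi e (del (k.1 * X * k.1ᵀ)) ∂(hK (N+1)) := by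
    intro l
    rw [← integral_mul_left_eq_self (μ := hK (N+1)) (fun k => chi e (del (k.1 * X * k.1ᵀ))) ⟨up l.1, up_og l.2⟩]
    refine integral_congr_ae (evf fun k => ?_)
    simp only []
    rw [← del_up]
    simp [Matrix.mul_assoc]
  unfold sph
  rw [integral_integral_swap]
  · simp_rw [h1]; simp
  · refine Integrable.of_bound (C := 1) ?_ (evf fun q => chi_norm he _)
    refine Measurable.aestronglyMeasurable ?_
    refine (chi_meas e).comp (Continuous.measurable ?_)
    have := del_cont (N := N)
    fun_prop


lemma cpw_add {t : ℝ} (u v : ℂ) : cpw t (u + v) = cpw t u * cpw t v := by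
  unfold cpw
  split_ifs
  · simp
  · rw [add_mul, Complex.exp_add]

lemma cpw_real {t : ℝ} (ht : 0 < t) (x : ℝ) : cpw t x = ((t ^ x : ℝ) : ℂ) := by
  unfold cpw
  rw [if_neg ht.ne', Real.rpow_def_of_pos ht]
  push_cast
  ring_nf

lemma cpw_cpow {t : ℝ} (ht : 0 ≤ t) {w : ℂ} (hw : w ≠ 0) : cpw t w = (t : ℂ) ^ w := by
  unfold cpw
  split_ifs with h
  · rw [h]; simp [hw]
  · rw [Complex.cpow_def_of_ne_zero (by exact_mod_cast h), Complex.ofReal_log ht, mul_comm]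

lemma cpw_prod (b : Fin m → ℝ) (hb : ∀ i, 0 < b i) (w : ℂ) : cpw (∏ i, b i) w = ∏ i, cpw (b i) w := by
  unfold cpw
  rw [if_neg (Finset.prod_pos fun i _ => hb i).ne', Real.log_prod (fun i _ => (hb i).ne')]
  simp_rw [if_neg (hb _).ne']
  rw [← Complex.exp_sum]
  push_cast
  rw [Finset.mul_sum]

lemma cpw_integrable {b a : ℝ} (hb : 0 ≤ b) (hba : b ≤ a) {q : ℂ} (hq : 0 < q.re) :
    IntegrableOn (fun t : ℝ => cpw t (q - 1)) (Set.Ioo b a) ∧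
    ∫ t in Set.Ioo b a, cpw t (q - 1) = (cpw a q - cpw b q) / q := by
  have hq0 : q ≠ 0 := by intro h; simp [h] at hq
  have h1 : IntervalIntegrable (fun t : ℝ => (t:ℂ) ^ (q - 1)) volume b a :=
    intervalIntegral.intervalIntegrable_cpow' (by simp; linarith)
  have h2 := integral_cpow (a := b) (b := a) (r := q - 1) (Or.inl (by simp; linarith))
  rw [sub_add_cancel] at h2
  have heq : Set.EqOn (fun t : ℝ => (t:ℂ) ^ (q - 1)) (fun t : ℝ => cpw t (q - 1)) (Set.Ioo b a) := by
    intro t ht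
    have ht0 : 0 < t := lt_of_le_of_lt hb ht.1
    simp only [cpw]
    rw [if_neg ht0.ne', Complex.cpow_def_of_ne_zero (by exact_mod_cast ht0.ne'), Complex.ofReal_log ht0.le, mul_comm]
  constructor
  · rw [intervalIntegrable_iff_integrableOn_Ioo_of_le hba] at h1
    exact h1.congr_fun heq measurableSet_Ioo
  · rw [← setIntegral_congr_fun measurableSet_Ioo heq, ← integral_Ioc_eq_integral_Ioo, ← intervalIntegral.integral_of_le hba, h2,
      cpw_cpow (hb.trans hba) hq0, cpw_cpow hb hq0]

lemma box_int {β : Fin (m+1) → ℝ} (hβ : StrictAnti β) (h0 : ∀ i, 0 ≤ β i) (q : Fin m → ℂ) (hq : ∀ j, 0 < (q j).re) :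
    ∫ μ in box β, (of fun i j : Fin m => cpw (μ i) (q j - 1)).det =
      (∏ j, q j)⁻¹ * (of fun i j : Fin (m+1) => (Fin.snoc (fun j => cpw (β i) (q j)) 1 : Fin (m+1) → ℂ) j).det := by
  have hb : box β = Set.pi Set.univ fun i => Set.Ioo (β i.succ) (β i.castSucc) := by
    ext; simp [box]
  have hlt : ∀ i : Fin m, β i.succ ≤ β i.castSucc := fun i => (hβ (Fin.castSucc_lt_succ)).le
  rw [hb, volume_pi, Measure.restrict_pi_pi, det_int (fun j t => cpw t (q j - 1)) _ (fun i j => (cpw_integrable (h0 _) (hlt i) (hq j)).1)]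
  rw [← det_diff (fun i j => cpw (β i) (q j)), ← Finset.prod_inv_distrib, ← det_mul_row]
  congr 1
  ext i j
  simp only [of_apply]
  rw [(cpw_integrable (h0 _) (hlt i) (hq j)).2, div_eq_inv_mul]

def rho (e : ℕ → ℂ) (m j : ℕ) : ℂ := ∑ i ∈ Finset.Ico j m, e i + ((m:ℂ) - 1 - j)

lemma rho_re {e : ℕ → ℂ} (he : ∀ j, (e j).re = 0) (m j : ℕ) : (rho e m j).re = (m:ℝ) - 1 - j := by
  simp [rho, he]

lemma rho_succ (e : ℕ → ℂ) {m j : ℕ} (hj : j ≤ m) : rho e (m+1) j = rho e m j + 1 + e m := by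
  simp only [rho]
  rw [Finset.sum_Ico_succ_top hj]
  push_cast; ring

lemma rho_last (e : ℕ → ℂ) (m : ℕ) : rho e (m+1) m = e m := by
  rw [rho_succ e le_rfl]; simp [rho]

def pf (e : ℕ → ℂ) : ℕ → ℂ
  | 0 => 1
  | N+1 => pf e N * ∏ j : Fin (N/2), (rho e (N/2) j + if N % 2 = 1 then 1 else 1/2)

lemma rho_pos {e : ℕ → ℂ} (he : ∀ j, (e j).re = 0) (j : Fin m) (b : Prop) [Decidable b] :
    0 < (rho e m j + if b then 1 else 1/2).re := by
  have h1 : ((j:ℕ):ℝ) + 1 ≤ m := by exact_mod_cast j.2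
  rw [Complex.add_re, rho_re he]
  split_ifs
  · simp; linarith
  · have : ((1:ℂ)/2).re = 1/2 := by norm_num
    rw [this]; linarith

lemma pf_ne {e : ℕ → ℂ} (he : ∀ j, (e j).re = 0) (N : ℕ) : pf e N ≠ 0 := by
  induction N with
  | zero => simp [pf]
  | succ N ih =>
    rw [pf]
    refine mul_ne_zero ih (Finset.prod_ne_zero_iff.mpr fun j _ h => ?_)
    have := rho_pos he j (N % 2 = 1)
    rw [h] at this
    simp at this

def sform (e : ℕ → ℂ) (β : Fin m → ℝ) : ℂ :=
  (of fun i j : Fin m => cpw (β i) (rho e m j)).det / ((|(vandermonde β).det| : ℝ) : ℂ)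

lemma sform_meas (e : ℕ → ℂ) (m : ℕ) : Measurable (sform e (m := m)) := by
  unfold sform
  refine Measurable.div ?_ ?_
  · simp_rw [det_apply']
    refine Finset.measurable_fun_sum _ fun σ _ => Measurable.const_mul ?_ _
    refine Finset.measurable_fun_prod _ fun i _ => ?_
    exact (cpw_meas _).comp (measurable_pi_apply _)
  · refine Complex.measurable_ofReal.comp ?_
    have : Continuous fun β : Fin m → ℝ => |(vandermonde β).det| := by
      refine continuous_abs.comp (Continuous.matrix_det ?_)
      refine continuous_matrix fun i j => ?_
      simp only [vandermonde_apply]; fun_prop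
    exact this.measurable

lemma vand_ne {β : Fin m → ℝ} (hβ : StrictAnti β) : (vandermonde β).det ≠ 0 :=
  det_vandermonde_ne_zero_iff.mpr hβ.injective

lemma det_lastrow {R : Type*} [CommRing R] (M : Matrix (Fin (m+1)) (Fin (m+1)) R) (j0 : Fin (m+1)) (h : ∀ j ≠ j0, M (Fin.last m) j = 0) :
    M.det = (-1)^(m + j0.val) * M (Fin.last m) j0 * (M.submatrix Fin.castSucc j0.succAbove).det := by
  rw [det_succ_row M (Fin.last m), Finset.sum_eq_single j0]
  · simp [Fin.succAbove_last]
  · intro j _ hj; rw [h j hj]; ring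
  · simp

lemma vand_zero {β : Fin (m+1) → ℝ} (h0 : β (Fin.last m) = 0) :
    |(vandermonde β).det| = |∏ i : Fin m, β i.castSucc| * |(vandermonde fun i : Fin m => β i.castSucc).det| := by
  rw [det_lastrow _ 0 (fun j hj => by
    rw [vandermonde_apply, h0, zero_pow]; exact fun h => hj (Fin.ext h))]
  have : (vandermonde β).submatrix Fin.castSucc (Fin.succAbove 0) = of fun i j : Fin m => β i.castSucc * (vandermonde fun i : Fin m => β i.castSucc) i j := by
    ext i j; simp [vandermonde_apply, pow_succ, mul_comm]
  rw [this, det_mul_column, vandermonde_apply]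
  simp [abs_mul]

lemma step_box (b : Bool) {e : ℕ → ℂ} (he : ∀ j, (e j).re = 0) {β : Fin (m+1) → ℝ} (hβ : StrictAnti β) (h0 : ∀ i, 0 ≤ β i) :
    ∫ μ in box β, (((|(vandermonde μ).det| / |(vandermonde β).det| * om b β μ : ℝ)) : ℂ) * sform e μ =
    (∏ j : Fin m, (rho e m j + if b then 1 else 1/2))⁻¹ * (((|(vandermonde β).det|⁻¹ * (if b then 1 else (∏ i : Fin m, β i.castSucc) ^ (1/2 : ℝ)) : ℝ) : ℂ) *
      (of fun i j : Fin (m+1) => (Fin.snoc (fun j : Fin m => cpw (β i) (rho e m j + if b then 1 else 1/2)) 1 : Fin (m+1) → ℂ) j).det) := by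
  rw [mul_left_comm, ← box_int hβ h0 _ (fun j => rho_pos he j _), ← integral_const_mul]
  refine setIntegral_congr_fun (box_measurable β) fun μ hμ => ?_
  have hpos : ∀ i, 0 < μ i := fun i => lt_of_le_of_lt (h0 _) (hμ i).1
  have hanti : StrictAnti μ := by
    have := BB_mu_anti hβ (v := Fin.cons 1 μ) ⟨by simp, fun i => by simpa using hμ i⟩
    simpa using this
  have hne := abs_ne_zero.mpr (vand_ne hanti)
  have hne' : ((|(vandermonde μ).det| : ℝ) : ℂ) ≠ 0 := by exact_mod_cast hne
  simp only [sform]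
  have key : ((om b β μ : ℝ) : ℂ) * (of fun i j : Fin m => cpw (μ i) (rho e m j)).det =
      (((if b then 1 else (∏ i : Fin m, β i.castSucc) ^ (1/2 : ℝ)) : ℝ) : ℂ) *
      (of fun i j : Fin m => cpw (μ i) ((rho e m j + if b then 1 else 1/2) - 1)).det := by
    cases b with
    | true => simp [om]
    | false =>
      simp only [om, Bool.false_eq_true, if_false]
      have e1 : (fun i j : Fin m => cpw (μ i) ((rho e m j + 1/2) - 1)) = fun i j : Fin m => (((μ i) ^ (-1/2:ℝ) : ℝ) : ℂ) * (of fun i j : Fin m => cpw (μ i) (rho e m j)) i j := by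
        funext i j
        rw [show rho e m j + 1/2 - 1 = ((-1/2:ℝ):ℂ) + rho e m j by push_cast; ring, cpw_add, cpw_real (hpos i)]
        rfl
      rw [e1, det_mul_column, ← Complex.ofReal_prod, Real.finsetProd_rpow _ _ (fun i _ => (hpos i).le)]
      push_cast; ring
  have := congrArg (fun z => (((|(vandermonde β).det|⁻¹:ℝ)):ℂ) * z) key
  push_cast at this ⊢
  rw [mul_assoc (_⁻¹) _ _, ← this]
  field_simp


lemma det_DN_even (hN : N % 2 = 0) (hm : N / 2 = m) (a : Fin m → ℝ) : (DN N (ex a)).det = ∏ j, a j ^ 2 := by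
  have h := spec_DN_ex hm a 0
  rw [spec, zero_smul, zero_sub, det_neg, hN] at h
  have : Even (Fintype.card (Fin N)) := by rw [Fintype.card_fin]; exact Nat.even_iff.mpr hN
  rw [this.neg_one_pow] at h
  simpa using h

lemma det_conj {k : Mx N} (hk : k ∈ Og N) (X : Mx N) :
    (k * X * kᵀ).det = X.det := by
  have h := og_abs_det hk
  rw [det_mul, det_mul, det_transpose]
  have : k.det * k.det = 1 := by rw [← abs_mul_abs_self, h, one_mul]
  linear_combination X.det * this

lemma sform_odd (e : ℕ → ℂ) (β : Fin m → ℝ) (hβ : ∀ i, 0 < β i) (β' : Fin (m+1) → ℝ) (h1 : ∀ i : Fin m, β' i.castSucc = β i)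
    (h0 : β' (Fin.last m) = 0) :
    (((|(vandermonde β').det|⁻¹ * (∏ i : Fin m, β' i.castSucc) ^ (1/2 : ℝ) : ℝ) : ℂ) *
      (of fun i j : Fin (m+1) => (Fin.snoc (fun j : Fin m => cpw (β' i) (rho e m j + 1/2)) 1 : Fin (m+1) → ℂ) j).det) =
    sform e β := by
  rw [vand_zero h0, det_lastrow _ (Fin.last m) (fun j hj => by
    obtain ⟨i, rfl⟩ := Fin.exists_castSucc_eq.mpr hj
    simp [h0, cpw])]
  simp only [of_apply, Fin.snoc_last, Fin.val_last, mul_one]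
  have e1 : (of fun i j : Fin (m+1) => (Fin.snoc (fun j : Fin m => cpw (β' i) (rho e m j + 1/2)) 1 : Fin (m+1) → ℂ) j).submatrix Fin.castSucc (Fin.last m).succAbove
      = of fun i j : Fin m => (((β i) ^ (1/2:ℝ) : ℝ) : ℂ) * (of fun i j : Fin m => cpw (β i) (rho e m j)) i j := by
    ext i j
    simp only [submatrix_apply, of_apply, Fin.succAbove_last, Fin.snoc_castSucc, h1]
    rw [add_comm, cpw_add, ← cpw_real (hβ i)]
    norm_num
  rw [e1, det_mul_column, ← Complex.ofReal_prod, Real.finsetProd_rpow _ _ (fun i _ => (hβ i).le)]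
  simp_rw [h1]
  have hP : 0 < ∏ i, β i := Finset.prod_pos fun i _ => hβ i
  rw [abs_of_pos hP]
  have h2 : (∏ i, β i) ^ (1/2:ℝ) * (∏ i, β i) ^ (1/2:ℝ) = ∏ i, β i := by
    rw [← Real.rpow_add hP]; norm_num
  have h3 : (((∏ i, β i) ^ (1/2:ℝ) : ℝ) : ℂ) * (((∏ i, β i) ^ (1/2:ℝ) : ℝ) : ℂ) = ((∏ i, β i : ℝ) : ℂ) := by exact_mod_cast h2
  rw [sform]
  have hP' : ((∏ i, β i : ℝ) : ℂ) ≠ 0 := by exact_mod_cast hP.ne'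
  generalize (((∏ i, β i) ^ (1/2:ℝ) : ℝ)) = x at h3 ⊢
  have : (-1:ℂ)^(m+m) = 1 := by rw [← two_mul]; simp
  rw [this, one_mul, Complex.ofReal_mul, Complex.ofReal_inv, Complex.ofReal_mul, mul_inv]
  have e4 : ∀ A B P x : ℂ, P ≠ 0 → x * x = P → P⁻¹ * A⁻¹ * x * (x * B) = B / A := by
    intro A B P x hP hx
    calc P⁻¹ * A⁻¹ * x * (x * B) = P⁻¹ * (x * x) * A⁻¹ * B := by ring
      _ = _ := by rw [hx, inv_mul_cancel₀ hP, one_mul]; ring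
  exact e4 _ _ _ _ hP' h3

lemma sform_even (e : ℕ → ℂ) (β : Fin (m+1) → ℝ) (hβ : ∀ i, 0 < β i) :
    (((|(vandermonde β).det|⁻¹ : ℝ) : ℂ) *
      (of fun i j : Fin (m+1) => (Fin.snoc (fun j : Fin m => cpw (β i) (rho e m j + 1)) 1 : Fin (m+1) → ℂ) j).det) *
      cpw (∏ i, β i) (e m) = sform e β := by
  have e1 : (of fun i j : Fin (m+1) => cpw (β i) (rho e (m+1) j)) =
      of fun i j : Fin (m+1) => cpw (β i) (e m) * (of fun i j : Fin (m+1) => (Fin.snoc (fun j : Fin m => cpw (β i) (rho e m j + 1)) 1 : Fin (m+1) → ℂ) j) i j := by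
    ext i j
    refine Fin.lastCases ?_ (fun j => ?_) j
    · simp [rho_last]
    · simp only [of_apply, Fin.snoc_castSucc, Fin.val_castSucc]
      rw [rho_succ e j.2.le, add_comm, cpw_add]
  rw [sform, e1, det_mul_column, cpw_prod β hβ]
  push_cast
  ring

lemma sph_formula (N : ℕ) : ∃ Z : ℝ, 0 < Z ∧ ∀ e : ℕ → ℂ, (∀ j, (e j).re = 0) → ∀ (m : ℕ) (_ : N / 2 = m) (a : Fin m → ℝ),
    StrictAnti a → (∀ i, 0 < a i) → sph e (DN N (ex a)) = Z / pf e N * sform e (fun i => a i ^ 2) := by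
  induction N with
  | zero =>
    refine ⟨1, one_pos, fun e he m hm a ha hpos => ?_⟩
    have hm' : m = 0 := by omega
    subst hm'
    simp [sph, chi, pf, sform]
  | succ N ih =>
    obtain ⟨Z, hZ, hS⟩ := ih
    obtain ⟨c, hc, hstep⟩ := step_int (N := N) rfl
    refine ⟨c * Z, mul_pos hc hZ, fun e he M hM a ha hpos => ?_⟩
    have main : ∀ a' : Fin (N/2+1) → ℝ, StrictAnti a' → (∀ i, 0 ≤ a' i) → (N % 2 = 0 → a' (Fin.last (N/2)) = 0) →
        ∫ k, sph e (del (k.1 * DN (N+1) (ex a') * k.1ᵀ)) ∂(hK (N+1)) = c * (Z / pf e N * ((∏ j : Fin (N/2), (rho e (N/2) j + if decide (N % 2 = 1) then 1 else 1/2))⁻¹ * (((|(vandermonde fun i => a' i ^ 2).det|⁻¹ * (if decide (N % 2 = 1) then 1 else (∏ i : Fin (N/2), a' i.castSucc ^ 2) ^ (1/2 : ℝ)) : ℝ) : ℂ) *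
      (of fun i j : Fin (N/2+1) => (Fin.snoc (fun j : Fin (N/2) => cpw (a' i ^ 2) (rho e (N/2) j + if decide (N % 2 = 1) then 1 else 1/2)) 1 : Fin (N/2+1) → ℂ) j).det))) := by
      intro a' ha' ha0 hl
      have hβ : StrictAnti fun i => a' i ^ 2 := fun i j hij => pow_lt_pow_left₀ (ha' hij) (ha0 j) two_ne_zero
      rw [hstep a' ha' ha0 hl (sph e) (fun X l hl => sph_conj e X hl) (fun μ => Z / pf e N * sform e μ) ((sform_meas e _).const_mul _) ?_]
      · rw [← step_box _ he hβ (fun i => sq_nonneg _)]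
        congr 1
        rw [← integral_const_mul]
        congr 1
        funext μ
        ring
      · intro μ hμ
        have hp : ∀ i, 0 < μ i := fun i => lt_of_le_of_lt (sq_nonneg _) (hμ i).1
        have hanti : StrictAnti μ := by
          have := BB_mu_anti hβ (v := Fin.cons 1 μ) ⟨by simp, fun i => by simpa using hμ i⟩
          simpa using this
        rw [hS e he _ rfl (fun i => √(μ i)) (fun i j hij => Real.sqrt_lt_sqrt (hp j).le (hanti hij)) (fun i => Real.sqrt_pos.mpr (hp i))]
        congr 2
        funext i
        exact Real.sq_sqrt (hp i).le
    rcases Nat.mod_two_eq_zero_or_one N with hN | hN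
    · have hM' : N / 2 = M := by omega
      subst hM'
      let a' : Fin (N/2+1) → ℝ := Fin.snoc a 0
      have ha's : ∀ i : Fin (N/2), a' i.castSucc = a i := fun i => by simp [a']
      have ha'l : a' (Fin.last _) = 0 := by simp [a']
      have hDN : DN (N+1) (ex a) = DN (N+1) (ex a') := DN_congr fun i hi => by
        rw [ex_lt _ (by omega), ex_lt _ (by omega)]
        exact (ha's ⟨i, by omega⟩).symm
      have hanti : StrictAnti a' := by
        intro i j hij
        induction j using Fin.lastCases with
        | last =>
          obtain ⟨i, rfl⟩ := Fin.exists_castSucc_eq.mpr hij.ne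
          rw [ha's, ha'l]; exact hpos i
        | cast j =>
          obtain ⟨i, rfl⟩ := Fin.exists_castSucc_eq.mpr (hij.trans (Fin.castSucc_lt_last j)).ne
          rw [ha's, ha's]; exact ha hij
      have h0 : ∀ i, 0 ≤ a' i := by
        intro i
        induction i using Fin.lastCases with
        | last => rw [ha'l]
        | cast j => rw [ha's]; exact (hpos j).le
      have h1 : sph e (DN (N+1) (ex a)) = ∫ k, chi e (del (k.1 * DN (N+1) (ex a') * k.1ᵀ)) ∂(hK (N+1)) := by
        rw [hDN, sph]
        exact integral_congr_ae (evf fun k => chi_succ_odd hN e _)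
      rw [h1, sph_insert he, main a' hanti h0 (fun _ => ha'l)]
      have hNN : ¬ (N % 2 = 1) := by omega
      simp only [hNN, decide_false, Bool.false_eq_true, if_false]
      rw [sform_odd e (fun i => a i ^ 2) (fun i => pow_pos (hpos i) 2) (fun i => a' i ^ 2) (fun i => by simp only [ha's]) (by simp [ha'l]), pf]
      simp only [hNN, if_false]
      push_cast
      rw [div_mul_eq_div_div]
      ring
    · have hM' : M = N / 2 + 1 := by omega
      subst hM'
      have h1 : sph e (DN (N+1) (ex a)) = (∫ k, chi e (del (k.1 * DN (N+1) (ex a) * k.1ᵀ)) ∂(hK (N+1))) * cpw (∏ i, a i ^ 2) (e (N/2)) := by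
        rw [sph, ← integral_mul_const]
        refine integral_congr_ae (evf fun k => ?_)
        beta_reduce
        rw [chi_succ_even hN e, det_conj k.2, det_DN_even (by omega) hM]
      rw [h1, sph_insert he, main a ha (fun i => (hpos i).le) (by omega)]
      have hs := sform_even e (fun i => a i ^ 2) (fun i => pow_pos (hpos i) 2)
      rw [← hs, pf]
      simp only [hN, decide_true, if_true, mul_one]
      push_cast
      rw [div_mul_eq_div_div]
      ring


section
variable {α β γ ι κ : Type} [Fintype α] [Fintype β] [Fintype γ] [Fintype ι] [Fintype κ]

lemma mp_sum {E : Type} [MeasureSpace E] [SigmaFinite (volume : Measure E)] (e : α ⊕ β ≃ γ) :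
    MeasurePreserving (fun p : (α → E) × (β → E) => (fun g => Sum.elim p.1 p.2 (e.symm g) : γ → E)) volume volume := by
  have h1 := (volume_measurePreserving_sumPiEquivProdPi (fun _ : α ⊕ β => E)).symm
  have h2 := volume_measurePreserving_piCongrLeft (fun _ : γ => E) e
  have h3 := h2.comp h1
  convert h3 using 1
  funext p g
  obtain ⟨s, rfl⟩ := e.surjective g
  simp only [Function.comp, Equiv.symm_apply_apply]
  rw [show ((MeasurableEquiv.piCongrLeft (fun _ : γ => E) e) ((MeasurableEquiv.sumPiEquivProdPi (fun _ : α ⊕ β => E)).symm p)) (e s) = ((MeasurableEquiv.sumPiEquivProdPi (fun _ : α ⊕ β => E)).symm p) s from Equiv.piCongrLeft_apply_apply (fun _ : γ => E) e _ s]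
  cases s <;> rfl

lemma lint_sum {E : Type} [MeasureSpace E] [SigmaFinite (volume : Measure E)] (e : α ⊕ β ≃ γ)
    (F : (γ → E) → ℝ≥0∞) (hF : Measurable F) :
    ∫⁻ u, F u = ∫⁻ a : α → E, ∫⁻ b : β → E, F (fun g => Sum.elim a b (e.symm g)) := by
  rw [← (mp_sum e).lintegral_comp hF, Measure.volume_eq_prod, lintegral_prod]
  exact (hF.comp (mp_sum e).measurable).aemeasurable

lemma lint_cols (e : α ⊕ β ≃ γ) (F : (ι → γ → ℝ) → ℝ≥0∞) (hF : Measurable F) :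
    ∫⁻ u, F u = ∫⁻ a : ι → α → ℝ, ∫⁻ b : ι → β → ℝ, F (fun i g => Sum.elim (a i) (b i) (e.symm g)) := by
  have h1 := (volume_measurePreserving_arrowProdEquivProdArrow (α → ℝ) (β → ℝ) ι).symm
  have h2 := volume_preserving_pi (fun _ : ι => mp_sum (E := ℝ) e)
  have h3 := h2.comp h1
  rw [← h3.lintegral_comp hF, Measure.volume_eq_prod, lintegral_prod]
  · rfl
  · exact (hF.comp h3.measurable).aemeasurable

def bm (e : α ⊕ β ≃ γ) (A : α → α → ℝ) (B : α → β → ℝ) (C : β → α → ℝ) (D : β → β → ℝ) : γ → γ → ℝ :=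
  fun i j => fromBlocks (of A) (of B) (of C) (of D) (e.symm i) (e.symm j)

lemma bm_meas (e : α ⊕ β ≃ γ) : Measurable fun p : ((α → α → ℝ) × (α → β → ℝ)) × ((β → α → ℝ) × (β → β → ℝ)) => bm e p.1.1 p.1.2 p.2.1 p.2.2 := by
  refine measurable_pi_lambda _ fun i => measurable_pi_lambda _ fun j => ?_
  unfold bm
  rcases e.symm i with i | i <;> rcases e.symm j with j | j <;> simp only [fromBlocks_apply₁₁, fromBlocks_apply₁₂, fromBlocks_apply₂₁, fromBlocks_apply₂₂, of_apply] <;> fun_prop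

lemma lint_block (e : α ⊕ β ≃ γ) (F : (γ → γ → ℝ) → ℝ≥0∞) (hF : Measurable F) :
    ∫⁻ u, F u = ∫⁻ A, ∫⁻ B, ∫⁻ C, ∫⁻ D, F (bm e A B C D) := by
  rw [lint_sum e F hF]
  have hm : Measurable fun p : (α → γ → ℝ) × (β → γ → ℝ) => F (fun g => Sum.elim p.1 p.2 (e.symm g)) :=
    hF.comp (mp_sum e).measurable
  rw [lint_cols e _ (Measurable.lintegral_prod_right' hm)]
  refine lintegral_congr fun A => lintegral_congr fun B => ?_
  refine (lint_cols e _ (hm.comp measurable_prodMk_left)).trans ?_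
  refine lintegral_congr fun C => lintegral_congr fun D => ?_
  refine congrArg F ?_
  funext i j
  unfold bm
  rcases hi : e.symm i with i' | i' <;> rcases hj : e.symm j with j' | j' <;> simp [hj]

variable [DecidableEq ι] [DecidableEq κ]

lemma lint_lin {V : Type} [NormedAddCommGroup V] [NormedSpace ℝ V] [FiniteDimensional ℝ V] [MeasureSpace V] [BorelSpace V] [Measure.IsAddHaarMeasure (volume : Measure V)]
    (f : V →ₗ[ℝ] V) (hf : LinearMap.det f ≠ 0) (F : V → ℝ≥0∞) (hF : Measurable F) :
    ∫⁻ x, F x = eR |LinearMap.det f| * ∫⁻ x, F (f x) := by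
  have h := Measure.map_linearMap_addHaar_eq_smul_addHaar (volume : Measure V) hf
  have hfm : Measurable f := f.continuous_of_finiteDimensional.measurable
  rw [← lintegral_map hF hfm, h, lintegral_smul_measure, smul_eq_mul, ← mul_assoc, ← ENNReal.ofReal_mul (abs_nonneg _), ← abs_mul, mul_inv_cancel₀ hf]
  simp

def mulRL (q : Matrix κ κ ℝ) : (ι → κ → ℝ) →ₗ[ℝ] (ι → κ → ℝ) :=
  LinearMap.pi fun i => (Matrix.vecMulLinear q).comp (LinearMap.proj i)

lemma mulRL_det (q : Matrix κ κ ℝ) : LinearMap.det (mulRL (ι := ι) q) = q.det ^ Fintype.card ι := by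
  rw [mulRL, LinearMap.det_pi]
  have : LinearMap.det (Matrix.vecMulLinear q) = q.det := by
    rw [← det_transpose q, ← LinearMap.det_toLin']
    congr 1
    ext i j
    simp [Matrix.vecMul_transpose, ← Matrix.mulVec_transpose]
  simp [this]

lemma lint_mulR (q : Matrix κ κ ℝ) (hq : q.det ≠ 0) (F : (ι → κ → ℝ) → ℝ≥0∞) (hF : Measurable F) :
    ∫⁻ X, F X = eR (|q.det| ^ Fintype.card ι) * ∫⁻ X : ι → κ → ℝ, F (fun i j => (of X * q) i j) := by
  rw [lint_lin (mulRL (ι := ι) q) (by rw [mulRL_det]; exact pow_ne_zero _ hq) F hF, mulRL_det, abs_pow]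
  rfl

def tr (ι κ : Type) : (ι → κ → ℝ) ≃ₗ[ℝ] (κ → ι → ℝ) where
  toFun X := fun i j => X j i
  invFun X := fun i j => X j i
  map_add' _ _ := rfl
  map_smul' _ _ := rfl
  left_inv _ := rfl
  right_inv _ := rfl

lemma lint_mulL (q : Matrix κ κ ℝ) (hq : q.det ≠ 0) (F : (κ → ι → ℝ) → ℝ≥0∞) (hF : Measurable F) :
    ∫⁻ X, F X = eR (|q.det| ^ Fintype.card ι) * ∫⁻ X : κ → ι → ℝ, F (fun i j => (q * of X) i j) := by
  have hd := LinearMap.det_conj (mulRL (ι := ι) qᵀ) (tr ι κ)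
  rw [mulRL_det, det_transpose] at hd
  rw [lint_lin _ (by rw [hd]; exact pow_ne_zero _ hq) F hF, hd, abs_pow]
  congr 1
  refine lintegral_congr fun X => ?_
  congr 1
  funext i j
  simp [tr, mulRL, Matrix.mul_apply, dotProduct, mul_comm]
  rfl
end


lemma null_scale {V : Type} [NormedAddCommGroup V] [NormedSpace ℝ V] [FiniteDimensional ℝ V] [MeasureSpace V] [BorelSpace V] [Measure.IsAddHaarMeasure (volume : Measure V)]
    (q : V → ℝ) (hq : Continuous q) (x0 : V) (h : ∀ x, {t : ℝ | q (x0 + t • x) = 0}.Countable) :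
    ∀ᵐ x, q x ≠ 0 := by
  have hm : MeasurableSet {p : ℝ × V | q (x0 + p.1 • p.2) = 0} :=
    (isClosed_singleton.preimage (show Continuous fun p : ℝ × V => q (x0 + p.1 • p.2) by fun_prop)).measurableSet
  have h1 : ∀ᵐ p : V × ℝ ∂(volume.prod volume), ¬ (q (x0 + p.2 • p.1) = 0) := by
    rw [Measure.ae_prod_iff_ae_ae]
    · refine evf fun x => ?_
      rw [ae_iff]
      simpa using (h x).measure_zero volume
    · exact (hm.preimage measurable_swap).compl
  have h2 : ∀ᵐ p : ℝ × V ∂(volume.prod volume), ¬ (q (x0 + p.1 • p.2) = 0) := by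
    have := (Measure.measurePreserving_swap (μ := (volume : Measure ℝ)) (ν := (volume : Measure V))).quasiMeasurePreserving.ae h1
    simpa using this
  have h3 := Measure.ae_ae_of_ae_prod h2
  have h4 : ∃ t : ℝ, t ≠ 0 ∧ ∀ᵐ x, ¬ (q (x0 + t • x) = 0) := by
    have h5 : ∀ᵐ t : ℝ, t ≠ 0 := by simp [ae_iff]
    obtain ⟨t, ht⟩ := (h3.and h5).exists
    exact ⟨t, ht.2, ht.1⟩
  obtain ⟨t, ht, hx⟩ := h4
  have h6 : ∀ᵐ x, ¬ (q (x0 + x) = 0) := by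
    rw [ae_iff] at hx ⊢
    have : {a | ¬¬q (x0 + t • a) = 0} = (t • ·) ⁻¹' {a | ¬ ¬ q (x0 + a) = 0} := rfl
    rw [this, Measure.addHaar_preimage_smul _ ht, mul_eq_zero] at hx
    refine hx.resolve_left ?_
    simp [ht]
  have h7 := (measurePreserving_add_left (volume : Measure V) (-x0)).quasiMeasurePreserving.ae h6
  simpa using h7

lemma poly_countable (p : Polynomial ℝ) (t0 : ℝ) (h : p.eval t0 ≠ 0) : {t : ℝ | p.eval t = 0}.Countable := by
  have hp : p ≠ 0 := by rintro rfl; simp at h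
  refine ((p.roots.toFinset.finite_toSet).subset fun t ht => ?_).countable
  simp [hp]
  exact ht

lemma det_ae (α : Type) [Fintype α] [DecidableEq α] : ∀ᵐ A : α → α → ℝ, (of A).det ≠ 0 := by
  refine null_scale (fun A : α → α → ℝ => (of A).det) (Continuous.matrix_det continuous_id) (1 : Matrix α α ℝ) fun x => ?_
  have key : ∀ t, (((1 : Matrix α α (Polynomial ℝ)) + (Polynomial.X : Polynomial ℝ) • (of x).map Polynomial.C).det).eval t = ((1 : Matrix α α ℝ) + t • of x).det := by
    intro t
    rw [← Polynomial.coe_evalRingHom, RingHom.map_det]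
    congr 1
    ext i j
    simp [Matrix.one_apply, apply_ite]
    exact mul_comm _ _
  have h := poly_countable _ 0 (by rw [key]; simp)
  simp only [key] at h
  exact h

section
variable {α β : Type} [Fintype α] [Fintype β] [DecidableEq α] [DecidableEq β]

def tb (A : α → α → ℝ) (B : α → β → ℝ) : α → (α ⊕ β) → ℝ := fun i => Sum.elim (A i) (B i)

open scoped MatrixOrder Matrix.Norms.L2Operator in
lemma exists_pk (B : α → β → ℝ) : ∃ p : Matrix α α ℝ, ∃ k ∈ orthogonalGroup (α ⊕ β) ℝ,
    p.det ^ 2 = (1 + of B * (of B)ᵀ).det ∧ 0 < p.det ^ 2 ∧ of (tb (1 : Matrix α α ℝ) B) = of (tb p 0) * k := by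
  have hpd : (1 + of B * (of B)ᵀ).PosDef := by
    refine PosDef.add_posSemidef PosDef.one ?_
    simpa using posSemidef_self_mul_conjTranspose (of B)
  obtain ⟨b, hb⟩ := CStarAlgebra.nonneg_iff_eq_star_mul_self.mp hpd.posSemidef.nonneg
  have hb' : 1 + of B * (of B)ᵀ = bᵀ * b := by rw [hb]; simp [star_eq_conjTranspose]
  have hdet : (bᵀ).det ^ 2 = (1 + of B * (of B)ᵀ).det := by rw [hb', det_mul, det_transpose, sq]
  have hdpos : 0 < (bᵀ).det ^ 2 := by rw [hdet]; exact hpd.det_pos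
  have hu : IsUnit (bᵀ).det := by
    rw [isUnit_iff_ne_zero]; intro h; rw [h] at hdpos; simp at hdpos
  let T : Matrix α (α ⊕ β) ℝ := of (tb (1 : Matrix α α ℝ) B)
  have hTT : T * Tᵀ = 1 + of B * (of B)ᵀ := by
    ext i j
    simp [T, tb, mul_apply, Fintype.sum_sum_type, Matrix.one_apply]
  have hvv : ((bᵀ)⁻¹ * T) * ((bᵀ)⁻¹ * T)ᵀ = 1 := by
    rw [transpose_mul, Matrix.mul_assoc, ← Matrix.mul_assoc T, hTT, hb', Matrix.mul_assoc bᵀ, ← Matrix.mul_assoc, nonsing_inv_mul _ hu, Matrix.one_mul, transpose_nonsing_inv, transpose_transpose, mul_nonsing_inv _ (by simpa using hu)]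
  obtain ⟨k, hk, hkv⟩ := exists_og_rows (ι := α ⊕ β) (Set.range Sum.inl) (fun x => Sum.elim (fun i => ((bᵀ)⁻¹ * T) i) 0 x) (by
    rintro _ ⟨i, rfl⟩ _ ⟨j, rfl⟩
    have := congrFun (congrFun hvv i) j
    rw [mul_apply] at this
    simpa [Matrix.one_apply, dotProduct] using this)
  refine ⟨bᵀ, k, hk, hdet, hdpos, ?_⟩
  have h1 : of (tb bᵀ (0 : α → β → ℝ)) * k = bᵀ * ((bᵀ)⁻¹ * T) := by
    ext i j
    rw [mul_apply, Fintype.sum_sum_type, mul_apply]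
    simp only [of_apply, tb, Sum.elim_inl, Sum.elim_inr, Pi.zero_apply, zero_mul, Finset.sum_const_zero, add_zero]
    refine Finset.sum_congr rfl fun x _ => ?_
    rw [hkv _ ⟨x, rfl⟩]
    rfl
  refine Eq.trans ?_ h1.symm
  rw [← Matrix.mul_assoc, mul_nonsing_inv _ hu, Matrix.one_mul]

lemma tb_meas : Measurable fun p : (α → α → ℝ) × (α → β → ℝ) => tb p.1 p.2 := by
  refine measurable_pi_lambda _ fun i => measurable_pi_lambda _ fun j => ?_
  unfold tb
  rcases j with j | j <;> simp only [Sum.elim_inl, Sum.elim_inr] <;> fun_prop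

lemma mulR_meas {ι κ κ' : Type} [Fintype ι] [Fintype κ] [Fintype κ'] (q : Matrix κ κ' ℝ) : Measurable fun X : ι → κ → ℝ => (fun i j => (of X * q) i j : ι → κ' → ℝ) := by
  refine measurable_pi_lambda _ fun i => measurable_pi_lambda _ fun j => ?_
  simp only [mul_apply, of_apply]
  fun_prop

lemma mul_meas2 {ι κ κ' : Type} [Fintype ι] [Fintype κ] [Fintype κ'] : Measurable fun X : (ι → κ → ℝ) × (κ → κ' → ℝ) => (fun i j => (of X.1 * of X.2) i j : ι → κ' → ℝ) := by
  refine measurable_pi_lambda _ fun i => measurable_pi_lambda _ fun j => ?_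
  simp only [mul_apply, of_apply]
  fun_prop

lemma det_meas {ι : Type} [Fintype ι] [DecidableEq ι] : Measurable fun X : ι → ι → ℝ => (of X).det := by
  have : Continuous fun X : ι → ι → ℝ => (of X).det := by
    refine Continuous.matrix_det ?_
    exact continuous_id
  exact this.measurable

lemma step_top : ∃ c : ℝ≥0∞, ∀ Ψ : (α → (α ⊕ β) → ℝ) → ℝ≥0∞, Measurable Ψ →
    (∀ T, ∀ k ∈ orthogonalGroup (α ⊕ β) ℝ, Ψ (fun i j => (of T * k) i j) = Ψ T) →
    ∫⁻ T, Ψ T = c * ∫⁻ A, eR (|(of A).det| ^ Fintype.card β) * Ψ (tb A 0) := by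
  refine ⟨∫⁻ B : α → β → ℝ, eR ((√((1 + of B * (of B)ᵀ).det) ^ (Fintype.card α + Fintype.card β))⁻¹), fun Ψ hΨ hinv => ?_⟩
  have hm1 : Measurable fun p : (α → α → ℝ) × (α → β → ℝ) => Ψ (tb p.1 p.2) := hΨ.comp tb_meas
  have hm2 : Measurable fun p : (α → α → ℝ) × (α → β → ℝ) => eR (|(of p.1).det| ^ Fintype.card β) * Ψ (tb p.1 (fun i j => (of p.1 * of p.2) i j)) := by
    refine Measurable.mul ?_ ?_
    · exact (((det_meas.comp measurable_fst).abs).pow_const _).ennreal_ofReal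
    · exact hm1.comp (measurable_fst.prodMk mul_meas2)
  have hm3 : Measurable fun A : α → α → ℝ => eR (|(of A).det| ^ Fintype.card β) * Ψ (tb A 0) := by
    refine Measurable.mul ?_ ?_
    · exact (((det_meas).abs).pow_const _).ennreal_ofReal
    · exact hm1.comp (measurable_id.prodMk measurable_const)
  have h0 : ∫⁻ T, Ψ T = ∫⁻ A : α → α → ℝ, ∫⁻ B : α → β → ℝ, eR (|(of A).det| ^ Fintype.card β) * Ψ (tb A (fun i j => (of A * of B) i j)) := by
    rw [lint_cols (Equiv.refl _) Ψ hΨ]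
    refine lintegral_congr_ae ?_
    filter_upwards [det_ae α] with A hA
    rw [lintegral_const_mul _ (show Measurable fun B : α → β → ℝ => Ψ (tb A (fun i j => (of A * of B) i j)) from hm1.comp (measurable_const.prodMk (mul_meas2.comp measurable_prodMk_left)))]
    exact lint_mulL (of A) hA (fun B : α → β → ℝ => Ψ (tb A B)) (hm1.comp measurable_prodMk_left)
  rw [h0, lintegral_lintegral_swap hm2.aemeasurable]
  rw [← lintegral_mul_const]
  · refine lintegral_congr fun B => ?_
    obtain ⟨p, k, hk, hp, hppos, hT⟩ := exists_pk B
    have hp0 : p.det ≠ 0 := by intro h; rw [h] at hppos; simp at hppos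
    have habs : √((1 + of B * (of B)ᵀ).det) = |p.det| := by rw [← hp, Real.sqrt_sq_eq_abs]
    have e1 : ∀ A : α → α → ℝ, Ψ (tb A (fun i j => (of A * of B) i j)) = Ψ (tb (fun i j => (of A * p) i j) 0) := by
      intro A
      rw [← hinv (tb (fun i j => (of A * p) i j) 0) k hk]
      congr 1
      have e2 : of (tb (fun i j => (of A * p) i j) (0 : α → β → ℝ)) = of A * of (tb p 0) := by
        ext i j
        rcases j with j | j <;> simp [tb, mul_apply]
      have e3 : of (tb A (fun i j => (of A * of B) i j)) = of A * of (tb (1 : Matrix α α ℝ) B) := by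
        ext i j
        rcases j with j | j <;> simp [tb, mul_apply, Matrix.one_apply]
      rw [e2, Matrix.mul_assoc]
      exact e3.trans (congrArg (of A * ·) hT)
    simp only [e1]
    rw [lint_mulR p hp0 _ hm3, habs, ← mul_assoc, ← ENNReal.ofReal_mul (by positivity), ← lintegral_const_mul']
    · refine lintegral_congr fun A => ?_
      have : of (fun i j => (of A * p) i j) = of A * p := rfl
      rw [← mul_assoc, ← ENNReal.ofReal_mul (by positivity), this, det_mul, abs_mul]
      congr 2
      have : |p.det| ≠ 0 := abs_ne_zero.mpr hp0
      rw [mul_pow, pow_add]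
      field_simp
    · exact ENNReal.ofReal_ne_top
  · refine ((Measurable.pow_const (Measurable.sqrt ?_) _).inv).ennreal_ofReal
    refine (Continuous.matrix_det ?_).measurable
    fun_prop
end


lemma lint_linequiv {V V' : Type} [NormedAddCommGroup V] [NormedSpace ℝ V] [FiniteDimensional ℝ V] [MeasureSpace V] [BorelSpace V] [Measure.IsAddHaarMeasure (volume : Measure V)]
    [NormedAddCommGroup V'] [NormedSpace ℝ V'] [FiniteDimensional ℝ V'] [MeasureSpace V'] [BorelSpace V'] [Measure.IsAddHaarMeasure (volume : Measure V')]
    (f : V ≃ₗ[ℝ] V') : ∃ c : ℝ≥0∞, ∀ F : V' → ℝ≥0∞, Measurable F → ∫⁻ y, F y = c * ∫⁻ x, F (f x) := by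
  let g : V ≃L[ℝ] V' := f.toContinuousLinearEquiv
  have h1 : (Measure.map g (volume : Measure V)).IsAddHaarMeasure := g.isAddHaarMeasure_map volume
  have h2 := Measure.isAddLeftInvariant_eq_smul (volume : Measure V') (Measure.map g (volume : Measure V))
  refine ⟨(Measure.addHaarScalarFactor (volume : Measure V') (Measure.map g (volume : Measure V)) : ℝ≥0∞), fun F hF => ?_⟩
  have h3 : ∫⁻ y, F y = ∫⁻ y, F y ∂((Measure.addHaarScalarFactor (volume : Measure V') (Measure.map g (volume : Measure V))) • (Measure.map g (volume : Measure V))) := by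
    conv_lhs => rw [h2]
  rw [h3, lintegral_smul_measure, lintegral_map hF g.continuous.measurable]
  rfl

def cEquiv (n : ℕ) : (Fin n → Fin 2 → Fin 2 → ℝ) ≃ₗ[ℝ] (Fin (2 * n) → Fin 2 → ℝ) where
  toFun C := fun i j => C ⟨i.val / 2, by have := i.isLt; omega⟩ ⟨i.val % 2, by omega⟩ j
  invFun C := fun i a j => C ⟨2 * i.val + a.val, by have := i.isLt; omega⟩ j
  map_add' _ _ := rfl
  map_smul' _ _ := rfl
  left_inv C := by
    funext i a j
    have h1 : (2 * i.val + a.val) / 2 = i.val := by omega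
    have h2 : (2 * i.val + a.val) % 2 = a.val := by omega
    simp only [h1, h2]
  right_inv C := by
    funext i j
    have h1 : 2 * (i.val / 2) + i.val % 2 = i.val := by omega
    simp only [h1]

abbrev LT (n : ℕ) := {ij : Fin n × Fin n // ij.2 < ij.1}

def eTf (n : ℕ) : Fin n ⊕ LT n → LT (n+1) :=
  Sum.elim (fun i => ⟨(i.succ, 0), Fin.succ_pos i⟩) (fun ij => ⟨(ij.1.1.succ, ij.1.2.succ), Fin.succ_lt_succ_iff.mpr ij.2⟩)

lemma eTf_bij (n : ℕ) : Function.Bijective (eTf n) := by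
  constructor
  · rintro (i | ⟨⟨i, i'⟩, hi⟩) (j | ⟨⟨j, j'⟩, hj⟩) h
    · simp [eTf] at h; rw [h]
    · simp only [eTf, Sum.elim_inl, Sum.elim_inr, Subtype.mk.injEq, Prod.mk.injEq] at h
      exact absurd h.2.symm (Fin.succ_ne_zero _)
    · simp only [eTf, Sum.elim_inl, Sum.elim_inr, Subtype.mk.injEq, Prod.mk.injEq] at h
      exact absurd h.2 (Fin.succ_ne_zero _)
    · simp only [eTf, Sum.elim_inr, Subtype.mk.injEq, Prod.mk.injEq, Fin.succ_inj] at h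
      obtain ⟨rfl, rfl⟩ := h; rfl
  · rintro ⟨⟨i, j⟩, h⟩
    simp only at h
    obtain ⟨i', rfl⟩ := Fin.exists_succ_eq.mpr (ne_of_gt (lt_of_le_of_lt (Fin.zero_le _) h))
    induction j using Fin.cases with
    | zero => exact ⟨Sum.inl i', rfl⟩
    | succ j => exact ⟨Sum.inr ⟨(i', j), Fin.succ_lt_succ_iff.mp h⟩, rfl⟩

def eT (n : ℕ) : Fin n ⊕ LT n ≃ LT (n+1) := Equiv.ofBijective _ (eTf_bij n)

lemma Zmat_cons (A : Fin 2 → Fin 2 → ℝ) (z : Fin n → Fin 2 → Fin 2 → ℝ) :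
    (Zmat (Fin.cons A z : Fin (n+1) → Fin 2 → Fin 2 → ℝ)).submatrix (e2 (2*n)) (e2 (2*n)) = fromBlocks (of A) 0 0 (Zmat z) := by
  ext i j
  have hA : ∀ (i : ℕ) (h : i < n + 1) , i = 0 → (Fin.cons A z : Fin (n+1) → Fin 2 → Fin 2 → ℝ) ⟨i, h⟩ = A := by
    rintro _ h rfl; rfl
  rcases i with i | i <;> rcases j with j | j
  · have hi : i.val / 2 = 0 := by omega
    have hj : j.val / 2 = 0 := by omega
    have hi' : i.val % 2 = i.val := by omega
    have hj' : j.val % 2 = j.val := by omega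
    simp only [submatrix_apply, Zmat, of_apply, e2_inl, hi, hj, hi', hj', if_true, fromBlocks_apply₁₁, Fin.eta]
    rw [hA _ _ rfl]
  · have hi : i.val / 2 = 0 := by omega
    have hj : ¬ (0 = (j.val + 2) / 2) := by omega
    simp only [submatrix_apply, Zmat, of_apply, e2_inl, e2_inr, hi, hj, if_false, fromBlocks_apply₁₂, Matrix.zero_apply]
  · have hi : j.val / 2 = 0 := by omega
    have hj : ¬ ((i.val + 2) / 2 = 0) := by omega
    simp only [submatrix_apply, Zmat, of_apply, e2_inl, e2_inr, hi, hj, if_false, fromBlocks_apply₂₁, Matrix.zero_apply]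
  · have hi : (i.val + 2) / 2 = i.val / 2 + 1 := by omega
    have hj : (j.val + 2) / 2 = j.val / 2 + 1 := by omega
    have hi' : (i.val + 2) % 2 = i.val % 2 := by omega
    have hj' : (j.val + 2) % 2 = j.val % 2 := by omega
    simp only [submatrix_apply, Zmat, of_apply, e2_inr, hi, hj, hi', hj', fromBlocks_apply₂₂, add_left_inj]
    rfl

lemma Tmat_elim (C : Fin n → Fin 2 → Fin 2 → ℝ) (c : LT n → Fin 2 → Fin 2 → ℝ) :
    (Tmat (fun g => Sum.elim C c ((eT n).symm g))).submatrix (e2 (2*n)) (e2 (2*n)) = fromBlocks 1 0 (of (cEquiv n C)) (Tmat c) := by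
  have hinl : ∀ (i : ℕ) (h : i < n) (h1 : i + 1 < n + 1) (h0 : 0 < n + 1) (p : (⟨0, h0⟩ : Fin (n+1)) < ⟨i+1, h1⟩), Sum.elim C c ((eT n).symm ⟨(⟨i+1, h1⟩, ⟨0, h0⟩), p⟩) = C ⟨i, h⟩ := by
    intro i h h1 h0 p
    have : (eT n).symm ⟨(⟨i+1, h1⟩, ⟨0, h0⟩), p⟩ = Sum.inl ⟨i, h⟩ := by
      rw [Equiv.symm_apply_eq]; rfl
    rw [this]; rfl
  have hinr : ∀ (i j : ℕ) (h : i < n) (h' : j < n) (h1 : i + 1 < n + 1) (h0 : j + 1 < n + 1) (p : (⟨j+1, h0⟩ : Fin (n+1)) < ⟨i+1, h1⟩) (p' : (⟨j, h'⟩ : Fin n) < ⟨i, h⟩), Sum.elim C c ((eT n).symm ⟨(⟨i+1, h1⟩, ⟨j+1, h0⟩), p⟩) = c ⟨(⟨i, h⟩, ⟨j, h'⟩), p'⟩ := by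
    intro i j h h' h1 h0 p p'
    have : (eT n).symm ⟨(⟨i+1, h1⟩, ⟨j+1, h0⟩), p⟩ = Sum.inr ⟨(⟨i, h⟩, ⟨j, h'⟩), p'⟩ := by
      rw [Equiv.symm_apply_eq]; rfl
    rw [this]; rfl
  ext i j
  rcases i with i | i <;> rcases j with j | j
  · have hi : i.val / 2 = 0 := by omega
    have hj : j.val / 2 = 0 := by omega
    have hi' : i.val % 2 = i.val := by omega
    have hj' : j.val % 2 = j.val := by omega
    simp only [submatrix_apply, Tmat, of_apply, e2_inl, hi, hj, hi', hj', lt_irrefl, dif_neg, not_false_iff, if_true, fromBlocks_apply₁₁, Matrix.one_apply, Fin.ext_iff]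
  · have hi : i.val / 2 = 0 := by omega
    have hj : ¬ (0 = (j.val + 2) / 2) := by omega
    have hj2 : ¬ ((j.val + 2) / 2 < 0) := by omega
    simp only [submatrix_apply, Tmat, of_apply, e2_inl, e2_inr, hi, hj, hj2, dif_neg, not_false_iff, if_false, fromBlocks_apply₁₂, Matrix.zero_apply]
  · have hi : j.val / 2 = 0 := by omega
    have hj : (i.val + 2) / 2 = i.val / 2 + 1 := by omega
    have hj' : j.val % 2 = j.val := by omega
    have hi' : (i.val + 2) % 2 = i.val % 2 := by omega
    have hlt : i.val / 2 < n := by have := i.isLt; omega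
    simp only [submatrix_apply, Tmat, of_apply, e2_inl, e2_inr, hi, hj, hi', hj', Nat.succ_pos, dif_pos, fromBlocks_apply₂₁]
    rw [hinl _ hlt]
    rfl
  · have hi : (i.val + 2) / 2 = i.val / 2 + 1 := by omega
    have hj : (j.val + 2) / 2 = j.val / 2 + 1 := by omega
    have hi' : (i.val + 2) % 2 = i.val % 2 := by omega
    have hj' : (j.val + 2) % 2 = j.val % 2 := by omega
    have hlt : i.val / 2 < n := by have := i.isLt; omega
    have hlt' : j.val / 2 < n := by have := j.isLt; omega
    simp only [submatrix_apply, Tmat, of_apply, e2_inr, hi, hj, hi', hj', fromBlocks_apply₂₂, add_left_inj, add_lt_add_iff_right]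
    split_ifs with h
    · rw [hinr _ _ hlt hlt' _ _ _ (Fin.mk_lt_mk.mpr h)]
    all_goals rfl

lemma TZ_blocks (A : Fin 2 → Fin 2 → ℝ) (z : Fin n → Fin 2 → Fin 2 → ℝ) (C : Fin n → Fin 2 → Fin 2 → ℝ) (c : LT n → Fin 2 → Fin 2 → ℝ) :
    Tmat (fun g => Sum.elim C c ((eT n).symm g)) * Zmat (Fin.cons A z : Fin (n+1) → Fin 2 → Fin 2 → ℝ) =
      of (bm (e2 (2*n)) A 0 (fun i j => (of (cEquiv n C) * of A) i j) (fun i j => (Tmat c * Zmat z) i j)) := by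
  have h : (Tmat (fun g => Sum.elim C c ((eT n).symm g)) * Zmat (Fin.cons A z : Fin (n+1) → Fin 2 → Fin 2 → ℝ)).submatrix (e2 (2*n)) (e2 (2*n)) = fromBlocks (of A) 0 (of (cEquiv n C) * of A) (Tmat c * Zmat z) := by
    refine (submatrix_mul_equiv (Tmat (fun g => Sum.elim C c ((eT n).symm g))) (Zmat (Fin.cons A z : Fin (n+1) → Fin 2 → Fin 2 → ℝ)) (e2 (2*n)) (e2 (2*n)) (e2 (2*n))).symm.trans ?_
    rw [Zmat_cons, Tmat_elim, fromBlocks_multiply]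
    simp
  ext i j
  have := congrFun (congrFun h ((e2 (2*n)).symm i)) ((e2 (2*n)).symm j)
  simp only [submatrix_apply] at this
  rw [show (e2 (2*n)) ((e2 (2*n)).symm i) = i from Equiv.apply_symm_apply _ _, show (e2 (2*n)) ((e2 (2*n)).symm j) = j from Equiv.apply_symm_apply _ _] at this
  rw [this]
  rfl


lemma lint_consE {E : Type} [MeasureSpace E] [SigmaFinite (volume : Measure E)] (F : (Fin (n+1) → E) → ℝ≥0∞) (hF : Measurable F) :
    ∫⁻ r, F r = ∫⁻ x : E, ∫⁻ r : Fin n → E, F (Fin.cons x r) := by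
  have h := (volume_preserving_piFinSuccAbove (fun _ : Fin (n+1) => E) 0).symm
  rw [← h.lintegral_comp hF, Measure.volume_eq_prod, lintegral_prod]
  · simp [MeasurableEquiv.piFinSuccAbove, Fin.insertNth_zero']
    rfl
  · exact (hF.comp (MeasurableEquiv.measurable _)).aemeasurable

abbrev Zs (n : ℕ) := Fin n → Fin 2 → Fin 2 → ℝ
abbrev Cs (n : ℕ) := LT n → Fin 2 → Fin 2 → ℝ

def TZ (c : Cs n) (z : Zs n) : Fin (2*n) → Fin (2*n) → ℝ := fun i j => (Tmat c * Zmat z) i j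

lemma Tmat_meas (i j : Fin (2*n)) : Measurable fun c : Cs n => Tmat c i j := by
  unfold Tmat
  simp only [of_apply]
  split_ifs <;> fun_prop

lemma Zmat_meas (i j : Fin (2*n)) : Measurable fun z : Zs n => Zmat z i j := by
  unfold Zmat
  simp only [of_apply]
  split_ifs <;> fun_prop

lemma TZ_meas : Measurable fun p : Cs n × Zs n => TZ p.1 p.2 := by
  refine measurable_pi_lambda _ fun i => measurable_pi_lambda _ fun j => ?_
  unfold TZ
  simp only [mul_apply]
  refine Finset.measurable_fun_sum _ fun k _ => ?_
  exact ((Tmat_meas i k).comp measurable_fst).mul ((Zmat_meas k j).comp measurable_snd)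

def Jw (z : Zs n) : ℝ := ∏ j : Fin n, |(of (z j)).det| ^ (4 * (n - 1 - j.val))

lemma Jw_nonneg (z : Zs n) : 0 ≤ Jw z := Finset.prod_nonneg fun j _ => by positivity

lemma Jw_meas : Measurable (Jw (n := n)) := by
  unfold Jw
  refine Finset.measurable_fun_prod _ fun j _ => ?_
  exact ((det_meas.comp (measurable_pi_apply j)).abs).pow_const _

lemma Jw_cons (A : Fin 2 → Fin 2 → ℝ) (z : Zs n) : Jw (Fin.cons A z : Zs (n+1)) = |(of A).det| ^ (2*n) * |(of A).det| ^ (2*n) * Jw z := by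
  unfold Jw
  rw [Fin.prod_univ_succ]
  simp only [Fin.cons_zero, Fin.cons_succ, Fin.val_zero, Fin.val_succ]
  congr 1
  · rw [← pow_add]; congr 1; omega
  · refine Finset.prod_congr rfl fun j _ => ?_
    congr 2; omega

def RInv (Θ : (Fin N → Fin N → ℝ) → ℝ≥0∞) : Prop :=
  ∀ u, ∀ k ∈ Og N, Θ (fun i j => (of u * k) i j) = Θ u

lemma og_lint {ι κ : Type} [Fintype ι] [Fintype κ] [DecidableEq ι] [DecidableEq κ] {k : Matrix κ κ ℝ} (hk : k ∈ orthogonalGroup κ ℝ)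
    (F : (ι → κ → ℝ) → ℝ≥0∞) (hF : Measurable F) : ∫⁻ X, F X = ∫⁻ X : ι → κ → ℝ, F (fun i j => (of X * k) i j) := by
  have h1 : |k.det| = 1 := by
    rw [mem_orthogonalGroup_iff] at hk
    have := congrArg det hk
    rw [det_mul, det_transpose, det_one] at this
    rw [← sq] at this
    exact (pow_eq_one_iff_of_nonneg (abs_nonneg _) two_ne_zero).mp (by rw [sq_abs, this])
  rw [lint_mulR k (by intro h; rw [h] at h1; simp at h1) F hF, h1]
  simp

set_option maxHeartbeats 400000 in
lemma polar_succ (c1 c2 c3 : ℝ≥0∞)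
    (h1 : ∀ Ψ : (Fin 2 → (Fin 2 ⊕ Fin (2*n)) → ℝ) → ℝ≥0∞, Measurable Ψ →
      (∀ T, ∀ k ∈ orthogonalGroup (Fin 2 ⊕ Fin (2*n)) ℝ, Ψ (fun i j => (of T * k) i j) = Ψ T) →
      ∫⁻ T, Ψ T = c1 * ∫⁻ A, eR (|(of A).det| ^ Fintype.card (Fin (2*n))) * Ψ (tb A 0))
    (h2 : ∀ F : (Fin (2*n) → Fin 2 → ℝ) → ℝ≥0∞, Measurable F → ∫⁻ y, F y = c2 * ∫⁻ x, F (cEquiv n x))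
    (h3 : ∀ Θ : (Fin (2*n) → Fin (2*n) → ℝ) → ℝ≥0∞, Measurable Θ → RInv Θ →
      ∫⁻ u, Θ u = c3 * ∫⁻ z : Zs n, eR (Jw z) * ∫⁻ c : Cs n, Θ (TZ c z))
    (Θ : (Fin (2*n+2) → Fin (2*n+2) → ℝ) → ℝ≥0∞) (hΘ : Measurable Θ) (hinv : RInv Θ) :
    ∫⁻ u, Θ u = (c1 * c2 * c3) * ∫⁻ z : Zs (n+1), eR (Jw z) * ∫⁻ c : Cs (n+1), Θ (TZ (n := n+1) c z) := by
  let e := e2 (2*n)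
  let Θ' : ((Fin 2 ⊕ Fin (2*n)) → (Fin 2 ⊕ Fin (2*n)) → ℝ) → ℝ≥0∞ := fun v => Θ (fun i j => v (e.symm i) (e.symm j))
  have hΘ' : Measurable Θ' := hΘ.comp (by fun_prop)
  have hinv' : ∀ v, ∀ k ∈ orthogonalGroup (Fin 2 ⊕ Fin (2*n)) ℝ, Θ' (fun i j => (of v * k) i j) = Θ' v := by
    intro v k hk
    simp only [Θ']
    rw [← hinv (fun i j => v (e.symm i) (e.symm j)) (k.submatrix e.symm e.symm) (og_reindex e.symm hk)]
    congr 1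
    funext i j
    have := congrFun (congrFun (submatrix_mul_equiv (of v) k e.symm e.symm e.symm) i) j
    exact this.symm
  have S1 : ∫⁻ u, Θ u = ∫⁻ v, Θ' v := by
    rw [lint_block e Θ hΘ, lint_block (Equiv.refl _) Θ' hΘ']
    rfl
  have hmE : Measurable fun p : (Fin 2 → (Fin 2 ⊕ Fin (2*n)) → ℝ) × (Fin (2*n) → (Fin 2 ⊕ Fin (2*n)) → ℝ) => Θ' (Sum.elim p.1 p.2) :=
    hΘ'.comp (mp_sum (E := (Fin 2 ⊕ Fin (2*n)) → ℝ) (Equiv.refl (Fin 2 ⊕ Fin (2*n)))).measurable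
  let Ψ : (Fin 2 → (Fin 2 ⊕ Fin (2*n)) → ℝ) → ℝ≥0∞ := fun T => ∫⁻ E : Fin (2*n) → (Fin 2 ⊕ Fin (2*n)) → ℝ, Θ' (Sum.elim T E)
  have hΨ : Measurable Ψ := hmE.lintegral_prod_right'
  have S2 : ∫⁻ v, Θ' v = ∫⁻ T, Ψ T := by
    rw [lint_sum (Equiv.refl (Fin 2 ⊕ Fin (2*n))) Θ' hΘ']
    rfl
  have S3 : ∀ T, ∀ k ∈ orthogonalGroup (Fin 2 ⊕ Fin (2*n)) ℝ, Ψ (fun i j => (of T * k) i j) = Ψ T := by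
    intro T k hk
    have h5 : ∀ T', Measurable fun E : Fin (2*n) → (Fin 2 ⊕ Fin (2*n)) → ℝ => Θ' (Sum.elim T' E) := fun T' => hmE.comp measurable_prodMk_left
    simp only [Ψ]
    rw [og_lint hk _ (h5 _)]
    refine lintegral_congr fun E => ?_
    rw [← hinv' (Sum.elim T E) k hk]
    congr 1
    funext i j
    rcases i with i | i <;> simp [mul_apply]
  have hmb : Measurable fun p : (Fin 2 → Fin 2 → ℝ) × ((Fin (2*n) → Fin 2 → ℝ) × (Fin (2*n) → Fin (2*n) → ℝ)) => Θ (bm e p.1 0 p.2.1 p.2.2) :=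
    hΘ.comp ((bm_meas e).comp ((measurable_fst.prodMk measurable_const).prodMk measurable_snd))
  have S5 : ∀ A, Ψ (tb A 0) = ∫⁻ C, ∫⁻ D, Θ (bm e A 0 C D) := by
    intro A
    simp only [Ψ]
    rw [lint_cols (Equiv.refl (Fin 2 ⊕ Fin (2*n))) _ (show Measurable fun E : Fin (2*n) → (Fin 2 ⊕ Fin (2*n)) → ℝ => Θ' (Sum.elim (tb A 0) E) from hmE.comp measurable_prodMk_left)]
    refine lintegral_congr fun C => lintegral_congr fun D => ?_
    simp only [Θ']
    refine congrArg Θ ?_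
    funext i j
    unfold bm
    rcases e.symm i with i' | i' <;> rcases e.symm j with j' | j' <;> rfl
  have S6 : ∀ A : Fin 2 → Fin 2 → ℝ, (of A).det ≠ 0 → Ψ (tb A 0) = eR (|(of A).det| ^ (2*n)) * (c2 * ∫⁻ C : Zs n, ∫⁻ D, Θ (bm e A 0 (fun i j => (of (cEquiv n C) * of A) i j) D)) := by
    intro A hA
    have hmC : Measurable fun C : Fin (2*n) → Fin 2 → ℝ => ∫⁻ D, Θ (bm e A 0 C D) :=
      (hmb.comp measurable_prodMk_left).lintegral_prod_right'
    rw [S5, lint_mulR (of A) hA _ hmC, h2 _ (show Measurable fun X : Fin (2*n) → Fin 2 → ℝ => ∫⁻ D, Θ (bm e A 0 (fun i j => (of X * of A) i j) D) from hmC.comp (mulR_meas (of A)))]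
    simp
  have S7 : ∀ (A : Fin 2 → Fin 2 → ℝ) C, ∫⁻ D, Θ (bm e A 0 C D) = c3 * ∫⁻ z : Zs n, eR (Jw z) * ∫⁻ c : Cs n, Θ (bm e A 0 C (TZ c z)) := by
    intro A C
    refine h3 (fun D => Θ (bm e A 0 C D)) (hmb.comp (measurable_const.prodMk (measurable_const.prodMk measurable_id))) ?_
    intro D k hk
    show Θ (bm e A 0 C (fun i j => (of D * k) i j)) = Θ (bm e A 0 C D)
    rw [← hinv (bm e A 0 C D) ((fromBlocks 1 0 0 k : Matrix (Fin 2 ⊕ Fin (2*n)) (Fin 2 ⊕ Fin (2*n)) ℝ).submatrix e.symm e.symm) (og_reindex e.symm (fromBlocks_og hk))]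
    congr 1
    funext i j
    have h8 : of (bm e A 0 C D) = (fromBlocks (of A) 0 (of C) (of D)).submatrix e.symm e.symm := rfl
    rw [h8, submatrix_mul_equiv, fromBlocks_multiply]
    simp only [Matrix.mul_one, Matrix.mul_zero, Matrix.zero_mul, add_zero, zero_add]
    rfl
  have hmall : Measurable fun p : ((Fin 2 → Fin 2 → ℝ) × Zs n) × (Zs n × Cs n) => Θ (bm e p.1.1 0 (fun i j => (of (cEquiv n p.1.2) * of p.1.1) i j) (TZ p.2.2 p.2.1)) := by
    have hce : Measurable (cEquiv n) := (LinearMap.continuous_of_finiteDimensional (cEquiv n).toLinearMap).measurable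
    refine hmb.comp ((measurable_fst.comp measurable_fst).prodMk (Measurable.prodMk ?_ (TZ_meas.comp ((measurable_snd.comp measurable_snd).prodMk (measurable_fst.comp measurable_snd)))))
    exact mul_meas2.comp ((hce.comp (measurable_snd.comp measurable_fst)).prodMk (measurable_fst.comp measurable_fst))
  have hmz : Measurable fun p : ((Fin 2 → Fin 2 → ℝ) × Zs n) × Zs n => ∫⁻ c : Cs n, Θ (bm e p.1.1 0 (fun i j => (of (cEquiv n p.1.2) * of p.1.1) i j) (TZ c p.2)) := by
    have : Measurable fun q : (((Fin 2 → Fin 2 → ℝ) × Zs n) × Zs n) × Cs n => Θ (bm e q.1.1.1 0 (fun i j => (of (cEquiv n q.1.1.2) * of q.1.1.1) i j) (TZ q.2 q.1.2)) :=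
      hmall.comp ((measurable_fst.comp measurable_fst).prodMk ((measurable_snd.comp measurable_fst).prodMk measurable_snd))
    exact this.lintegral_prod_right'
  obtain ⟨G, hG⟩ : ∃ G : (Fin 2 → Fin 2 → ℝ) → Zs n → Zs n → ℝ≥0∞, ∀ A C z, G A C z = ∫⁻ c : Cs n, Θ (bm e A 0 (fun i j => (of (cEquiv n C) * of A) i j) (TZ c z)) := ⟨_, fun _ _ _ => rfl⟩
  simp only [← hG] at hmz
  have hmz2 : Measurable fun p : ((Fin 2 → Fin 2 → ℝ) × Zs n) × Zs n => eR (Jw p.2) * G p.1.1 p.1.2 p.2 :=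
    ((Jw_meas.comp measurable_snd).ennreal_ofReal).mul hmz
  have hTZ : Measurable fun p : Zs (n+1) × Cs (n+1) => Θ (TZ (n := n+1) p.2 p.1) := hΘ.comp (TZ_meas.comp measurable_swap)
  have R1 : ∀ (A : Fin 2 → Fin 2 → ℝ) (z : Zs n), ∫⁻ c : Cs (n+1), Θ (TZ (n := n+1) c (Fin.cons A z : Zs (n+1))) = ∫⁻ C : Zs n, G A C z := by
    intro A z
    rw [lint_sum (eT n) _ (show Measurable fun c : Cs (n+1) => Θ (TZ (n := n+1) c (Fin.cons A z : Zs (n+1))) from hTZ.comp measurable_prodMk_left)]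
    refine lintegral_congr fun C => ?_
    rw [hG]
    refine lintegral_congr fun c => ?_
    refine congrArg Θ ?_
    unfold TZ
    rw [TZ_blocks]
    rfl
  have R : ∫⁻ z : Zs (n+1), eR (Jw z) * ∫⁻ c : Cs (n+1), Θ (TZ (n := n+1) c z) =
      ∫⁻ A : Fin 2 → Fin 2 → ℝ, eR (|(of A).det| ^ (2*n)) * (eR (|(of A).det| ^ (2*n)) * ∫⁻ C : Zs n, ∫⁻ z : Zs n, eR (Jw z) * G A C z) := by
    rw [lint_consE _ (show Measurable fun z : Zs (n+1) => eR (Jw z) * ∫⁻ c : Cs (n+1), Θ (TZ (n := n+1) c z) from (Jw_meas.ennreal_ofReal).mul hTZ.lintegral_prod_right')]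
    refine lintegral_congr fun A => ?_
    have hq : Measurable fun p : Zs n × Zs n => (((A, p.1), p.2) : ((Fin 2 → Fin 2 → ℝ) × Zs n) × Zs n) := by fun_prop
    have hcons : Measurable fun p : Zs n × Zs n => eR (Jw p.2) * G A p.1 p.2 := by
      have h9 := hmz2.comp hq
      simp only [Function.comp_def] at h9
      exact h9
    rw [lintegral_lintegral_swap hcons.aemeasurable, ← lintegral_const_mul' _ _ ENNReal.ofReal_ne_top, ← lintegral_const_mul' _ _ ENNReal.ofReal_ne_top]
    refine lintegral_congr fun z => ?_
    rw [R1, Jw_cons, ENNReal.ofReal_mul (by positivity), ENNReal.ofReal_mul (by positivity), mul_assoc, mul_assoc, lintegral_const_mul' _ _ ENNReal.ofReal_ne_top]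
  rw [S1, S2, h1 Ψ hΨ S3, R, mul_assoc, mul_assoc]
  congr 1
  have S8 : ∫⁻ A, eR (|(of A).det| ^ Fintype.card (Fin (2*n))) * Ψ (tb A 0) = ∫⁻ A : Fin 2 → Fin 2 → ℝ, (c2 * c3) * (eR (|(of A).det| ^ (2*n)) * (eR (|(of A).det| ^ (2*n)) * ∫⁻ C : Zs n, ∫⁻ z : Zs n, eR (Jw z) * G A C z)) := by
    refine lintegral_congr_ae ?_
    filter_upwards [det_ae (Fin 2)] with A hA
    rw [S6 A hA, Fintype.card_fin]
    simp only [S7, ← hG]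
    have hq : Measurable fun C : Zs n => ∫⁻ z : Zs n, eR (Jw z) * G A C z := (hmz2.lintegral_prod_right').comp measurable_prodMk_left
    rw [lintegral_const_mul _ hq]
    ring
  rw [S8, lintegral_const_mul, mul_assoc]
  refine Measurable.mul ?_ (Measurable.mul ?_ ?_)
  · exact (det_meas.abs.pow_const _).ennreal_ofReal
  · exact (det_meas.abs.pow_const _).ennreal_ofReal
  · exact (hmz2.lintegral_prod_right').lintegral_prod_right'

lemma polar (n : ℕ) : ∃ c0 : ℝ≥0∞, ∀ Θ : (Fin (2*n) → Fin (2*n) → ℝ) → ℝ≥0∞, Measurable Θ → RInv Θ →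
      ∫⁻ u, Θ u = c0 * ∫⁻ z : Zs n, eR (Jw z) * ∫⁻ c : Cs n, Θ (TZ c z) := by
  induction n with
  | zero =>
    refine ⟨1, fun Θ hΘ _ => ?_⟩
    have h0 : IsEmpty (Fin (2*0)) := inferInstanceAs (IsEmpty (Fin 0))
    have h1 : IsEmpty (LT 0) := ⟨fun x => x.1.1.elim0⟩
    rw [Measure.volume_pi_eq_dirac (fun i => h0.elim i), Measure.volume_pi_eq_dirac (fun i => i.elim0), lintegral_dirac' _ hΘ]
    rw [lintegral_dirac', Measure.volume_pi_eq_dirac (fun i => h1.elim i), lintegral_dirac']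
    · simp only [Jw, Finset.univ_eq_empty, Finset.prod_empty, ENNReal.ofReal_one, one_mul]
      congr 1
      exact Subsingleton.elim _ _
    · exact hΘ.comp (TZ_meas.comp (measurable_id.prodMk measurable_const))
    · refine Measurable.mul (Jw_meas.ennreal_ofReal) ?_
      exact Measurable.lintegral_prod_right' (f := fun p : Zs 0 × Cs 0 => Θ (TZ p.2 p.1)) (hΘ.comp (TZ_meas.comp measurable_swap))
  | succ n ih =>
    obtain ⟨c3, h3⟩ := ih
    obtain ⟨c1, h1⟩ := step_top (α := Fin 2) (β := Fin (2*n))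
    have i1 : (volume : Measure (Fin 2 → ℝ)).IsAddHaarMeasure := inferInstance
    have i2 : (volume : Measure (Fin 2 → Fin 2 → ℝ)).IsAddHaarMeasure := Measure.pi.isAddHaarMeasure _
    have i3 : (volume : Measure (Fin n → Fin 2 → Fin 2 → ℝ)).IsAddHaarMeasure := Measure.pi.isAddHaarMeasure _
    obtain ⟨c2, h2⟩ := lint_linequiv (cEquiv n)
    exact ⟨c1 * c2 * c3, fun Θ hΘ hinv => polar_succ c1 c2 c3 h1 h2 h3 Θ hΘ hinv⟩


abbrev Us (N : ℕ) := Fin N → Fin N → ℝ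

def rm (p : Us N × OG N) : Us N := fun i j => (of p.1 * p.2.1) i j

lemma rm_meas : Measurable (rm (N := N)) := by
  have h : Measurable fun p : Us N × OG N => ((p.1, fun i j => p.2.1 i j) : Us N × Us N) := by
    refine measurable_fst.prodMk ?_
    exact measurable_subtype_coe.comp measurable_snd
  exact mul_meas2.comp h

def rho0 (n : ℕ) : Measure ((Zs n × Cs n) × OG (2*n)) :=
  (((volume : Measure (Zs n)).withDensity fun z => eR (Jw z)).prod (volume : Measure (Cs n))).prod (hK (2*n))

def Phi (p : (Zs n × Cs n) × OG (2*n)) : Us (2*n) := rm (TZ p.1.2 p.1.1, p.2)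

lemma Phi_meas : Measurable (Phi (n := n)) := by
  refine rm_meas.comp (Measurable.prodMk ?_ measurable_snd)
  exact TZ_meas.comp (measurable_swap.comp measurable_fst)

instance jw_sf (n : ℕ) : SigmaFinite ((volume : Measure (Zs n)).withDensity fun z => eR (Jw z)) :=
  SigmaFinite.withDensity_ofReal (μ := (volume : Measure (Zs n))) Jw

lemma decomp (n : ℕ) : ∃ c0 : ℝ≥0∞, (volume : Measure (Us (2*n))) = c0 • Measure.map Phi (rho0 n) := by
  obtain ⟨c0, hc0⟩ := polar n
  refine ⟨c0, Measure.ext_of_lintegral _ fun f hf => ?_⟩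
  have hfr : Measurable fun p : Us (2*n) × OG (2*n) => f (rm p) := hf.comp rm_meas
  have h1 : ∫⁻ u, f u = ∫⁻ u, ∫⁻ k, f (rm (u, k)) ∂(hK (2*n)) := by
    rw [lintegral_lintegral_swap (f := fun u k => f (rm (u, k))) hfr.aemeasurable]
    have : ∀ k : OG (2*n), ∫⁻ u, f (rm (u, k)) = ∫⁻ u, f u := fun k => (og_lint k.2 f hf).symm
    simp [this]
  have h2 : Measurable fun u : Us (2*n) => ∫⁻ k, f (rm (u, k)) ∂(hK (2*n)) := hfr.lintegral_prod_right'
  have h3 : RInv fun u : Us (2*n) => ∫⁻ k, f (rm (u, k)) ∂(hK (2*n)) := by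
    intro u l hl
    have := lintegral_mul_left_eq_self (μ := hK (2*n)) (fun k => f (rm (u, k))) ⟨l, hl⟩
    refine Eq.trans ?_ this
    refine lintegral_congr fun k => congrArg f ?_
    funext i j
    show (of u * l * k.1) i j = (of u * (l * k.1)) i j
    rw [Matrix.mul_assoc]
  rw [h1, hc0 _ h2 h3, lintegral_smul_measure, lintegral_map hf Phi_meas, rho0]
  have hp : Measurable fun p : (Zs n × Cs n) × OG (2*n) => f (Phi p) := hf.comp Phi_meas
  rw [lintegral_prod _ hp.aemeasurable, lintegral_prod _ (hp.lintegral_prod_right').aemeasurable,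
    lintegral_withDensity_eq_lintegral_mul _ Jw_meas.ennreal_ofReal (hp.lintegral_prod_right').lintegral_prod_right']
  rfl

lemma TZ_det (c : Cs n) (z : Zs n) : (Tmat c * Zmat z).det = ∏ j, (of (z j)).det := by
  induction n with
  | zero =>
    have h0 : IsEmpty (Fin (2*0)) := inferInstanceAs (IsEmpty (Fin 0))
    rw [det_isEmpty]; simp
  | succ n ih =>
    have h1 : c = fun g => Sum.elim (fun i => c (eT n (Sum.inl i))) (fun i => c (eT n (Sum.inr i))) ((eT n).symm g) := by
      funext g
      obtain ⟨x, rfl⟩ := (eT n).surjective g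
      rw [Equiv.symm_apply_apply]
      rcases x with x | x <;> rfl
    have h2 : z = Fin.cons (z 0) (fun i => z i.succ) := (Fin.cons_self_tail z).symm
    rw [Fin.prod_univ_succ]
    have h3 := TZ_blocks (z 0) (fun i => z i.succ) (fun i => c (eT n (Sum.inl i))) (fun i => c (eT n (Sum.inr i)))
    rw [← h1, ← h2] at h3
    refine (congrArg det h3).trans ?_
    have h4 : of (bm (e2 (2*n)) (z 0) 0 (fun i j => (of (cEquiv n fun i => c (eT n (Sum.inl i))) * of (z 0)) i j) (fun i j => (Tmat (fun i => c (eT n (Sum.inr i))) * Zmat fun i => z i.succ) i j))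
       = (fromBlocks (of (z 0)) 0 (of (cEquiv n fun i => c (eT n (Sum.inl i))) * of (z 0)) (Tmat (fun i => c (eT n (Sum.inr i))) * Zmat fun i => z i.succ)).submatrix (e2 (2*n)).symm (e2 (2*n)).symm := rfl
    rw [h4, det_submatrix_equiv_self, det_fromBlocks_zero₁₂, ih]

lemma sum_castLE (h : m ≤ N) (f : Fin N → ℝ) (hf : ∀ l : Fin N, m ≤ l.val → f l = 0) : ∑ l, f l = ∑ l : Fin m, f (Fin.castLE h l) := by
  have h1 : ∑ l : Fin m, f (Fin.castLE h l) = ∑ l ∈ Finset.univ.map (Fin.castLEEmb h), f l := by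
    rw [Finset.sum_map]; rfl
  rw [h1]
  symm
  refine Finset.sum_subset (Finset.subset_univ _) fun l _ hl => hf l ?_
  by_contra hlt
  refine hl ?_
  simp only [Finset.mem_map, Finset.mem_univ, true_and]
  exact ⟨⟨l.val, by omega⟩, rfl⟩

lemma sub_mul_low (h : m ≤ N) (A B : Mx N) (hA : ∀ i l : Fin N, i.val < m → m ≤ l.val → A i l = 0) :
    (A * B).submatrix (Fin.castLE h) (Fin.castLE h) = A.submatrix (Fin.castLE h) (Fin.castLE h) * B.submatrix (Fin.castLE h) (Fin.castLE h) := by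
  ext i j
  simp only [submatrix_apply, mul_apply]
  refine sum_castLE h _ fun l hl => ?_
  rw [hA _ l (by simp) hl, zero_mul]

lemma mn_conj (h : m ≤ N) (L Y : Mx N) (hL : ∀ i l : Fin N, i.val < m → m ≤ l.val → L i l = 0) :
    mn (L * Y * Lᵀ) m = (mn L m)^2 * mn Y m := by
  unfold mn
  simp only [dif_pos h]
  have h1 : (Y * Lᵀ).submatrix (Fin.castLE h) (Fin.castLE h) = ((L * Yᵀ).submatrix (Fin.castLE h) (Fin.castLE h))ᵀ := by
    rw [transpose_submatrix, transpose_mul, transpose_transpose]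
  have h2 : (Yᵀ.submatrix (Fin.castLE h) (Fin.castLE h)).det = (Y.submatrix (Fin.castLE h) (Fin.castLE h)).det := by
    rw [← transpose_submatrix, det_transpose]
  rw [Matrix.mul_assoc, sub_mul_low h L _ hL, h1, sub_mul_low h L _ hL, det_mul, det_transpose, det_mul, h2]
  ring

lemma TZ_low {n r : ℕ} (c : Cs n) (z : Zs n) (i l : Fin (2*n)) (hi : i.val < 2*r) (hl : 2*r ≤ l.val) : (Tmat c * Zmat z) i l = 0 := by
  rw [mul_apply]
  refine Finset.sum_eq_zero fun k _ => ?_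
  simp only [Tmat, Zmat, of_apply]
  by_cases hk : k.val / 2 = l.val / 2
  · rw [dif_neg (by omega), if_neg (by omega), zero_mul]
  · rw [if_neg hk, mul_zero]

lemma Tmat_low {n r : ℕ} (c : Cs n) (i l : Fin (2*n)) (hi : i.val < 2*r) (hl : 2*r ≤ l.val) : Tmat c i l = 0 := by
  simp only [Tmat, of_apply]
  rw [dif_neg (by omega), if_neg (by omega)]

lemma mn_TZ {n r : ℕ} (h : r ≤ n) (c : Cs n) (z : Zs n) : mn (Tmat c * Zmat z) (2*r) = ∏ j : Fin r, (of (z (Fin.castLE h j))).det := by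
  unfold mn
  rw [dif_pos (by omega), sub_mul_low _ _ _ (fun i l => Tmat_low c i l)]
  rw [← TZ_det (fun ij : LT r => c ⟨(Fin.castLE h ij.1.1, Fin.castLE h ij.1.2), ij.2⟩) (fun j => z (Fin.castLE h j))]
  rfl

lemma cpw_mul (x y : ℝ) (w : ℂ) : cpw (x * y) w = cpw x w * cpw y w := by
  unfold cpw
  by_cases hx : x = 0
  · simp [hx]
  by_cases hy : y = 0
  · simp [hy]
  rw [if_neg (mul_ne_zero hx hy), if_neg hx, if_neg hy, Real.log_mul hx hy, ← Complex.exp_add]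
  push_cast; ring_nf

lemma cpw_one (w : ℂ) : cpw 1 w = 1 := by simp [cpw]

lemma cpw_zero' {x : ℝ} (hx : x ≠ 0) : cpw x 0 = 1 := by simp [cpw, hx]

lemma cpw_fprod {ι : Type} (s : Finset ι) (f : ι → ℝ) (w : ℂ) : cpw (∏ i ∈ s, f i) w = ∏ i ∈ s, cpw (f i) w := by
  classical
  induction s using Finset.induction_on with
  | empty => simp [cpw_one]
  | insert a s ha ih => rw [Finset.prod_insert ha, Finset.prod_insert ha, cpw_mul, ih]

lemma cpw_sq (x : ℝ) (w : ℂ) : cpw (x^2) w = cpw |x| (2*w) := by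
  rw [← sq_abs, sq, cpw_mul, ← cpw_add, two_mul]

lemma cpw_fsum {ι : Type} {x : ℝ} (hx : x ≠ 0) (s : Finset ι) (f : ι → ℂ) : cpw x (∑ i ∈ s, f i) = ∏ i ∈ s, cpw x (f i) := by
  classical
  induction s using Finset.induction_on with
  | empty => simp [cpw_zero' hx]
  | insert a s ha ih => rw [Finset.prod_insert ha, Finset.sum_insert ha, cpw_add, ih]

def ms (e : ℕ → ℂ) (z : Zs n) : ℂ := ∏ i : Fin n, cpw |(of (z i)).det| (2 * ∑ j ∈ Finset.Ico i.val n, e j)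

lemma chi_TZ (e : ℕ → ℂ) (c : Cs n) (z : Zs n) (hz : ∀ j, (of (z j)).det ≠ 0) (Y : Mx (2*n)) :
    chi e ((Tmat c * Zmat z) * Y * (Tmat c * Zmat z)ᵀ) = ms e z * chi e Y := by
  unfold chi
  have hn : 2 * n / 2 = n := by omega
  rw [hn]
  have h1 : ∀ j ∈ Finset.range n, cpw (mn ((Tmat c * Zmat z) * Y * (Tmat c * Zmat z)ᵀ) (2*(j+1))) (e j) =
      (∏ i : Fin n, if i.val ≤ j then cpw |(of (z i)).det| (2 * e j) else 1) * cpw (mn Y (2*(j+1))) (e j) := by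
    intro j hj
    have hj' : j + 1 ≤ n := Finset.mem_range.mp hj
    rw [mn_conj (by omega) _ _ (fun i l => TZ_low c z i l), mn_TZ hj', cpw_mul, cpw_sq, Finset.abs_prod, cpw_fprod]
    congr 1
    rw [← Finset.prod_filter]
    have : (Finset.univ.filter fun i : Fin n => i.val ≤ j) = Finset.univ.map (Fin.castLEEmb hj') := by
      ext i
      simp only [Finset.mem_filter, Finset.mem_univ, true_and, Finset.mem_map]
      constructor
      · intro h; exact ⟨⟨i.val, by omega⟩, rfl⟩
      · rintro ⟨a, rfl⟩; have := a.2; simp; omega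
    rw [this, Finset.prod_map]
    rfl
  rw [Finset.prod_congr rfl h1, Finset.prod_mul_distrib, Finset.prod_comm]
  congr 1
  unfold ms
  refine Finset.prod_congr rfl fun i _ => ?_
  rw [Finset.mul_sum, cpw_fsum (abs_ne_zero.mpr (hz i)), ← Finset.prod_filter]
  refine Finset.prod_congr ?_ fun _ _ => rfl
  ext j; simp; omega


lemma det_law {σw : Mx 2 → ℝ} {h : ℝ → ℝ} (hs : ∀ z, 0 ≤ σw z) (hdet : IsDetDensity σw h)
    (hh : IntegrableOn h (Set.Ioi 0)) (hpos : 0 < ∫ t in Set.Ioi 0, h t) (f : ℝ → ℂ) (hf : Measurable f) :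
    ∫ z : Fin 2 → Fin 2 → ℝ, (σw (of z) : ℂ) * f |(of z).det| = ∫ t in Set.Ioi 0, (h t : ℂ) * f t := by
  obtain ⟨h0, hd⟩ := hdet
  have hσi : Integrable fun z : Fin 2 → Fin 2 → ℝ => σw (of z) := by
    by_contra hc
    have := hd (fun _ => 1) measurable_const ⟨1, by simp⟩
    simp only [mul_one] at this
    rw [integral_undef hc] at this
    exact hpos.ne this
  have hdm : Measurable fun z : Fin 2 → Fin 2 → ℝ => |(of z).det| := det_meas.abs
  have h0' : ∀ᵐ t ∂(volume.restrict (Set.Ioi (0:ℝ))), 0 ≤ h t := (ae_restrict_mem measurableSet_Ioi).mono fun t ht => h0 t ht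
  have key : Measure.map (fun z : Fin 2 → Fin 2 → ℝ => |(of z).det|) (volume.withDensity fun z => eR (σw (of z))) =
      (volume.restrict (Set.Ioi (0:ℝ))).withDensity fun t => eR (h t) := by
    ext s hsm
    rw [Measure.map_apply hdm hsm, withDensity_apply _ (hdm hsm), withDensity_apply _ hsm]
    rw [← ofReal_integral_eq_lintegral_ofReal hσi.integrableOn (evf fun z => hs _),
      ← ofReal_integral_eq_lintegral_ofReal hh.integrableOn (ae_restrict_of_ae h0')]
    congr 1
    have := hd (s.indicator fun _ => 1) (measurable_const.indicator hsm) ⟨1, fun t => by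
      by_cases ht : t ∈ s <;> simp [ht]⟩
    rw [← integral_indicator (hdm hsm), ← integral_indicator hsm]
    refine Eq.trans ?_ (this.trans ?_)
    · refine integral_congr_ae (evf fun z => ?_)
      by_cases hz : |(of z).det| ∈ s <;> simp [Set.indicator, hz]
    · refine integral_congr_ae (evf fun t => ?_)
      by_cases ht : t ∈ s <;> simp [Set.indicator, ht]
  have := congrArg (fun μ => ∫ t, f t ∂μ) key
  beta_reduce at this
  rw [integral_map hdm.aemeasurable hf.aestronglyMeasurable,
    integral_withDensity_eq_integral_toReal_smul₀ hσi.aemeasurable.ennreal_ofReal (by simp),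
    integral_withDensity_eq_integral_toReal_smul₀ hh.aemeasurable.ennreal_ofReal (by simp)] at this
  convert this using 1
  · refine integral_congr_ae (evf fun z => ?_)
    simp [ENNReal.toReal_ofReal (hs _)]
  · refine integral_congr_ae (h0'.mono fun t ht => ?_)
    simp [ENNReal.toReal_ofReal ht]

def mP (P : Mx N → ℝ) : Measure (Us N) := volume.withDensity fun u => eR (P (of u))

lemma int_mP {P : Mx N → ℝ} (h0 : ∀ g, 0 ≤ P g) (hi : Integrable fun u : Us N => P (of u))
    {E : Type} [NormedAddCommGroup E] [NormedSpace ℝ E] (f : Us N → E) : ∫ u, f u ∂(mP P) = ∫ u, P (of u) • f u := by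
  unfold mP
  rw [integral_withDensity_eq_integral_toReal_smul₀ hi.aemeasurable.ennreal_ofReal (by simp)]
  simp [ENNReal.toReal_ofReal (h0 _)]

lemma mP_prob {P : Mx N → ℝ} (h0 : ∀ g, 0 ≤ P g) (hi : Integrable fun u : Us N => P (of u))
    (h1 : ∫ u : Us N, P (of u) = 1) : IsProbabilityMeasure (mP P) := by
  constructor
  rw [mP, withDensity_apply _ MeasurableSet.univ, Measure.restrict_univ, ← ofReal_integral_eq_lintegral_ofReal hi (evf fun z => h0 _), h1]
  simp

def rmE (k : OG N) : Us N ≃ᵐ Us N where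
  toFun u := fun i j => (of u * k.1) i j
  invFun u := fun i j => (of u * k.1ᵀ) i j
  left_inv u := by
    funext i j
    have hk : k.1 * k.1ᵀ = 1 := (mem_orthogonalGroup_iff (Fin N) ℝ).mp k.2
    show (of u * k.1 * k.1ᵀ) i j = u i j
    rw [Matrix.mul_assoc, hk, Matrix.mul_one]; rfl
  right_inv u := by
    funext i j
    have hk : k.1ᵀ * k.1 = 1 := (mem_orthogonalGroup_iff' (Fin N) ℝ).mp k.2
    show (of u * k.1ᵀ * k.1) i j = u i j
    rw [Matrix.mul_assoc, hk, Matrix.mul_one]; rfl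
  measurable_toFun := mulR_meas _
  measurable_invFun := mulR_meas _

lemma rmE_mp (k : OG N) : MeasurePreserving (rmE k) (volume : Measure (Us N)) volume := by
  refine ⟨(rmE k).measurable, Measure.ext_of_lintegral _ fun f hf => ?_⟩
  rw [lintegral_map hf (rmE k).measurable]
  exact (og_lint k.2 f hf).symm

def lmE (k : OG N) : Us N ≃ᵐ Us N where
  toFun u := fun i j => (k.1 * of u) i j
  invFun u := fun i j => (k.1ᵀ * of u) i j
  left_inv u := by
    funext i j
    have hk : k.1ᵀ * k.1 = 1 := (mem_orthogonalGroup_iff' (Fin N) ℝ).mp k.2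
    show (k.1ᵀ * (k.1 * of u)) i j = u i j
    rw [← Matrix.mul_assoc, hk, Matrix.one_mul]; rfl
  right_inv u := by
    funext i j
    have hk : k.1 * k.1ᵀ = 1 := (mem_orthogonalGroup_iff (Fin N) ℝ).mp k.2
    show (k.1 * (k.1ᵀ * of u)) i j = u i j
    rw [← Matrix.mul_assoc, hk, Matrix.one_mul]; rfl
  measurable_toFun := mul_meas2.comp (measurable_const.prodMk measurable_id)
  measurable_invFun := mul_meas2.comp (measurable_const.prodMk measurable_id)

lemma lmE_mp (k : OG N) : MeasurePreserving (lmE k) (volume : Measure (Us N)) volume := by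
  refine ⟨(lmE k).measurable, Measure.ext_of_lintegral _ fun f hf => ?_⟩
  rw [lintegral_map hf (lmE k).measurable]
  have h1 := og_abs_det k.2
  rw [lint_mulL k.1 (by intro h; rw [h] at h1; simp at h1) f hf, h1]
  simp
  rfl

lemma mP_mp {P : Mx N → ℝ} (T : Us N ≃ᵐ Us N) (hT : MeasurePreserving T volume volume)
    (h : ∀ u, P (of (T u)) = P (of u)) : MeasurePreserving T (mP P) (mP P) := by
  refine ⟨T.measurable, ?_⟩
  ext s hs
  rw [Measure.map_apply T.measurable hs, mP, withDensity_apply _ hs, withDensity_apply _ (T.measurable hs)]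
  rw [← hT.setLIntegral_comp_preimage_emb T.measurableEmbedding (fun u => eR (P (of u))) s]
  simp [h]

lemma mult_gen {P : Mx (2 * n) → ℝ} {σw : Mx 2 → ℝ} (hfac : IsFactorizing n P σw) :
    ∃ c : ℝ, ∀ (f : Fin n → ℝ → ℂ) (g : OG (2*n) → ℂ) (G : Us (2*n) → ℂ), (∀ i, Measurable (f i)) → (∀ i t, ‖f i t‖ ≤ 1) → Measurable G →
      (∀ c z, (∀ j, (of (z j)).det ≠ 0) → ∀ k, G (rm (TZ c z, k)) = (∏ i, f i |(of (z i)).det|) * g k) →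
      ∫ u, G u ∂(mP P) = c * (∏ i : Fin n, ∫ z : Fin 2 → Fin 2 → ℝ, (σw (of z) : ℂ) * ((|(of z).det| ^ (2 * (n - 1 - i.val)) : ℝ) * f i |(of z).det|)) * ∫ k, g k ∂(hK (2*n)) := by
  obtain ⟨c0, hc0⟩ := decomp n
  refine ⟨c0.toReal, fun f g G hf hf1 hG hsplit => ?_⟩
  have hi := hfac.integrable
  have hc0' : c0 ≠ 0 := by
    rintro rfl
    have := hfac.prob
    rw [hc0] at this
    simp at this
  have hac : Measure.map Phi (rho0 n) ≪ (volume : Measure (Us (2*n))) := by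
    refine Measure.AbsolutelyContinuous.mk fun s _ hs => ?_
    rw [hc0, Measure.smul_apply, smul_eq_mul, mul_eq_zero] at hs
    exact hs.resolve_left hc0'
  have hc0t : c0 ≠ ⊤ := by
    rintro rfl
    have := hfac.prob
    rw [hc0, integral_smul_measure] at this
    simp at this
  have hPm : AEStronglyMeasurable (fun u : Us (2*n) => P (of u)) (Measure.map Phi (rho0 n)) := hi.aestronglyMeasurable.mono_ac hac
  have hPi : Integrable (fun p => P (of (Phi p))) (rho0 n) := by
    have : Integrable (fun u : Us (2*n) => P (of u)) (Measure.map Phi (rho0 n)) := by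
      rw [hc0] at hi
      exact (integrable_smul_measure hc0' hc0t).mp hi
    exact (integrable_map_measure hPm Phi_meas.aemeasurable).mp this
  have hPP : ∀ p : (Zs n × Cs n) × OG (2*n), P (of (Phi p)) = P (Tmat p.1.2 * Zmat p.1.1) := by
    intro p
    have := hfac.invariant (Tmat p.1.2 * Zmat p.1.1) 1 (one_mem _) p.2.1 p.2.2
    rw [Matrix.one_mul] at this
    exact this
  have hzae : ∀ᵐ z : Zs n, ∀ j, (of (z j)).det ≠ 0 := by
    rw [ae_all_iff]
    intro j
    exact (Measure.quasiMeasurePreserving_eval (μ := fun _ : Fin n => (volume : Measure (Fin 2 → Fin 2 → ℝ))) j).ae (det_ae (Fin 2))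
  have hzae' : ∀ᵐ z ∂((volume : Measure (Zs n)).withDensity fun z => eR (Jw z)), ∀ j, (of (z j)).det ≠ 0 := (withDensity_absolutelyContinuous _ _).ae_le hzae
  have hI2 : Integrable (fun q : Zs n × Cs n => P (Tmat q.2 * Zmat q.1)) (((volume : Measure (Zs n)).withDensity fun z => eR (Jw z)).prod (volume : Measure (Cs n))) := by
    simp only [hPP] at hPi
    exact (hPi.prod_left_ae).exists.choose_spec
  have hm : Measurable fun z : Zs n => ∏ i, f i |(of (z i)).det| :=
    Finset.measurable_fun_prod _ fun i _ => (hf i).comp ((det_meas.comp (measurable_pi_apply i)).abs)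
  have hI3 : Integrable (fun q : Zs n × Cs n => (P (Tmat q.2 * Zmat q.1) : ℂ) * ∏ i, f i |(of (q.1 i)).det|) (((volume : Measure (Zs n)).withDensity fun z => eR (Jw z)).prod (volume : Measure (Cs n))) := by
    refine hI2.ofReal.mul_bdd (c := 1) (hm.comp measurable_fst).aestronglyMeasurable (evf fun q => ?_)
    rw [norm_prod]
    exact Finset.prod_le_one (fun _ _ => norm_nonneg _) fun i _ => hf1 i _
  rw [int_mP hfac.nonneg hi, hc0, integral_smul_measure, integral_map Phi_meas.aemeasurable (show AEStronglyMeasurable (fun u => P (of u) • G u) _ from hPm.smul hG.aestronglyMeasurable)]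
  have hJ : ∀ᵐ p ∂(rho0 n), P (of (Phi p)) • G (Phi p) = ((P (Tmat p.1.2 * Zmat p.1.1) : ℂ) * ∏ i, f i |(of (p.1.1 i)).det|) * g p.2 := by
    have h1 : ∀ᵐ p ∂(rho0 n), ∀ j, (of (p.1.1 j)).det ≠ 0 :=
      (Measure.quasiMeasurePreserving_fst.comp Measure.quasiMeasurePreserving_fst).ae hzae'
    filter_upwards [h1] with p hp
    rw [hPP, show G (Phi p) = _ from hsplit p.1.2 p.1.1 hp p.2, Complex.real_smul, mul_assoc]
  rw [integral_congr_ae hJ, rho0, integral_prod_mul (fun q : Zs n × Cs n => (P (Tmat q.2 * Zmat q.1) : ℂ) * ∏ i, f i |(of (q.1 i)).det|) g, integral_prod _ hI3]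
  rw [integral_withDensity_eq_integral_toReal_smul₀ Jw_meas.aemeasurable.ennreal_ofReal (by simp)]
  rw [← integral_fintype_prod_eq_prod (𝕜 := ℂ) (E := fun _ => Fin 2 → Fin 2 → ℝ) (f := fun i z => (σw (of z) : ℂ) * ((|(of z).det| ^ (2 * (n - 1 - i.val)) : ℝ) * f i |(of z).det|))]
  rw [Complex.real_smul, mul_assoc]
  congr 2
  refine integral_congr_ae ?_
  filter_upwards [hfac.factor] with z hz
  rw [integral_mul_const, ENNReal.toReal_ofReal (Jw_nonneg z), Complex.real_smul, integral_complex_ofReal, Finset.prod_mul_distrib, Finset.prod_mul_distrib, ← Complex.ofReal_prod, ← hz, ← mul_assoc, ← mul_assoc]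
  congr 1
  rw [← Complex.ofReal_prod, ← Complex.ofReal_mul, ← Complex.ofReal_mul]
  congr 1
  have : Jw z = (∏ j : Fin n, ((of (z j)) * (of (z j))ᵀ).det ^ (n - 1 - j.val)) * ∏ j : Fin n, |(of (z j)).det| ^ (2 * (n - 1 - j.val)) := by
    rw [← Finset.prod_mul_distrib]
    refine Finset.prod_congr rfl fun j _ => ?_
    rw [det_mul, det_transpose, ← abs_mul_abs_self, ← sq, ← pow_mul, ← pow_add]
    congr 1; omega
  rw [this]; ring


def Hc (h : ℝ → ℝ) (w : ℂ) : ℂ := ∫ t in Set.Ioi (0:ℝ), (h t : ℂ) * cpw t w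

def M0 (n : ℕ) (h : ℝ → ℝ) : ℝ := ∏ i : Fin n, ∫ t in Set.Ioi (0:ℝ), h t * t ^ (2 * (n - 1 - i.val))

lemma cj_meas (X : Mx N) : Measurable fun u : Us N => (of u * X * (of u)ᵀ : Mx N) := by
  have : Continuous fun u : Mx N => u * X * uᵀ := by fun_prop
  exact this.measurable

lemma cj_meas2 : Measurable fun p : Us N × Mx N => (of p.1 * p.2 * (of p.1)ᵀ : Mx N) := by
  have : Continuous fun p : Mx N × Mx N => p.1 * p.2 * p.1ᵀ := by fun_prop
  exact this.measurable

lemma sph_avg {P : Mx N → ℝ} (hp : IsProbabilityMeasure (mP P))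
    (hinv : ∀ k : OG N, ∀ u : Us N, P (k.1 * of u) = P (of u)) {e : ℕ → ℂ} (he : ∀ j, (e j).re = 0) (X : Mx N) :
    ∫ u : Us N, sph e (of u * X * (of u)ᵀ) ∂(mP P) = ∫ u : Us N, chi e (of u * X * (of u)ᵀ) ∂(mP P) := by
  unfold sph
  have hm : Measurable fun p : Us N × OG N => chi e (p.2.1 * (of p.1 * X * (of p.1)ᵀ) * p.2.1ᵀ) := by
    refine (chi_meas e).comp ?_
    have : Continuous fun p : Mx N × OG N => p.2.1 * (p.1 * X * p.1ᵀ) * p.2.1ᵀ := by fun_prop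
    exact this.measurable
  rw [integral_integral_swap (f := fun (u : Us N) (k : OG N) => chi e (k.1 * (of u * X * (of u)ᵀ) * k.1ᵀ))]
  · have : ∀ k : OG N, ∫ u : Us N, chi e (k.1 * (of u * X * (of u)ᵀ) * k.1ᵀ) ∂(mP P) = ∫ u : Us N, chi e (of u * X * (of u)ᵀ) ∂(mP P) := by
      intro k
      rw [← (mP_mp (lmE k) (lmE_mp k) (hinv k)).integral_comp' (g := fun u : Us N => chi e (of u * X * (of u)ᵀ))]
      refine integral_congr_ae (evf fun u => ?_)
      show chi e (k.1 * (of u * X * (of u)ᵀ) * k.1ᵀ) = chi e ((k.1 * of u) * X * (k.1 * of u)ᵀ)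
      rw [transpose_mul]
      simp only [Matrix.mul_assoc]
    simp [this]
  · refine Integrable.of_bound hm.aestronglyMeasurable 1 (evf fun p => chi_norm he _)

lemma mult {P : Mx (2 * n) → ℝ} {σw : Mx 2 → ℝ} (hfac : IsFactorizing n P σw)
    {h : ℝ → ℝ} (hdet : IsDetDensity σw h) (hh : IntegrableOn h (Set.Ioi 0)) (hpos : 0 < ∫ t in Set.Ioi 0, h t)
    {e : ℕ → ℂ} (he : ∀ j, (e j).re = 0) (X : Mx (2*n)) :
    ∫ u : Us (2*n), sph e (of u * X * (of u)ᵀ) ∂(mP P) = (∏ i : Fin n, Hc h (2 * rho e n i)) / (M0 n h : ℂ) * sph e X := by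
  have hpr := mP_prob hfac.nonneg hfac.integrable hfac.prob
  rw [sph_avg hpr (fun k u => by simpa using hfac.invariant (of u) k.1 k.2 1 (one_mem _)) he]
  obtain ⟨c, hc⟩ := mult_gen hfac
  have h1 := hc (fun _ _ => 1) (fun _ => 1) (fun _ => 1) (fun _ => measurable_const) (by simp) measurable_const (by simp)
  simp only [mul_one, integral_const, probReal_univ, one_smul] at h1
  have h2 : ∀ i : Fin n, ∫ z : Fin 2 → Fin 2 → ℝ, (σw (of z) : ℂ) * ((|(of z).det| ^ (2 * (n - 1 - i.val)) : ℝ) : ℂ) = ((∫ t in Set.Ioi (0:ℝ), h t * t ^ (2 * (n - 1 - i.val)) : ℝ) : ℂ) := by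
    intro i
    rw [det_law hfac.wnonneg hdet hh hpos (fun t => ((t ^ (2 * (n - 1 - i.val)) : ℝ) : ℂ)) (by fun_prop), ← integral_complex_ofReal]
    simp
  simp only [h2] at h1
  rw [← Complex.ofReal_prod] at h1
  change 1 = (c : ℂ) * (M0 n h : ℂ) at h1
  have hM : (M0 n h : ℂ) ≠ 0 := fun h => by rw [h, mul_zero] at h1; exact one_ne_zero h1
  have hcM : (c : ℂ) = (M0 n h : ℂ)⁻¹ := (eq_inv_of_mul_eq_one_left h1.symm)
  have hre : ∀ i, (2 * ∑ j ∈ Finset.Ico i n, e j).re = 0 := by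
    intro i; simp [he]
  rw [hc (fun i t => cpw t (2 * ∑ j ∈ Finset.Ico i.val n, e j)) (fun k => chi e (k.1 * X * k.1ᵀ)) (fun u : Us (2*n) => chi e (of u * X * (of u)ᵀ))
    (fun i => cpw_meas _) (fun i t => cpw_norm (hre i) t) ((chi_meas e).comp (cj_meas X))]
  · rw [hcM, div_eq_inv_mul]
    congr 2
    refine Finset.prod_congr rfl fun i _ => ?_
    rw [det_law hfac.wnonneg hdet hh hpos (fun t => ((t ^ (2 * (n - 1 - i.val)) : ℝ) : ℂ) * cpw t (2 * ∑ j ∈ Finset.Ico i.val n, e j))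
      (Measurable.mul (by fun_prop) (cpw_meas _))]
    refine setIntegral_congr_fun measurableSet_Ioi fun t ht => ?_
    have ht' : (0:ℝ) < t := ht
    have h3 : (2 * rho e n i) = ((2 * (n - 1 - i.val) : ℕ) : ℝ) + 2 * ∑ j ∈ Finset.Ico i.val n, e j := by
      have := i.2
      rw [rho, Nat.cast_mul, Nat.sub_sub, Nat.cast_sub (by omega)]
      push_cast; ring
    beta_reduce
    rw [h3, cpw_add, cpw_real ht', Real.rpow_natCast]
  · intro c z hz k
    have := chi_TZ e c z hz (k.1 * X * k.1ᵀ)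
    unfold ms at this
    rw [← this]
    show chi e ((Tmat c * Zmat z) * k.1 * X * ((Tmat c * Zmat z) * k.1)ᵀ) = _
    rw [transpose_mul (Tmat c * Zmat z)]
    simp only [Matrix.mul_assoc]

lemma M0_ne {P : Mx (2 * n) → ℝ} {σw : Mx 2 → ℝ} (hfac : IsFactorizing n P σw)
    {h : ℝ → ℝ} (hmell : ∀ j : ℕ, j < n → 0 < ∫ t in Set.Ioi (0:ℝ), h t * t ^ (2 * j)) : 0 < M0 n h :=
  Finset.prod_pos fun i _ => hmell _ (by have := i.2; omega)


def V0 (y : Fin n → ℝ) : ℝ := (vandermonde fun i => y i ^ 2).det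

def Nm (e : ℕ → ℂ) (y : Fin n → ℝ) : ℂ := (of fun i j : Fin n => cpw (y i ^ 2) (rho e n j)).det

def Tf (e : ℕ → ℂ) (y : Fin n → ℝ) : ℂ := Nm e y / (V0 y : ℂ)

def Ds (y : Fin n → ℝ) : Prop := (∀ i, 0 < y i) ∧ Function.Injective y

lemma V0_perm (y : Fin n → ℝ) (σ : Equiv.Perm (Fin n)) : V0 (y ∘ σ) = (Equiv.Perm.sign σ : ℝ) * V0 y := by
  unfold V0
  rw [← det_permute]; rfl

lemma Nm_perm (e : ℕ → ℂ) (y : Fin n → ℝ) (σ : Equiv.Perm (Fin n)) : Nm e (y ∘ σ) = (Equiv.Perm.sign σ : ℂ) * Nm e y := by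
  unfold Nm
  rw [← det_permute]; rfl

lemma Tf_perm (e : ℕ → ℂ) (y : Fin n → ℝ) (σ : Equiv.Perm (Fin n)) : Tf e (y ∘ σ) = Tf e y := by
  unfold Tf
  rw [V0_perm, Nm_perm]
  rcases Int.units_eq_one_or (Equiv.Perm.sign σ) with h | h <;> simp [h, neg_div_neg_eq]

lemma V0_cont : Continuous (V0 (n := n)) := by
  unfold V0
  refine Continuous.matrix_det ?_
  refine continuous_matrix fun i j => ?_
  simp only [vandermonde_apply]; fun_prop

lemma V0_ne {y : Fin n → ℝ} (h : Ds y) : V0 y ≠ 0 := by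
  refine det_vandermonde_ne_zero_iff.mpr fun i j hij => h.2 ?_
  exact (pow_left_inj₀ (h.1 i).le (h.1 j).le two_ne_zero).mp hij

lemma Nm_meas (e : ℕ → ℂ) : Measurable (Nm e (n := n)) := by
  unfold Nm
  simp_rw [det_apply']
  refine Finset.measurable_fun_sum _ fun σ _ => Measurable.const_mul ?_ _
  refine Finset.measurable_fun_prod _ fun i _ => ?_
  exact (cpw_meas _).comp ((measurable_pi_apply _).pow_const 2)

lemma Tf_meas (e : ℕ → ℂ) : Measurable (Tf e (n := n)) :=
  (Nm_meas e).div (Complex.measurable_ofReal.comp V0_cont.measurable)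

lemma sort_ds {y : Fin n → ℝ} (h : Ds y) : ∃ σ : Equiv.Perm (Fin n), StrictAnti (y ∘ σ) ∧ ∀ i, 0 < (y ∘ σ) i := by
  let σ := Tuple.sort (fun i => - y i)
  have hmono : Monotone ((fun i => - y i) ∘ σ) := Tuple.monotone_sort _
  refine ⟨σ, ?_, fun i => h.1 _⟩
  have h1 : Antitone (y ∘ σ) := by
    intro i j hij
    have := hmono hij
    simp only [Function.comp] at this ⊢
    linarith
  exact h1.strictAnti_of_injective (h.2.comp σ.injective)

lemma sph_T (n : ℕ) : ∃ Z : ℝ, Z ≠ 0 ∧ ∀ e : ℕ → ℂ, (∀ j, (e j).re = 0) → ∀ y : Fin n → ℝ, Ds y →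
    sph e (Dmat y) = Z / pf e (2 * n) * Tf e y := by
  obtain ⟨Z, hZ, hf⟩ := sph_formula (2 * n)
  set ε : ℝ := ∏ i : Fin n, ∏ j ∈ Finset.Ioi i, (-1 : ℝ) with hε
  have hε1 : ε ≠ 0 := by
    rw [hε]; exact Finset.prod_ne_zero_iff.mpr fun i _ => Finset.prod_ne_zero_iff.mpr fun j _ => by norm_num
  refine ⟨Z / ε, div_ne_zero hZ.ne' hε1, fun e he y hy => ?_⟩
  obtain ⟨σ, h1, h2⟩ := sort_ds hy
  have hn : 2 * n / 2 = n := by omega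
  obtain ⟨k, hk, hk2⟩ := DN_perm hn y σ
  have h3 : sph e (Dmat y) = sph e (DN (2*n) (ex (y ∘ σ))) := by
    rw [hk2, sph_conj e _ hk, Dmat_eq]
  rw [h3, hf e he n hn _ h1 h2, ← Tf_perm e y σ]
  set a := y ∘ σ
  have h4 : |V0 a| = ε * V0 a := by
    unfold V0
    rw [det_vandermonde, hε, ← Finset.prod_mul_distrib, Finset.abs_prod]
    refine Finset.prod_congr rfl fun i _ => ?_
    rw [← Finset.prod_mul_distrib, Finset.abs_prod]
    refine Finset.prod_congr rfl fun j hj => ?_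
    have := h1 (Finset.mem_Ioi.mp hj)
    have := h2 j
    rw [abs_of_neg (by nlinarith)]; ring
  have h5 : sform e (fun i => a i ^ 2) = Nm e a / ((|V0 a| : ℝ) : ℂ) := rfl
  have h6 : V0 a ≠ 0 := by
    have := vand_ne (β := fun i => a i ^ 2) (fun i j hij => by have := h1 hij; have := h2 j; have := h2 i; simp only; nlinarith)
    exact this
  rw [h5, h4, Tf]
  have h7 : (ε : ℂ) ≠ 0 := by exact_mod_cast hε1
  have h8 : (V0 a : ℂ) ≠ 0 := by exact_mod_cast h6
  have h9 := pf_ne he (2 * n)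
  push_cast
  field_simp

lemma Tf_bound (n : ℕ) : ∃ Z : ℝ, ∀ e : ℕ → ℂ, (∀ j, (e j).re = 0) → ∀ y : Fin n → ℝ, Ds y → ‖Tf e y‖ ≤ Z * ‖pf e (2*n)‖ := by
  obtain ⟨Z, hZ, h⟩ := sph_T n
  refine ⟨|Z|⁻¹, fun e he y hy => ?_⟩
  have h1 := sph_norm he (Dmat y)
  rw [h e he y hy, norm_mul, norm_div, Complex.norm_real, Real.norm_eq_abs] at h1
  have h9 : 0 < ‖pf e (2 * n)‖ := norm_pos_iff.mpr (pf_ne he (2 * n))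
  have hz : 0 < |Z| := abs_pos.mpr hZ
  rw [div_mul_eq_mul_div, div_le_one h9] at h1
  rw [inv_mul_eq_div, le_div_iff₀ hz]; linarith

lemma sect (n : ℕ) : ∃ S : (ℕ → ℝ) → (Fin n → ℝ), Measurable S ∧ ∀ a, StrictAnti a → (∀ i, 0 < a i) →
    S (fun l : ℕ => ∏ j, ((l:ℝ) ^ 2 + a j ^ 2)) = a := by
  set W : Set (Fin n → ℝ) := {a | StrictAnti a ∧ ∀ i, 0 < a i} with hW
  have hWm : MeasurableSet W := by
    have : W = (⋂ i : Fin n, ⋂ j : Fin n, {a | i < j → a j < a i}) ∩ ⋂ i : Fin n, {a | 0 < a i} := by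
      ext a; simp only [hW, StrictAnti, Set.mem_setOf_eq, Set.mem_inter_iff, Set.mem_iInter]

    rw [this]
    refine MeasurableSet.inter (MeasurableSet.iInter fun i => MeasurableSet.iInter fun j => ?_) (MeasurableSet.iInter fun i => ?_)
    · by_cases hij : i < j
      · simp only [hij, true_imp_iff]
        exact measurableSet_lt (measurable_pi_apply _) (measurable_pi_apply _)
      · simp [hij]
    · exact measurableSet_lt measurable_const (measurable_pi_apply _)
  let E : (Fin n → ℝ) → (ℕ → ℝ) := fun a l => ∏ j, ((l:ℝ) ^ 2 + a j ^ 2)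
  have hE : Continuous E := by
    refine continuous_pi fun l => ?_
    simp only [E]; fun_prop
  have hinj : Set.InjOn E W := by
    intro a ha b hb hab
    refine sorted_unique ha.1.antitone hb.1.antitone (fun i => (ha.2 i).le) (fun i => (hb.2 i).le) fun l _ => congrFun hab l
  have hemb := hE.continuousOn.measurableEmbedding hWm hinj
  obtain ⟨S, hS, hS2⟩ := hemb.exists_measurable_extend (g := fun x : W => x.1) measurable_subtype_coe (fun _ => ⟨fun _ => 0⟩)
  exact ⟨S, hS, fun a h1 h2 => congrFun hS2 ⟨a, h1, h2⟩⟩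


def hq {R : Type} [CommRing R] (n : ℕ) (Y : Matrix (Fin N) (Fin N) R) : R :=
  Y.det * (of fun i j : Fin n => (Y ^ (2 * (i.val + j.val))).trace).det

lemma hq_map {R S : Type} [CommRing R] [CommRing S] (f : R →+* S) (n : ℕ) (Y : Matrix (Fin N) (Fin N) R) :
    f (hq n Y) = hq n (Y.map f) := by
  unfold hq
  rw [map_mul, RingHom.map_det, RingHom.map_det]
  congr 2
  ext i j
  have : (f.mapMatrix Y) ^ (2 * (i.val + j.val)) = f.mapMatrix (Y ^ (2 * (i.val + j.val))) := (map_pow _ _ _).symm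
  simp only [RingHom.mapMatrix_apply] at this ⊢
  simp only [map_apply, of_apply, this]
  simp [Matrix.trace]

lemma sum_half (n : ℕ) (f : ℕ → ℝ) : ∑ i : Fin (2 * n), f (i.val / 2) = 2 * ∑ i : Fin n, f i := by
  rw [← Finset.sum_range (fun i => f (i / 2)), ← Finset.sum_range f]
  induction n with
  | zero => simp
  | succ n ih =>
    rw [show 2 * (n+1) = 2 * n + 1 + 1 by ring, Finset.sum_range_succ, Finset.sum_range_succ, ih, Finset.sum_range_succ]
    have h1 : (2 * n + 1) / 2 = n := by omega
    have h2 : (2 * n) / 2 = n := by omega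
    rw [h1, h2]; ring

lemma conj_pow {k : Mx N} (hk : k ∈ Og N) (Y : Mx N) (m : ℕ) :
    (k * Y * kᵀ) ^ m = k * Y ^ m * kᵀ := by
  have h := (mem_orthogonalGroup_iff' _ _).mp hk
  have h' := (mem_orthogonalGroup_iff _ _).mp hk
  change kᵀ * k = 1 at h
  change k * kᵀ = 1 at h'
  induction m with
  | zero => simp [h']
  | succ m ih =>
    rw [pow_succ, ih, pow_succ]
    calc k * Y ^ m * kᵀ * (k * Y * kᵀ) = k * Y ^ m * (kᵀ * k) * Y * kᵀ := by simp only [Matrix.mul_assoc]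
      _ = _ := by rw [h]; simp only [Matrix.mul_assoc, Matrix.one_mul]

lemma hq_DN (b : Fin n → ℝ) {k : Mx (2*n)} (hk : k ∈ Og (2*n)) :
    hq n (k * DN (2*n) (ex b) * kᵀ) ≠ 0 ↔ (∀ i, b i ≠ 0) ∧ Function.Injective (fun i => b i ^ 2) := by
  have h := (mem_orthogonalGroup_iff' _ _).mp hk
  change kᵀ * k = 1 at h
  have h1 : (k * DN (2*n) (ex b) * kᵀ).det = ∏ j, b j ^ 2 := by
    have h2 := spec_DN_ex (show 2 * n / 2 = n by omega) b 0
    rw [← spec_conj hk] at h2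
    simp only [spec, zero_smul, zero_sub, det_neg, Fintype.card_fin, pow_mul] at h2
    simpa using h2
  have h3 : (of fun i j : Fin n => ((k * DN (2*n) (ex b) * kᵀ) ^ (2 * (i.val + j.val))).trace)
      = (2:ℝ) • ((vandermonde fun i => - b i ^ 2)ᵀ * vandermonde fun i => - b i ^ 2) := by
    ext i j
    rw [of_apply, conj_pow hk, Matrix.mul_assoc, trace_mul_comm, Matrix.mul_assoc, h, Matrix.mul_one, pow_mul, sq,
      DN_sq _ _ (by omega), Matrix.smul_apply, mul_apply, diagonal_neg, diagonal_pow, trace_diagonal]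
    simp only [transpose_apply, vandermonde_apply, ← pow_add, smul_eq_mul, Pi.pow_apply]
    have := sum_half n (fun l => (- ex b l ^ 2) ^ (i.val + j.val))
    simpa using this
  rw [hq, h1, h3, det_smul, det_mul, det_transpose]
  simp only [ne_eq, mul_eq_zero, not_or, Finset.prod_eq_zero_iff, pow_eq_zero_iff, or_self]
  rw [← ne_eq (vandermonde _).det, det_vandermonde_ne_zero_iff]
  constructor
  · rintro ⟨h5, h6, h7⟩
    refine ⟨fun i hi => h5 ⟨i, Finset.mem_univ _, by simp [hi]⟩, fun i j hij => h7 ?_⟩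
    simp only at hij ⊢; rw [hij]
  · rintro ⟨h5, h6⟩
    have h7 : Function.Injective fun i => - b i ^ 2 := fun i j hij => h6 (neg_injective hij)
    refine ⟨fun ⟨i, _, hi⟩ => h5 i (by simpa using hi), by simp, h7⟩

lemma nf_ae {a : Fin n → ℝ} (ha : Ds a) : ∀ᵐ u : Us (2*n), ∃ b : Fin n → ℝ, (StrictAnti b ∧ ∀ i, 0 < b i) ∧
    ∃ k ∈ Og (2*n), (of u : Mx (2*n)) * Dmat a * (of u)ᵀ = k * Dmat b * kᵀ := by
  have i1 : (volume : Measure (Us (2*n))).IsAddHaarMeasure := by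
    have i2 : (volume : Measure (Fin (2*n) → ℝ)).IsAddHaarMeasure := inferInstance
    exact Measure.pi.isAddHaarMeasure _
  have key : ∀ᵐ u : Us (2*n), hq n ((of u : Mx (2*n)) * Dmat a * (of u)ᵀ) ≠ 0 := by
    refine null_scale (fun u : Us (2*n) => hq n ((of u : Mx (2*n)) * Dmat a * (of u)ᵀ)) ?_ (1 : Mx (2*n)) fun x => ?_
    · have hc : Continuous fun u : Us (2*n) => (of u : Mx (2*n)) := continuous_id
      have h2 : Continuous fun u : Us (2*n) => (of u : Mx (2*n)) * Dmat a * (of u)ᵀ := by fun_prop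
      have h3 : Continuous fun Y : Mx (2*n) => hq n Y := by
        unfold hq
        refine (Continuous.matrix_det continuous_id).mul (Continuous.matrix_det ?_)
        refine continuous_matrix fun i j => ?_
        exact (continuous_pow _).matrix_trace
      exact h3.comp h2
    · let A : Matrix (Fin (2*n)) (Fin (2*n)) (Polynomial ℝ) := 1 + (Polynomial.X : Polynomial ℝ) • (of x).map Polynomial.C
      have hA : ∀ t, A.map (Polynomial.evalRingHom t) = 1 + t • (of x : Mx (2*n)) := by
        intro t
        ext i j
        simp [A, Matrix.one_apply, apply_ite]
        exact mul_comm _ _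
      have key : ∀ t, (hq n (A * (Dmat a).map Polynomial.C * Aᵀ)).eval t = hq n ((1 + t • (of x : Mx (2*n))) * Dmat a * (1 + t • (of x : Mx (2*n)))ᵀ) := by
        intro t
        rw [← Polynomial.coe_evalRingHom, hq_map]
        refine congrArg (hq n) ?_
        rw [Matrix.map_mul, Matrix.map_mul, hA, transpose_map, hA]
        congr 2
        ext i j
        simp
      have h := poly_countable _ 0 (by
        rw [key]
        have := (hq_DN a (one_mem (Og (2*n)))).mpr ⟨fun i => (ha.1 i).ne', fun i j hij => ha.2 ((pow_left_inj₀ (ha.1 i).le (ha.1 j).le two_ne_zero).mp hij)⟩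
        rw [← Dmat_eq] at this
        simpa using this)
      simp only [key] at h
      exact h
  filter_upwards [key] with u hu
  have hsk : ((of u : Mx (2*n)) * Dmat a * (of u)ᵀ)ᵀ = - ((of u : Mx (2*n)) * Dmat a * (of u)ᵀ) := by
    rw [transpose_mul, transpose_mul, transpose_transpose, Dmat_eq, DN_transpose]
    simp [Matrix.mul_assoc]
  obtain ⟨b, hb1, hb2, k, hk, hk2⟩ := normal_form (2*n) n (by omega) _ hsk
  rw [hk2] at hu
  obtain ⟨h1, h2⟩ := (hq_DN b hk).mp hu
  refine ⟨b, ⟨hb1.strictAnti_of_injective fun i j hij => h2 (by simp only [hij]), fun i => lt_of_le_of_ne (hb2 i) (h1 i).symm⟩, k, hk, ?_⟩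
  rw [hk2, Dmat_eq]

lemma radial (n : ℕ) : ∃ R : Mx (2*n) → Fin n → ℝ, Measurable R ∧
    ∀ b : Fin n → ℝ, StrictAnti b → (∀ i, 0 < b i) → ∀ k ∈ Og (2*n), R (k * Dmat b * kᵀ) = b := by
  obtain ⟨S, hS, hS2⟩ := sect n
  refine ⟨fun X => S (fun l : ℕ => spec X l), hS.comp (measurable_pi_lambda _ fun l => ?_), fun b h1 h2 k hk => ?_⟩
  · have : Continuous fun X : Mx (2*n) => spec X l := by
      unfold spec
      refine Continuous.matrix_det ?_
      fun_prop
    exact this.measurable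
  · have : ∀ l : ℕ, spec (k * Dmat b * kᵀ) l = ∏ j, ((l:ℝ)^2 + b j ^ 2) := by
      intro l
      rw [spec_conj hk, Dmat_eq, spec_DN_ex (show 2 * n / 2 = n by omega) b]
      simp
    simp only [this]
    exact hS2 b h1 h2


def es (s : Fin n → ℝ) (j : ℕ) : ℂ := Complex.I * ((ex s j - ex s (j+1) : ℝ) : ℂ) / 2

lemma es_re (s : Fin n → ℝ) (j : ℕ) : (es s j).re = 0 := by
  unfold es
  rw [mul_div_assoc, ← Complex.ofReal_ofNat, ← Complex.ofReal_div]
  simp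

lemma rho_es (s : Fin n → ℝ) (c : Fin n) : rho (es s) n c = Complex.I * s c / 2 + ((n:ℂ) - 1 - c) := by
  unfold rho
  have h : ∀ m, c.val ≤ m → ∑ i ∈ Finset.Ico c.val m, es s i = Complex.I * ((ex s c - ex s m : ℝ) : ℂ) / 2 := by
    intro m hm
    induction m, hm using Nat.le_induction with
    | base => simp
    | succ m hm ih =>
      rw [Finset.sum_Ico_succ_top hm, ih, es]; push_cast; ring
  rw [h n c.2.le, ex_fin]
  have : ex s n = 0 := by simp [ex]
  rw [this]; push_cast; ring

def Gam (κ : Fin n → ℂ) (s : Fin n → ℝ) : ℂ := ∏ c, Complex.exp (-(1/2) * (s c:ℂ) ^ 2 + κ c * s c)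

def dl (n : ℕ) (c : Fin n) : ℂ := (n:ℂ) - 1 - c

def Gc : ℂ := (Real.pi / -(-(1/2) : ℂ)) ^ (1/2 : ℂ)

lemma Gc_ne : Gc ≠ 0 := by
  unfold Gc
  rw [Complex.cpow_ne_zero_iff]
  left
  simp [Real.pi_ne_zero]

def Bk (κ : Fin n → ℂ) (y : Fin n → ℝ) : ℂ := ∑ σ : Equiv.Perm (Fin n), ((Equiv.Perm.sign σ : ℤ) : ℂ) *
  ∏ c, Complex.exp ((κ c + Complex.I * Real.log (y (σ c))) ^ 2 / 2 + 2 * dl n c * Real.log (y (σ c)))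

lemma cpw_es (s : Fin n → ℝ) (c : Fin n) {y : ℝ} (hy : 0 < y) :
    cpw (y ^ 2) (rho (es s) n c) = Complex.exp (Complex.I * Real.log y * s c + 2 * dl n c * Real.log y) := by
  unfold cpw
  rw [if_neg (by positivity), rho_es, Real.log_pow, dl]
  congr 1; push_cast; ring

lemma gauss1 (κ : Fin n → ℂ) {y : Fin n → ℝ} (hy : ∀ i, 0 < y i) :
    ∫ s : Fin n → ℝ, Gam κ s * Nm (es s) y = Gc ^ n * Bk κ y := by
  have h1 : ∀ s : Fin n → ℝ, Gam κ s * Nm (es s) y = ∑ σ : Equiv.Perm (Fin n), ((Equiv.Perm.sign σ : ℤ) : ℂ) *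
      ∏ c, Complex.exp (-(1/2) * (s c:ℂ) ^ 2 + (κ c + Complex.I * Real.log (y (σ c))) * s c + 2 * dl n c * Real.log (y (σ c))) := by
    intro s
    rw [Nm, det_apply', Finset.mul_sum]
    refine Finset.sum_congr rfl fun σ _ => ?_
    rw [mul_left_comm, Gam, ← Finset.prod_mul_distrib]
    refine congrArg _ (Finset.prod_congr rfl fun c _ => ?_)
    rw [of_apply, cpw_es s c (hy _), ← Complex.exp_add]
    congr 1; ring
  simp_rw [h1]
  have hb : (-(1/2) : ℂ).re < 0 := by norm_num
  rw [integral_finset_sum]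
  · rw [Bk, Finset.mul_sum]
    refine Finset.sum_congr rfl fun σ _ => ?_
    rw [integral_const_mul, mul_left_comm]
    refine congrArg _ ?_
    have h2 := integral_fintype_prod_eq_prod (𝕜 := ℂ) (μ := fun _ : Fin n => (volume : Measure ℝ)) (fun c (t:ℝ) => Complex.exp (-(1/2) * (t:ℂ) ^ 2 + (κ c + Complex.I * Real.log (y (σ c))) * t + 2 * dl n c * Real.log (y (σ c))))
    refine h2.trans ?_
    simp_rw [integral_cexp_quadratic hb]
    rw [Finset.prod_mul_distrib, Finset.prod_const, Finset.card_univ, Fintype.card_fin]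
    refine congrArg₂ _ rfl (Finset.prod_congr rfl fun c _ => ?_)
    congr 1; ring
  · intro σ _
    refine Integrable.const_mul ?_ _
    exact Integrable.fintype_prod (μ := fun _ : Fin n => (volume : Measure ℝ)) (f := fun c (t:ℝ) => Complex.exp (-(1/2) * (t:ℂ) ^ 2 + (κ c + Complex.I * Real.log (y (σ c))) * t + 2 * dl n c * Real.log (y (σ c)))) fun c => integrable_cexp_quadratic' hb _ _

def kap (ξ : Fin n → ℝ) (τ : Equiv.Perm (Fin n)) (c : Fin n) : ℂ := ξ c - 2 * Complex.I * ((τ c).val - dl n c)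

lemma gauss2 (ξ : Fin n → ℝ) {y : Fin n → ℝ} (hy : ∀ i, 0 < y i) :
    ∑ τ : Equiv.Perm (Fin n), ((Equiv.Perm.sign τ : ℤ) : ℂ) * (∏ c, Complex.exp (- (kap ξ τ c) ^ 2 / 2)) * Bk (kap ξ τ) y =
     V0 y * ∑ σ : Equiv.Perm (Fin n), (Real.exp (-(∑ c, Real.log (y c) ^ 2) / 2) : ℂ) * Complex.exp ((∑ c, ξ c * Real.log (y (σ c)) : ℝ) * Complex.I) := by
  simp_rw [Bk, Finset.mul_sum]
  rw [Finset.sum_comm]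
  refine Finset.sum_congr rfl fun σ _ => ?_
  have h1 : ∀ τ : Equiv.Perm (Fin n), ((Equiv.Perm.sign τ : ℤ) : ℂ) * (∏ c, Complex.exp (- (kap ξ τ c) ^ 2 / 2)) *
      (((Equiv.Perm.sign σ : ℤ) : ℂ) * ∏ c, Complex.exp ((kap ξ τ c + Complex.I * Real.log (y (σ c))) ^ 2 / 2 + 2 * dl n c * Real.log (y (σ c))))
      = ((Equiv.Perm.sign σ : ℤ) : ℂ) * ((Real.exp (-(∑ c, Real.log (y c) ^ 2) / 2) : ℂ) * Complex.exp ((∑ c, ξ c * Real.log (y (σ c)) : ℝ) * Complex.I)) *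
        (((Equiv.Perm.sign τ : ℤ) : ℂ) * ∏ c, (((y (σ c) ^ 2) ^ (τ c).val : ℝ) : ℂ)) := by
    intro τ
    have h2 : (∏ c, Complex.exp (- (kap ξ τ c) ^ 2 / 2)) * ∏ c, Complex.exp ((kap ξ τ c + Complex.I * Real.log (y (σ c))) ^ 2 / 2 + 2 * dl n c * Real.log (y (σ c)))
       = ((Real.exp (-(∑ c, Real.log (y c) ^ 2) / 2) : ℂ) * Complex.exp ((∑ c, ξ c * Real.log (y (σ c)) : ℝ) * Complex.I)) * ∏ c, (((y (σ c) ^ 2) ^ (τ c).val : ℝ) : ℂ) := by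
      have h3 : ∑ c, Real.log (y c) ^ 2 = ∑ c, Real.log (y (σ c)) ^ 2 := (Equiv.sum_comp σ fun c => Real.log (y c) ^ 2).symm
      rw [h3, neg_div, Finset.sum_div, ← Finset.sum_neg_distrib, Complex.ofReal_exp, Complex.ofReal_sum, Complex.exp_sum, Complex.ofReal_sum, Finset.sum_mul, Complex.exp_sum,
        ← Finset.prod_mul_distrib, ← Finset.prod_mul_distrib, ← Finset.prod_mul_distrib]
      refine Finset.prod_congr rfl fun c _ => ?_
      have h4 : ((y (σ c) ^ 2) ^ (τ c).val : ℝ) = Real.exp (2 * (τ c).val * Real.log (y (σ c))) := by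
        rw [← pow_mul, ← Real.rpow_natCast, Real.rpow_def_of_pos (hy _)]; push_cast; congr 1; ring
      rw [h4, Complex.ofReal_exp, ← Complex.exp_add, ← Complex.exp_add, ← Complex.exp_add]
      congr 1
      rw [kap]
      push_cast
      have := Complex.I_sq
      linear_combination (Real.log (y (σ c)) ^ 2 / 2 - 2 * (((τ c).val : ℂ) - dl n c) * Real.log (y (σ c)) : ℂ) * this
    linear_combination ((Equiv.Perm.sign τ : ℤ) : ℂ) * ((Equiv.Perm.sign σ : ℤ) : ℂ) * h2
  simp_rw [h1]
  rw [← Finset.mul_sum]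
  have h5 : ∑ τ : Equiv.Perm (Fin n), (((Equiv.Perm.sign τ : ℤ) : ℂ) * ∏ c, (((y (σ c) ^ 2) ^ (τ c).val : ℝ) : ℂ)) = ((Equiv.Perm.sign σ : ℤ) : ℂ) * V0 y := by
    have h6 : (V0 (y ∘ σ) : ℂ) = ((Equiv.Perm.sign σ : ℤ) : ℂ) * V0 y := by rw [V0_perm]; push_cast; rfl
    rw [← h6, V0, ← det_transpose, det_apply']
    push_cast
    refine Finset.sum_congr rfl fun τ _ => ?_
    simp [vandermonde_apply]
  rw [h5]
  have h7 : ((Equiv.Perm.sign σ : ℤ) : ℂ) * ((Equiv.Perm.sign σ : ℤ) : ℂ) = 1 := by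
    rcases Int.units_eq_one_or (Equiv.Perm.sign σ) with h | h <;> simp [h]
  linear_combination ((Real.exp (-(∑ c, Real.log (y c) ^ 2) / 2) : ℂ) * Complex.exp ((∑ c, ξ c * Real.log (y (σ c)) : ℝ) * Complex.I)) * V0 y * h7


lemma pf_le {e : ℕ → ℂ} {A : ℝ} (hA : 1 ≤ A) (h : ∀ m ≤ n, ∀ j < m, ∀ (b : Prop) [Decidable b], ‖rho e m j + if b then 1 else 1/2‖ ≤ A) :
    ∀ N, N ≤ 2 * n → ‖pf e N‖ ≤ A ^ (N * n) := by
  intro N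
  induction N with
  | zero => intro _; simp [pf]
  | succ N ih =>
    intro hN
    rw [pf, norm_mul, norm_prod, show (N+1) * n = N * n + n by ring, pow_add]
    refine mul_le_mul (ih (by omega)) ?_ (Finset.prod_nonneg fun _ _ => norm_nonneg _) (by positivity)
    have hm : N / 2 ≤ n := by omega
    calc ∏ j : Fin (N/2), ‖rho e (N/2) j + if N % 2 = 1 then 1 else 1/2‖ ≤ ∏ j : Fin (N/2), A :=
        Finset.prod_le_prod (fun _ _ => norm_nonneg _) fun j _ => h _ hm _ j.2 _
      _ = A ^ (N/2) := by simp
      _ ≤ A ^ n := pow_le_pow_right₀ hA hm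

lemma pf_es (n : ℕ) : ∃ C L : ℝ, ∀ s : Fin n → ℝ, ‖pf (es s) (2*n)‖ ≤ Real.exp C * ∏ c, Real.exp (L * |s c|) := by
  refine ⟨(n + 1 : ℝ) * (2 * n * n : ℕ), (n : ℝ) * (2 * n * n : ℕ), fun s => ?_⟩
  set Q := ∑ c, |s c| with hQ
  have hQ0 : 0 ≤ Q := Finset.sum_nonneg fun _ _ => abs_nonneg _
  have h1 : ∀ j, |ex s j| ≤ Q := by
    intro j
    by_cases hj : j < n
    · rw [ex_lt s hj]
      exact Finset.single_le_sum (f := fun c => |s c|) (fun _ _ => abs_nonneg _) (Finset.mem_univ _)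
    · simp [ex, hj, hQ0]
  have h2 : ∀ j, ‖es s j‖ ≤ Q := by
    intro j
    rw [es, norm_div, norm_mul, Complex.norm_I, one_mul, Complex.norm_real, Complex.norm_ofNat, Real.norm_eq_abs]
    have := abs_sub (ex s j) (ex s (j+1))
    have := h1 j
    have := h1 (j+1)
    linarith
  have h3 := pf_le (e := es s) (n := n) (A := Real.exp (n * Q + n + 1)) (Real.one_le_exp (by positivity)) (by
    intro m hm j hj b _
    have hb : ‖(if b then 1 else 1/2 : ℂ)‖ ≤ 1 := by split_ifs <;> norm_num
    have h4 : ‖((m:ℂ) - 1 - j)‖ ≤ n := by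
      have : ((m:ℂ) - 1 - j) = ((m - 1 - j : ℝ) : ℂ) := by push_cast; rfl
      rw [this, Complex.norm_real, Real.norm_eq_abs]
      have a1 : ((j:ℕ):ℝ) + 1 ≤ m := by exact_mod_cast hj
      have a2 : (m:ℝ) ≤ n := by exact_mod_cast hm
      have a3 : (0:ℝ) ≤ j := Nat.cast_nonneg _
      rw [abs_of_nonneg (by linarith)]; linarith
    have h5 : ‖∑ i ∈ Finset.Ico j m, es s i‖ ≤ n * Q := by
      refine (norm_sum_le _ _).trans ((Finset.sum_le_card_nsmul _ _ Q fun i _ => h2 i).trans ?_)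
      rw [nsmul_eq_mul, Nat.card_Ico]
      refine mul_le_mul_of_nonneg_right ?_ hQ0
      exact_mod_cast (by omega : m - j ≤ n)
    rw [rho]
    refine (norm_add_le _ _).trans ((add_le_add ((norm_add_le _ _).trans (add_le_add h5 h4)) hb).trans ?_)
    linarith [Real.add_one_le_exp (n * Q + n + 1)]) (2*n) le_rfl
  refine h3.trans (le_of_eq ?_)
  rw [← Real.exp_sum, ← Finset.mul_sum, ← hQ, ← Real.exp_add, ← Real.exp_nat_mul]
  congr 1; ring

lemma cpw_meas2 : Measurable fun p : ℝ × ℂ => cpw p.1 p.2 := by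
  unfold cpw
  refine Measurable.ite (measurableSet_eq_fun measurable_fst measurable_const) measurable_const ?_
  refine Complex.measurable_exp.comp (measurable_snd.mul ?_)
  exact Complex.measurable_ofReal.comp (Real.measurable_log.comp measurable_fst)

lemma Tf_meas2 : Measurable fun p : (Fin n → ℝ) × (Fin n → ℝ) => Tf (es p.1) p.2 := by
  unfold Tf
  refine Measurable.div ?_ (Complex.measurable_ofReal.comp (V0_cont.measurable.comp measurable_snd))
  unfold Nm
  simp_rw [det_apply']
  refine Finset.measurable_fun_sum _ fun σ _ => Measurable.const_mul ?_ _
  refine Finset.measurable_fun_prod _ fun i _ => ?_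
  simp only [of_apply, rho_es]
  have h9 := cpw_meas2.comp (show Measurable fun p : (Fin n → ℝ) × (Fin n → ℝ) => (p.2 (σ i) ^ 2, Complex.I * (p.1 i : ℂ) / 2 + ((n:ℂ) - 1 - i)) by fun_prop)
  simp only [Function.comp_def] at h9
  exact h9

lemma gexp (κ : ℂ) (L : ℝ) : Integrable fun t : ℝ => ‖Complex.exp (-(1/2) * (t:ℂ) ^ 2 + κ * t)‖ * Real.exp (L * |t|) := by
  have hb : (-(1/2) : ℂ).re < 0 := by norm_num
  have h1 := (integrable_cexp_quadratic' hb (κ + L) 0).norm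
  have h2 := (integrable_cexp_quadratic' hb (κ - L) 0).norm
  refine (h1.add h2).mono' (by fun_prop) (evf fun t => ?_)
  have e0 : ∀ (z : ℂ) (r : ℝ), ‖Complex.exp (z + r)‖ = ‖Complex.exp z‖ * Real.exp r := by
    intro z r
    rw [Complex.norm_exp, Complex.norm_exp, ← Real.exp_add]; simp
  have e1 : ‖Complex.exp (-(1/2) * (t:ℂ) ^ 2 + (κ + L) * t + 0)‖ = ‖Complex.exp (-(1/2) * (t:ℂ) ^ 2 + κ * t)‖ * Real.exp (L * t) := by
    rw [← e0]; congr 2; push_cast; ring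
  have e2 : ‖Complex.exp (-(1/2) * (t:ℂ) ^ 2 + (κ - L) * t + 0)‖ = ‖Complex.exp (-(1/2) * (t:ℂ) ^ 2 + κ * t)‖ * Real.exp (-(L * t)) := by
    rw [← e0]; congr 2; push_cast; ring
  simp only [Pi.add_apply]
  rw [e1, e2, Real.norm_eq_abs, abs_of_nonneg (by positivity), ← mul_add]
  refine mul_le_mul_of_nonneg_left ?_ (norm_nonneg _)
  rcases abs_cases t with ⟨h, _⟩ | ⟨h, _⟩ <;> rw [h]
  · linarith [Real.exp_pos (-(L*t))]
  · rw [mul_neg]; linarith [Real.exp_pos ((L*t))]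

lemma fub (μ : Measure (Fin n → ℝ)) [IsFiniteMeasure μ] (hμ : ∀ᵐ y ∂μ, Ds y) (κ : Fin n → ℂ) :
    Integrable (fun y => Bk κ y / (V0 y : ℂ)) μ ∧
    ∫ s : Fin n → ℝ, Gam κ s * ∫ y, Tf (es s) y ∂μ = Gc ^ n * ∫ y, Bk κ y / (V0 y : ℂ) ∂μ := by
  obtain ⟨Z, hZ⟩ := Tf_bound n
  obtain ⟨C, L, hL⟩ := pf_es n
  have hG : Continuous (Gam κ) := by unfold Gam; fun_prop
  have hg : Integrable fun s : Fin n → ℝ => ∏ c, (‖Complex.exp (-(1/2) * (s c:ℂ) ^ 2 + κ c * s c)‖ * Real.exp (L * |s c|)) :=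
    Integrable.fintype_prod (μ := fun _ : Fin n => (volume : Measure ℝ)) (f := fun c (t:ℝ) => ‖Complex.exp (-(1/2) * (t:ℂ) ^ 2 + κ c * t)‖ * Real.exp (L * |t|)) fun c => gexp _ _
  have hint : Integrable (fun p : (Fin n → ℝ) × (Fin n → ℝ) => Gam κ p.1 * Tf (es p.1) p.2) (volume.prod μ) := by
    refine Integrable.mono' (hg.mul_prod (integrable_const (|Z| * Real.exp C))) ((hG.measurable.comp measurable_fst).mul Tf_meas2).aestronglyMeasurable ?_
    filter_upwards [Measure.quasiMeasurePreserving_snd.ae hμ] with p hp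
    have h1 := hZ (es p.1) (es_re _) p.2 hp
    have h2 := hL p.1
    have h3 : ‖Tf (es p.1) p.2‖ ≤ |Z| * (Real.exp C * ∏ c, Real.exp (L * |p.1 c|)) := by
      refine h1.trans ((mul_le_mul_of_nonneg_right (le_abs_self Z) (norm_nonneg _)).trans ?_)
      exact mul_le_mul_of_nonneg_left h2 (abs_nonneg _)
    rw [norm_mul, Finset.prod_mul_distrib, ← norm_prod]
    calc _ ≤ ‖Gam κ p.1‖ * (|Z| * (Real.exp C * ∏ c, Real.exp (L * |p.1 c|))) := mul_le_mul_of_nonneg_left h3 (norm_nonneg _)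
      _ = _ := by rw [Gam]; ring
  have h4 : ∀ᵐ y ∂μ, ∫ s, Gam κ s * Tf (es s) y = Gc ^ n * (Bk κ y / (V0 y : ℂ)) := by
    filter_upwards [hμ] with y hy
    simp_rw [Tf, ← mul_div_assoc]
    rw [integral_div, gauss1 κ hy.1]
  constructor
  · have h5 := (hint.integral_prod_right).congr h4
    have h6 := h5.const_mul (Gc ^ n)⁻¹
    refine h6.congr (evf fun y => ?_)
    simp only
    rw [inv_mul_cancel_left₀ (pow_ne_zero _ Gc_ne)]
  · simp_rw [← integral_const_mul (Gam κ _)]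
    have h7 := integral_integral_swap (f := fun s y => Gam κ s * Tf (es s) y) hint
    rw [h7, ← integral_const_mul]
    exact integral_congr_ae h4


def wq (y : Fin n → ℝ) : ℝ := Real.exp (-(∑ c, Real.log (y c) ^ 2) / 2)

lemma wq_pos (y : Fin n → ℝ) : 0 < wq y := Real.exp_pos _
lemma wq_le (y : Fin n → ℝ) : wq y ≤ 1 := by
  refine Real.exp_le_one_iff.mpr ?_
  have : 0 ≤ ∑ c, Real.log (y c) ^ 2 := Finset.sum_nonneg fun _ _ => sq_nonneg _
  linarith
lemma wq_meas : Measurable (wq (n := n)) := by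
  unfold wq; fun_prop

lemma lg_meas (σ : Equiv.Perm (Fin n)) : Measurable fun (y : Fin n → ℝ) (c : Fin n) => Real.log (y (σ c)) := by fun_prop

def Mm (μ : Measure (Fin n → ℝ)) : Measure (Fin n → ℝ) :=
  ∑ σ : Equiv.Perm (Fin n), (μ.withDensity fun y => eR (wq y)).map fun y c => Real.log (y (σ c))

lemma wd_fin (μ : Measure (Fin n → ℝ)) [IsFiniteMeasure μ] : IsFiniteMeasure (μ.withDensity fun y => eR (wq y)) := by
  refine isFiniteMeasure_withDensity_ofReal ?_
  refine (Integrable.of_bound wq_meas.aestronglyMeasurable 1 (evf fun y => ?_)).2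
  rw [Real.norm_eq_abs, abs_of_pos (wq_pos y)]; exact wq_le y

lemma Mm_fin (μ : Measure (Fin n → ℝ)) [IsFiniteMeasure μ] : IsFiniteMeasure (Mm μ) := by
  have := wd_fin μ
  unfold Mm
  infer_instance

lemma Mm_int (μ : Measure (Fin n → ℝ)) [IsFiniteMeasure μ] (hμ : ∀ᵐ y ∂μ, Ds y) (ξ : Fin n → ℝ) :
    Gc ^ n * ∫ v, Complex.exp ((∑ c, ξ c * v c : ℝ) * Complex.I) ∂(Mm μ) =
    ∑ τ : Equiv.Perm (Fin n), ((Equiv.Perm.sign τ : ℤ) : ℂ) * (∏ c, Complex.exp (- (kap ξ τ c) ^ 2 / 2)) *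
      ∫ s : Fin n → ℝ, Gam (kap ξ τ) s * ∫ y, Tf (es s) y ∂μ := by
  have hfin := wd_fin μ
  have hcm : Measurable fun v : Fin n → ℝ => Complex.exp ((∑ c, ξ c * v c : ℝ) * Complex.I) := by fun_prop
  have hb : ∀ x : ℝ, ‖Complex.exp (x * Complex.I)‖ ≤ 1 := fun x => (Complex.norm_exp_ofReal_mul_I x).le
  have h1 : ∫ v, Complex.exp ((∑ c, ξ c * v c : ℝ) * Complex.I) ∂(Mm μ) = ∫ y, ∑ σ : Equiv.Perm (Fin n), (wq y : ℂ) * Complex.exp ((∑ c, ξ c * Real.log (y (σ c)) : ℝ) * Complex.I) ∂μ := by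
    unfold Mm
    rw [integral_finsetSum_measure, integral_finsetSum]
    · refine Finset.sum_congr rfl fun σ _ => ?_
      rw [integral_map (lg_meas σ).aemeasurable hcm.aestronglyMeasurable,
        integral_withDensity_eq_integral_toReal_smul₀ wq_meas.ennreal_ofReal.aemeasurable (by simp)]
      refine integral_congr_ae (evf fun y => ?_)
      simp only [ENNReal.toReal_ofReal (wq_pos y).le, Complex.real_smul]
    · intro σ _
      refine Integrable.of_bound ?_ 1 (evf fun y => ?_)
      · have := wq_meas (n := n)
        exact ((Complex.measurable_ofReal.comp wq_meas).mul (hcm.comp (lg_meas σ))).aestronglyMeasurable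
      · rw [norm_mul, Complex.norm_real, Real.norm_eq_abs, abs_of_pos (wq_pos y)]
        exact mul_le_one₀ (wq_le y) (norm_nonneg _) (hb _)
    · intro σ _
      exact Integrable.of_bound hcm.aestronglyMeasurable 1 (evf fun y => hb _)
  rw [h1]
  have h2 : ∀ᵐ y ∂μ, ∑ σ : Equiv.Perm (Fin n), (wq y : ℂ) * Complex.exp ((∑ c, ξ c * Real.log (y (σ c)) : ℝ) * Complex.I)
     = ∑ τ : Equiv.Perm (Fin n), ((Equiv.Perm.sign τ : ℤ) : ℂ) * (∏ c, Complex.exp (- (kap ξ τ c) ^ 2 / 2)) * (Bk (kap ξ τ) y / (V0 y : ℂ)) := by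
    filter_upwards [hμ] with y hy
    have h3 := gauss2 ξ hy.1
    have h4 : (V0 y : ℂ) ≠ 0 := by exact_mod_cast V0_ne hy
    simp_rw [← mul_div_assoc]
    rw [← Finset.sum_div, h3, mul_div_cancel_left₀ _ h4]
    rfl
  rw [integral_congr_ae h2, integral_finsetSum, Finset.mul_sum]
  · refine Finset.sum_congr rfl fun τ _ => ?_
    rw [integral_const_mul, (fub μ hμ (kap ξ τ)).2]; ring
  · intro τ _
    exact ((fub μ hμ (kap ξ τ)).1).const_mul _

lemma Mm_lint (μ : Measure (Fin n → ℝ)) (hμ : ∀ᵐ y ∂μ, Ds y) (F : (Fin n → ℝ) → ℝ≥0∞) (hF : Measurable F)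
    (hs : ∀ y (σ : Equiv.Perm (Fin n)), F (y ∘ σ) = F y) :
    ∫⁻ v, eR (Real.exp ((∑ c, v c ^ 2) / 2)) * F (fun c => Real.exp (v c)) ∂(Mm μ) = (Fintype.card (Equiv.Perm (Fin n)) : ℝ≥0∞) * ∫⁻ y, F y ∂μ := by
  have hm : Measurable fun v : Fin n → ℝ => eR (Real.exp ((∑ c, v c ^ 2) / 2)) * F (fun c => Real.exp (v c)) := by
    refine Measurable.mul (by fun_prop) (hF.comp (by fun_prop))
  unfold Mm
  rw [lintegral_finsetSum_measure]
  have h1 : ∀ σ : Equiv.Perm (Fin n), ∫⁻ v, eR (Real.exp ((∑ c, v c ^ 2) / 2)) * F (fun c => Real.exp (v c)) ∂((μ.withDensity fun y => eR (wq y)).map fun y c => Real.log (y (σ c)))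
     = ∫⁻ y, F y ∂μ := by
    intro σ
    rw [lintegral_map hm (lg_meas σ)]
    refine (lintegral_withDensity_eq_lintegral_mul _ wq_meas.ennreal_ofReal (hm.comp (lg_meas σ))).trans ?_
    refine lintegral_congr_ae ?_
    filter_upwards [hμ] with y hy
    simp only [Pi.mul_apply, Function.comp_apply]
    have h2 : (fun c => Real.exp (Real.log (y (σ c)))) = y ∘ σ := by
      ext c; exact Real.exp_log (hy.1 _)
    rw [h2, hs, ← mul_assoc, ← ENNReal.ofReal_mul (wq_pos y).le, wq, ← Real.exp_add, Equiv.sum_comp σ (fun c => Real.log (y c) ^ 2)]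
    simp [neg_div]
  simp_rw [h1]
  simp

lemma uniq (μ1 μ2 : Measure (Fin n → ℝ)) [IsFiniteMeasure μ1] [IsFiniteMeasure μ2] (h1 : ∀ᵐ y ∂μ1, Ds y) (h2 : ∀ᵐ y ∂μ2, Ds y)
    (h : ∀ s : Fin n → ℝ, ∫ y, Tf (es s) y ∂μ1 = ∫ y, Tf (es s) y ∂μ2)
    (F : (Fin n → ℝ) → ℝ≥0∞) (hF : Measurable F)
    (hs : ∀ y (σ : Equiv.Perm (Fin n)), F (y ∘ σ) = F y) : ∫⁻ y, F y ∂μ1 = ∫⁻ y, F y ∂μ2 := by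
  have i1 := Mm_fin μ1
  have i2 := Mm_fin μ2
  have hM : Mm μ1 = Mm μ2 := by
    refine Measure.ext_of_charFunDual (funext fun L => ?_)
    rw [charFunDual_apply, charFunDual_apply]
    have hL : ∀ v, L v = ∑ c, L (Pi.single c 1) * v c := by
      intro v
      conv_lhs => rw [← Finset.univ_sum_single v]
      rw [map_sum]
      refine Finset.sum_congr rfl fun c _ => ?_
      have : (Pi.single c (v c) : Fin n → ℝ) = v c • Pi.single c 1 := by
        rw [← Pi.single_smul]; simp
      rw [this, map_smul, smul_eq_mul, mul_comm]
    have hL2 : (fun v : Fin n → ℝ => Complex.exp ((L v : ℂ) * Complex.I)) = fun v => Complex.exp (((∑ c, L (Pi.single c 1) * v c : ℝ) : ℂ) * Complex.I) := by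
      funext v; rw [hL v]
    rw [hL2]
    have a1 := Mm_int μ1 h1 (fun c => L (Pi.single c 1))
    have a2 := Mm_int μ2 h2 (fun c => L (Pi.single c 1))
    simp_rw [h] at a1
    exact mul_left_cancel₀ (pow_ne_zero n Gc_ne) (a1.trans a2.symm)
  have b1 := Mm_lint μ1 h1 F hF hs
  have b2 := Mm_lint μ2 h2 F hF hs
  rw [hM, b2] at b1
  refine ((ENNReal.mul_right_inj ?_ ?_).mp b1).symm
  · simp [Fintype.card_ne_zero]
  · simp


lemma split_int {X E : Type} [MeasurableSpace X] [NormedAddCommGroup E] [NormedSpace ℝ E] (μ : Measure X) {m : X → ℝ} (hm : Measurable m)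
    {f : X → E} (hf : AEStronglyMeasurable f μ) (hi : Integrable (fun x => m x • f x) μ) :
    (Integrable f (μ.withDensity fun x => eR (m x)) ∧ Integrable f (μ.withDensity fun x => eR (-m x))) ∧
    ∫ x, f x ∂(μ.withDensity fun x => eR (m x)) - ∫ x, f x ∂(μ.withDensity fun x => eR (- m x)) = ∫ x, m x • f x ∂μ := by
  have hm' : Measurable fun x => - m x := hm.neg
  have h1 : Integrable (fun x => max (m x) 0 • f x) μ := by
    refine hi.norm.mono' ((hm.max measurable_const).aestronglyMeasurable.smul hf) (evf fun x => ?_)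
    rw [norm_smul, norm_smul]
    refine mul_le_mul_of_nonneg_right ?_ (norm_nonneg _)
    rw [Real.norm_eq_abs, Real.norm_eq_abs, abs_of_nonneg (le_max_right _ _)]
    exact max_le (le_abs_self _) (abs_nonneg _)
  have h2 : Integrable (fun x => max (- m x) 0 • f x) μ := by
    refine hi.norm.mono' ((hm.neg.max measurable_const).aestronglyMeasurable.smul hf) (evf fun x => ?_)
    rw [norm_smul, norm_smul]
    refine mul_le_mul_of_nonneg_right ?_ (norm_nonneg _)
    rw [Real.norm_eq_abs, Real.norm_eq_abs, abs_of_nonneg (le_max_right _ _)]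
    exact max_le (neg_le_abs _) (abs_nonneg _)
  refine ⟨⟨?_, ?_⟩, ?_⟩
  · rw [integrable_withDensity_iff_integrable_smul₀' hm.ennreal_ofReal.aemeasurable (by simp)]
    simpa [ENNReal.toReal_ofReal'] using h1
  · rw [integrable_withDensity_iff_integrable_smul₀' hm'.ennreal_ofReal.aemeasurable (by simp)]
    simpa [ENNReal.toReal_ofReal'] using h2
  · rw [integral_withDensity_eq_integral_toReal_smul₀ hm.ennreal_ofReal.aemeasurable (by simp),
      integral_withDensity_eq_integral_toReal_smul₀ hm'.ennreal_ofReal.aemeasurable (by simp)]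
    simp only [ENNReal.toReal_ofReal']
    rw [← integral_sub h1 h2]
    refine integral_congr_ae (evf fun x => ?_)
    simp only
    rw [← sub_smul]
    congr 1
    rcases le_total 0 (m x) with h | h
    · rw [max_eq_left h, max_eq_right (by linarith)]; ring
    · rw [max_eq_right h, max_eq_left (by linarith)]; ring

lemma det_intK {𝕜 : Type} [RCLike 𝕜] (f : Fin n → ℝ → 𝕜) (k : Fin n → ℝ → 𝕜) (hi : ∀ b c, Integrable fun t => f c t * k b t) :
    (Integrable fun y : Fin n → ℝ => (of fun b c => f c (y b)).det * ∏ b, k b (y b)) ∧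
    ∫ y : Fin n → ℝ, (of fun b c => f c (y b)).det * ∏ b, k b (y b) = (of fun b c => ∫ t, f c t * k b t).det := by
  have h1 : ∀ y : Fin n → ℝ, (of fun b c => f c (y b)).det * ∏ b, k b (y b) = ∑ σ : Equiv.Perm (Fin n), ((Equiv.Perm.sign σ : ℤ) : 𝕜) * ∏ b, (f (σ b) (y b) * k b (y b)) := by
    intro y
    rw [← det_transpose, det_apply', Finset.sum_mul]
    refine Finset.sum_congr rfl fun σ _ => ?_
    rw [mul_assoc, ← Finset.prod_mul_distrib]; rfl
  have h2 : ∀ σ : Equiv.Perm (Fin n), Integrable fun y : Fin n → ℝ => ((Equiv.Perm.sign σ : ℤ) : 𝕜) * ∏ b, (f (σ b) (y b) * k b (y b)) := by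
    intro σ
    refine Integrable.const_mul ?_ _
    exact Integrable.fintype_prod (μ := fun _ : Fin n => (volume : Measure ℝ)) (f := fun b (t:ℝ) => f (σ b) t * k b t) fun b => hi b (σ b)
  simp_rw [h1]
  refine ⟨integrable_finsetSum _ fun σ _ => h2 σ, ?_⟩
  rw [integral_finsetSum _ fun σ _ => h2 σ, ← det_transpose, det_apply']
  refine Finset.sum_congr rfl fun σ _ => ?_
  rw [integral_const_mul]
  refine congrArg _ ?_
  exact integral_fintype_prod_eq_prod (𝕜 := 𝕜) (μ := fun _ : Fin n => (volume : Measure ℝ)) (fun b (t:ℝ) => f (σ b) t * k b t)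

structure NiceH (n : ℕ) (h : ℝ → ℝ) : Prop where
  meas : Measurable h
  nonneg : ∀ t, 0 ≤ h t
  zero : ∀ t, t ≤ 0 → h t = 0
  int : ∀ j < n, Integrable fun t => h t * t ^ (2 * j)

def kq (h : ℝ → ℝ) (a y : ℝ) : ℝ := h (y / a) / a

def gk (h : ℝ → ℝ) (a y : Fin n → ℝ) : ℝ := ∏ b, kq h (a b) (y b)

lemma V0_eq (y : Fin n → ℝ) : V0 y = (of fun b c : Fin n => y b ^ (2 * c.val)).det := by
  unfold V0
  congr 1
  ext i j
  simp [vandermonde_apply, pow_mul]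

lemma kq_pow {h : ℝ → ℝ} (hh : NiceH n h) {a : ℝ} (ha : 0 < a) {j : ℕ} (hj : j < n) : Integrable fun y => y ^ (2 * j) * kq h a y := by
  have h1 := ((hh.int j hj).comp_div ha.ne').const_mul (a ^ (2*j) / a)
  refine h1.congr (evf fun y => ?_)
  simp only [kq, div_pow]
  field_simp

lemma V0_int {h : ℝ → ℝ} (hh : NiceH n h) {a : Fin n → ℝ} (ha : ∀ b, 0 < a b) : Integrable fun y : Fin n → ℝ => V0 y * gk h a y := by
  simp only [V0_eq, gk]
  exact (det_intK (𝕜 := ℝ) (fun c t => t ^ (2 * c.val)) (fun b => kq h (a b)) fun b c => kq_pow hh (ha b) c.2).1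

lemma gk_pos {h : ℝ → ℝ} (hh : NiceH n h) {a y : Fin n → ℝ} (ha : ∀ b, 0 < a b) (hg : gk h a y ≠ 0) : ∀ b, 0 < y b := by
  intro b
  have h1 := Finset.prod_ne_zero_iff.mp hg b (Finset.mem_univ _)
  by_contra h2
  refine h1 ?_
  rw [kq, hh.zero _ (div_nonpos_of_nonpos_of_nonneg (not_lt.mp h2) (ha b).le), zero_div]

lemma gk_meas {h : ℝ → ℝ} (hh : NiceH n h) (a : Fin n → ℝ) : Measurable (gk h a) := by
  unfold gk kq
  have := hh.meas
  fun_prop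

lemma Nm_int {h : ℝ → ℝ} (hh : NiceH n h) {a : Fin n → ℝ} (ha : ∀ b, 0 < a b) {e : ℕ → ℂ} (he : ∀ j, (e j).re = 0) :
    ∫ y : Fin n → ℝ, Nm e y * (gk h a y : ℂ) = (∏ c : Fin n, Hc h (2 * rho e n c)) * Nm e a := by
  have h0 : ∀ c : Fin n, Integrable fun t : ℝ => cpw (t ^ 2) (rho e n c) * (h t : ℂ) := by
    intro c
    have hj : n - 1 - c.val < n := by have := c.2; omega
    refine (hh.int _ hj).mono' ?_ (evf fun t => ?_)
    · exact (((cpw_meas _).comp (measurable_id.pow_const 2)).mul (Complex.measurable_ofReal.comp hh.meas)).aestronglyMeasurable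
    · rcases le_or_gt t 0 with h1 | h1
      · simp [hh.zero t h1]
      · rw [norm_mul, mul_comm, Complex.norm_real, Real.norm_eq_abs, abs_of_nonneg (hh.nonneg t)]
        refine mul_le_mul_of_nonneg_left (le_of_eq ?_) (hh.nonneg t)
        have h2 : (rho e n c).re = ((n - 1 - c.val : ℕ) : ℝ) := by
          rw [rho_re he, Nat.sub_sub, Nat.cast_sub (by have := c.2; omega)]; push_cast; ring
        rw [cpw, if_neg (by positivity), Complex.norm_exp, Complex.mul_re, h2, Complex.ofReal_re, Complex.ofReal_im, mul_zero, sub_zero,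
          Real.log_pow, show ((n - 1 - c.val : ℕ) : ℝ) * (((2:ℕ):ℝ) * Real.log t) = ((2 * (n - 1 - c.val) : ℕ) : ℝ) * Real.log t by push_cast; ring, Real.exp_nat_mul, Real.exp_log h1]
  have h3 : ∀ b c : Fin n, (Integrable fun y : ℝ => cpw (y ^ 2) (rho e n c) * (kq h (a b) y : ℂ)) ∧
      ∫ y : ℝ, cpw (y ^ 2) (rho e n c) * (kq h (a b) y : ℂ) = Hc h (2 * rho e n c) * cpw (a b ^ 2) (rho e n c) := by
    intro b c
    have h4 : (fun y : ℝ => cpw (y ^ 2) (rho e n c) * (kq h (a b) y : ℂ)) = fun y => ((a b : ℂ)⁻¹ * cpw (a b ^ 2) (rho e n c)) * (cpw ((y / a b) ^ 2) (rho e n c) * (h (y / a b) : ℂ)) := by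
      funext y
      have h5 : cpw (y ^ 2) (rho e n c) = cpw (a b ^ 2) (rho e n c) * cpw ((y / a b) ^ 2) (rho e n c) := by
        rw [← cpw_mul, ← mul_pow, mul_div_cancel₀ _ (ha b).ne']
      rw [h5, kq]; push_cast; ring
    rw [h4]
    constructor
    · exact ((h0 c).comp_div (ha b).ne').const_mul _
    · rw [integral_const_mul, Measure.integral_comp_div (fun t => cpw (t ^ 2) (rho e n c) * (h t : ℂ)) (a b), abs_of_pos (ha b)]
      have h6 : ∫ t : ℝ, cpw (t ^ 2) (rho e n c) * (h t : ℂ) = Hc h (2 * rho e n c) := by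
        unfold Hc
        rw [← setIntegral_eq_integral_of_forall_compl_eq_zero (s := Set.Ioi 0)]
        · refine setIntegral_congr_fun measurableSet_Ioi fun t ht => ?_
          rw [cpw_sq, abs_of_pos ht, mul_comm]
        · intro t ht
          rw [hh.zero t (not_lt.mp ht)]; simp
      rw [h6, Complex.real_smul]
      have : (a b : ℂ) ≠ 0 := by exact_mod_cast (ha b).ne'
      field_simp
  have h7 := (det_intK (𝕜 := ℂ) (fun c t => cpw (t ^ 2) (rho e n c)) (fun b t => (kq h (a b) t : ℂ)) fun b c => (h3 b c).1).2
  have h8 : ∀ y : Fin n → ℝ, Nm e y * (gk h a y : ℂ) = (of fun b c : Fin n => cpw (y b ^ 2) (rho e n c)).det * ∏ b, (kq h (a b) (y b) : ℂ) := by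
    intro y; rw [gk, Nm]; push_cast; rfl
  simp_rw [h8]
  refine h7.trans ?_
  simp only [(h3 _ _).2]
  exact det_mul_row (fun c : Fin n => Hc h (2 * rho e n c)) (of fun b c : Fin n => cpw (a b ^ 2) (rho e n c))


lemma inj_ae (n : ℕ) : ∀ᵐ y : Fin n → ℝ, Function.Injective y := by
  have h1 : ∀ i j : Fin n, i ≠ j → ∀ᵐ y : Fin n → ℝ, y i ≠ y j := by
    intro i j hij
    set L : (Fin n → ℝ) →ₗ[ℝ] ℝ := (LinearMap.proj i : (Fin n → ℝ) →ₗ[ℝ] ℝ) - (LinearMap.proj j : (Fin n → ℝ) →ₗ[ℝ] ℝ) with hL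
    have h2 : L.ker ≠ ⊤ := by
      intro h
      have h3 : (Pi.single i 1 : Fin n → ℝ) ∈ L.ker := by rw [h]; trivial
      simp [hL, hij.symm] at h3
    have h4 := Measure.addHaar_submodule (volume : Measure (Fin n → ℝ)) _ h2
    rw [ae_iff]
    refine measure_mono_null (fun y hy => ?_) h4
    simp only [ne_eq, not_not, Set.mem_setOf_eq] at hy
    simp [hL, hy]
  have h2 : ∀ᵐ y : Fin n → ℝ, ∀ i j : Fin n, i ≠ j → y i ≠ y j := by
    rw [ae_all_iff]; intro i; rw [ae_all_iff]; intro j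
    by_cases h : i = j
    · simp [h]
    · filter_upwards [h1 i j h] with y hy _ using hy
  filter_upwards [h2] with y hy i j hij
  by_contra h
  exact hy i j h hij

lemma Dmat_meas : Measurable fun y : Fin n → ℝ => Dmat y := by
  refine measurable_pi_lambda _ fun i => measurable_pi_lambda _ fun j => ?_
  simp only [Dmat, of_apply]
  split_ifs <;> fun_prop

lemma Dmat_skew (y : Fin n → ℝ) : (Dmat y)ᵀ = - Dmat y := by
  rw [Dmat_eq]; exact DN_transpose _ _

lemma inv_perm {φ : Mx (2*n) → ℝ} (hφ : IsInvTest (2*n) φ) (y : Fin n → ℝ) (σ : Equiv.Perm (Fin n)) :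
    φ (Dmat (y ∘ σ)) = φ (Dmat y) := by
  obtain ⟨k, hk, h⟩ := DN_perm (N := 2*n) (by omega) y σ
  rw [Dmat_eq, h, ← Dmat_eq, hφ.2.2 _ (Dmat_skew y) k hk]

lemma kernel {P : Mx (2 * n) → ℝ} {σw : Mx 2 → ℝ} (hfac : IsFactorizing n P σw)
    {h : ℝ → ℝ} (hdet : IsDetDensity σw h) (hh : NiceH n h) (hn : 1 ≤ n) (hmell : ∀ j < n, 0 < ∫ t in Set.Ioi 0, h t * t ^ (2 * j))
    {a : Fin n → ℝ} (ha : Ds a) {φ : Mx (2*n) → ℝ} (hφ : IsInvTest (2*n) φ) :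
    ∫ u : Us (2*n), φ (of u * Dmat a * (of u)ᵀ) ∂(mP P) = ∫ y, (V0 y * gk h a y / (M0 n h * V0 a)) • φ (Dmat y) := by
  have hpr := mP_prob hfac.nonneg hfac.integrable hfac.prob
  have hI : Integrable h := by simpa using hh.int 0 hn
  have hpos : 0 < ∫ t in Set.Ioi 0, h t := by simpa using hmell 0 hn
  have hM : 0 < M0 n h := M0_ne hfac hmell
  obtain ⟨R, hR, hRb⟩ := radial n
  set m : (Fin n → ℝ) → ℝ := fun y => V0 y * gk h a y / (M0 n h * V0 a) with hm
  have hmm : Measurable m := (V0_cont.measurable.mul (gk_meas hh a)).div_const _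
  have hmm' : Measurable fun y => - m y := hmm.neg
  have hmi : Integrable m := (V0_int hh ha.1).div_const _
  set Y : Us (2*n) → Fin n → ℝ := fun u => R (of u * Dmat a * (of u)ᵀ) with hY
  have hYm : Measurable Y := hR.comp (cj_meas _)
  have hnf : ∀ᵐ u ∂(mP P), Ds (Y u) ∧ ∃ k ∈ Og (2*n), (of u : Mx (2*n)) * Dmat a * (of u)ᵀ = k * Dmat (Y u) * kᵀ := by
    have h0 := (withDensity_absolutelyContinuous (volume : Measure (Us (2*n))) (fun u => eR (P (of u)))).ae_le (nf_ae ha)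
    change ∀ᵐ u ∂(mP P), _ at h0
    filter_upwards [h0] with u hu
    obtain ⟨b, hb, k, hk, hx⟩ := hu
    have h1 : Y u = b := by
      show R (of u * Dmat a * (of u)ᵀ) = b
      rw [hx]; exact hRb b hb.1 hb.2 k hk
    rw [h1]
    exact ⟨⟨hb.2, hb.1.injective⟩, k, hk, hx⟩
  have hmD : ∀ᵐ y : Fin n → ℝ, m y ≠ 0 → Ds y := by
    filter_upwards [inj_ae n] with y hy h0
    refine ⟨gk_pos hh ha.1 fun h1 => h0 ?_, hy⟩
    simp [hm, h1]
  have i1 : IsFiniteMeasure (volume.withDensity fun y => eR (m y)) := isFiniteMeasure_withDensity_ofReal hmi.2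
  have i2 : IsFiniteMeasure (volume.withDensity fun y => eR (- m y)) := isFiniteMeasure_withDensity_ofReal hmi.neg.2
  have i3 : IsProbabilityMeasure ((mP P).map Y) := Measure.isProbabilityMeasure_map hYm.aemeasurable
  have d1 : ∀ᵐ y ∂(volume.withDensity fun y => eR (m y)), Ds y := by
    rw [ae_withDensity_iff hmm.ennreal_ofReal]
    filter_upwards [hmD] with y hy h0
    exact hy fun h1 => h0 (by simp [h1])
  have d2 : ∀ᵐ y ∂(volume.withDensity fun y => eR (- m y)), Ds y := by
    rw [ae_withDensity_iff hmm'.ennreal_ofReal]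
    filter_upwards [hmD] with y hy h0
    exact hy fun h1 => h0 (by simp [h1])
  obtain ⟨R', hR', hRW⟩ : ∃ S : Set (Fin n → ℝ), MeasurableSet S ∧ ∀ y, y ∈ S ↔ Ds y := by
    refine ⟨(⋂ i, {y | 0 < y i}) ∩ ⋂ i, ⋂ j, {y | y i = y j → i = j}, ?_, fun y => ?_⟩
    · refine MeasurableSet.inter (MeasurableSet.iInter fun i => measurableSet_lt measurable_const (measurable_pi_apply _)) ?_
      refine MeasurableSet.iInter fun i => MeasurableSet.iInter fun j => ?_
      by_cases hij : i = j
      · simp [hij]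
      · simp only [hij, imp_false]
        exact (measurableSet_eq_fun (measurable_pi_apply i) (measurable_pi_apply j)).compl
    · simp [Ds, Function.Injective]
  have d3 : ∀ᵐ y ∂((mP P).map Y), Ds y := by
    simp_rw [← hRW]
    rw [ae_map_iff hYm.aemeasurable (by simpa using hR')]
    filter_upwards [hnf] with u hu using (hRW _).mpr hu.1
  have d4 : ∀ᵐ y ∂((mP P).map Y + volume.withDensity fun y => eR (- m y)), Ds y := by
    rw [ae_add_measure_iff]; exact ⟨d3, d2⟩
  obtain ⟨Z, hZ, hsT⟩ := sph_T n
  obtain ⟨Z', hTb⟩ := Tf_bound n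
  have hV : V0 a ≠ 0 := V0_ne ha
  have key : ∀ s : Fin n → ℝ, ∫ y, Tf (es s) y ∂((mP P).map Y + volume.withDensity fun y => eR (- m y)) =
      ∫ y, Tf (es s) y ∂(volume.withDensity fun y => eR (m y)) := by
    intro s
    have he := es_re s
    set c : ℂ := (∏ i : Fin n, Hc h (2 * rho (es s) n i)) / (M0 n h : ℂ) with hc
    have t1 := mult hfac hdet hI.integrableOn hpos he (Dmat a)
    have hpf := pf_ne he (2*n)
    have t2 : ∫ u, Tf (es s) (Y u) ∂(mP P) = c * Tf (es s) a := by
      have t3 : ∫ u : Us (2*n), sph (es s) (of u * Dmat a * (of u)ᵀ) ∂(mP P) = (Z:ℂ) / pf (es s) (2*n) * ∫ u, Tf (es s) (Y u) ∂(mP P) := by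
        rw [← integral_const_mul]
        refine integral_congr_ae ?_
        filter_upwards [hnf] with u hu
        obtain ⟨hd, k, hk, hx⟩ := hu
        rw [hx, sph_conj _ _ hk, hsT _ he _ hd]
      rw [t3, hsT _ he _ ha] at t1
      have : (Z:ℂ) / pf (es s) (2*n) ≠ 0 := div_ne_zero (by exact_mod_cast hZ) hpf
      refine mul_left_cancel₀ this ?_
      rw [t1]; ring
    have t4 : ∀ᵐ y : Fin n → ℝ, m y • Tf (es s) y = Nm (es s) y * (gk h a y : ℂ) * ((M0 n h : ℂ) * V0 a)⁻¹ := by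
      filter_upwards [inj_ae n] with y hy
      by_cases hg : gk h a y = 0
      · simp [hm, hg]
      · have hv := V0_ne ⟨gk_pos hh ha.1 hg, hy⟩
        have hv' : (V0 y : ℂ) ≠ 0 := by exact_mod_cast hv
        simp only [hm, Tf, Complex.real_smul]
        push_cast
        field_simp
    have t5 : ∫ y, m y • Tf (es s) y = c * Tf (es s) a := by
      rw [integral_congr_ae t4, integral_mul_const, Nm_int hh ha.1 he, hc, Tf]
      have : (V0 a : ℂ) ≠ 0 := by exact_mod_cast hV
      have hM' : (M0 n h : ℂ) ≠ 0 := by exact_mod_cast hM.ne'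
      field_simp
    have t6 : Integrable fun y => m y • Tf (es s) y := by
      refine (hmi.norm.mul_const (Z' * ‖pf (es s) (2*n)‖)).mono' (hmm.aestronglyMeasurable.smul (Tf_meas _).aestronglyMeasurable) ?_
      filter_upwards [hmD] with y hy
      by_cases h0 : m y = 0
      · simp [h0]
      · rw [norm_smul]
        exact mul_le_mul_of_nonneg_left (hTb _ he _ (hy h0)) (norm_nonneg _)
    obtain ⟨⟨s1, s2⟩, s3⟩ := split_int volume hmm (Tf_meas (es s)).aestronglyMeasurable t6
    have s4 : Integrable (Tf (es s)) ((mP P).map Y) := by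
      refine Integrable.of_bound (Tf_meas _).aestronglyMeasurable (Z' * ‖pf (es s) (2*n)‖) ?_
      filter_upwards [d3] with y hy using hTb _ he _ hy
    rw [integral_add_measure s4 s2, integral_map hYm.aemeasurable (Tf_meas _).aestronglyMeasurable, t2, ← t5, ← s3]
    ring
  have hfm : Measurable fun y : Fin n → ℝ => φ (Dmat y) := hφ.1.comp Dmat_meas
  have hfm' : Measurable fun y : Fin n → ℝ => - φ (Dmat y) := hfm.neg
  obtain ⟨B, hB⟩ := hφ.2.1
  have u1 := uniq _ _ d4 d1 key (fun y => eR (φ (Dmat y))) hfm.ennreal_ofReal fun y σ => by simp only [inv_perm hφ]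
  have u2 := uniq _ _ d4 d1 key (fun y => eR (- φ (Dmat y))) hfm'.ennreal_ofReal fun y σ => by simp only [inv_perm hφ]
  have hbi : ∀ μ : Measure (Fin n → ℝ), IsFiniteMeasure μ → Integrable (fun y => φ (Dmat y)) μ := fun μ _ =>
    Integrable.of_bound hfm.aestronglyMeasurable B (evf fun y => hB _)
  have v1 : ∫ y, φ (Dmat y) ∂((mP P).map Y + volume.withDensity fun y => eR (- m y)) =
      ∫ y, φ (Dmat y) ∂(volume.withDensity fun y => eR (m y)) := by
    rw [integral_eq_lintegral_pos_part_sub_lintegral_neg_part (hbi _ inferInstance), integral_eq_lintegral_pos_part_sub_lintegral_neg_part (hbi _ inferInstance), u1, u2]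
  have t6 : Integrable fun y => m y • φ (Dmat y) := by
    refine (hmi.norm.mul_const B).mono' (hmm.aestronglyMeasurable.smul hfm.aestronglyMeasurable) (evf fun y => ?_)
    rw [norm_smul]
    exact mul_le_mul_of_nonneg_left (hB _) (norm_nonneg _)
  obtain ⟨⟨s1, s2⟩, s3⟩ := split_int volume hmm hfm.aestronglyMeasurable t6
  rw [integral_add_measure (hbi _ inferInstance) s2, integral_map hYm.aemeasurable hfm.aestronglyMeasurable] at v1
  rw [← s3, ← v1, add_sub_cancel_right]
  refine integral_congr_ae ?_
  filter_upwards [hnf] with u hu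
  obtain ⟨hd, k, hk, hx⟩ := hu
  rw [hx]; exact hφ.2.2 _ (Dmat_skew _) k hk


lemma vdm_V0 (a : Fin n → ℝ) : (vdm fun j => a j ^ 2) = V0 a := by
  unfold vdm V0
  rw [det_vandermonde, Finset.prod_filter, ← Finset.univ_product_univ, Finset.prod_product]
  refine Finset.prod_congr rfl fun i _ => ?_
  rw [← Finset.prod_filter]
  refine Finset.prod_congr ?_ fun _ _ => rfl
  ext j; simp

def wp (w : ℝ → ℝ) : ℝ → ℝ := (Set.Ioi 0).indicator w

lemma wp_nonpos (w : ℝ → ℝ) {t : ℝ} (ht : t ≤ 0) : wp w t = 0 := by simp [wp, ht]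

lemma wp_pos (w : ℝ → ℝ) {t : ℝ} (ht : 0 < t) : wp w t = w t := by simp [wp, ht]

lemma wp_meas {w : ℝ → ℝ} (hw : Measurable w) : Measurable (wp w) := hw.indicator measurableSet_Ioi

lemma q_int {h : ℝ → ℝ} (hh : NiceH n h) {w : ℝ → ℝ} (hw : Measurable w) {j : ℕ} (hj : j < n)
    (hi : IntegrableOn (fun t : ℝ => t ^ (2 * j) * w t) (Set.Ioi 0)) :
    Integrable fun p : ℝ × ℝ => p.2 ^ (2 * j) * kq h p.1 p.2 * wp w p.1 := by
  have hm : Measurable fun p : ℝ × ℝ => p.2 ^ (2 * j) * kq h p.1 p.2 * wp w p.1 := by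
    have h1 := wp_meas hw
    have h2 := hh.meas
    unfold kq
    fun_prop
  rw [Measure.volume_eq_prod, integrable_prod_iff hm.aestronglyMeasurable]
  constructor
  · refine evf fun x => ?_
    rcases le_or_gt x 0 with hx | hx
    · simp [wp_nonpos w hx]
    · exact (kq_pow hh hx hj).mul_const (wp w x)
  · have h3 : (fun x : ℝ => ∫ y, ‖y ^ (2 * j) * kq h x y * wp w x‖) = fun x => (∫ t, h t * t ^ (2*j)) * ‖(Set.Ioi (0:ℝ)).indicator (fun t => t ^ (2*j) * w t) x‖ := by
      funext x
      rcases le_or_gt x 0 with hx | hx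
      · simp [wp_nonpos w hx, hx]
      · have h4 : ∀ y, ‖y ^ (2 * j) * kq h x y * wp w x‖ = (fun t => h t * t ^ (2*j)) (y / x) * (x ^ (2*j) / x * |w x|) := by
          intro y
          have e1 : 0 ≤ y ^ (2*j) := (even_two_mul j).pow_nonneg y
          have e2 := hh.nonneg (y / x)
          rw [kq, wp_pos w hx, norm_mul, Real.norm_of_nonneg (mul_nonneg e1 (div_nonneg e2 hx.le)), Real.norm_eq_abs]
          simp only [div_pow]
          field_simp
        rw [integral_congr_ae (evf h4), integral_mul_const, Measure.integral_comp_div (fun t => h t * t ^ (2*j)), Set.indicator_of_mem (Set.mem_Ioi.mpr hx), norm_mul, Real.norm_of_nonneg (pow_nonneg hx.le _), Real.norm_eq_abs, smul_eq_mul, abs_of_pos hx]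
        field_simp
    rw [h3]
    exact ((integrable_indicator_iff measurableSet_Ioi).mpr hi).norm.const_mul _

lemma mconv_kq {h w : ℝ → ℝ} {y : ℝ} (hy : 0 < y) : mconv h w y = ∫ t, wp w t * kq h t y := by
  have h1 : ∫ t, wp w t * kq h t y = ∫ t in Set.Ioi 0, w t * kq h t y := by
    rw [← integral_indicator measurableSet_Ioi]
    refine integral_congr_ae (evf fun t => ?_)
    simp only [wp]
    exact (Set.indicator_mul_left _ _ _).symm
  rw [h1, mconv, ← integral_comp_rpow_Ioi (fun t => h t * w (y / t) / t) (show (-1:ℝ) ≠ 0 by norm_num)]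
  have h2 := integral_comp_mul_left_Ioi (fun t => w t * kq h t y * y) 0 hy
  rw [mul_zero, integral_mul_const (μ := volume.restrict (Set.Ioi 0)) y (fun t => w t * kq h t y), smul_eq_mul] at h2
  rw [show ∫ t in Set.Ioi 0, w t * kq h t y = y⁻¹ * ((∫ t in Set.Ioi 0, w t * kq h t y) * y) by field_simp, ← h2]
  refine setIntegral_congr_fun measurableSet_Ioi fun t ht => ?_
  have ht : 0 < t := ht
  simp only [kq, smul_eq_mul, abs_neg, abs_one, one_mul, Real.rpow_neg_one]
  rw [show (-1 - 1 : ℝ) = ((-2 : ℤ) : ℝ) by norm_num, Real.rpow_intCast, div_inv_eq_mul, show y / (y * t) = t⁻¹ by field_simp]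
  rw [div_inv_eq_mul, _root_.zpow_neg, zpow_ofNat]
  field_simp

lemma kq_zero {h : ℝ → ℝ} (hh : NiceH n h) (w : ℝ → ℝ) {y : ℝ} (hy : y ≤ 0) (t : ℝ) : wp w t * kq h t y = 0 := by
  rcases le_or_gt t 0 with ht | ht
  · rw [wp_nonpos w ht, zero_mul]
  · rw [kq, hh.zero _ (div_nonpos_of_nonpos_of_nonneg hy ht.le)]; simp

lemma inner_int {h : ℝ → ℝ} (hh : NiceH n h) (hn : 1 ≤ n) {w : Fin n → ℝ → ℝ} (hwm : ∀ b, Measurable (w b))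
    (hi : ∀ b, ∀ j < n, IntegrableOn (fun t : ℝ => t ^ (2 * j) * w b t) (Set.Ioi 0)) :
    ∀ᵐ y : Fin n → ℝ, ∫ a, (of fun b c : Fin n => wp (w b) (a c)).det * gk h a y =
      (Set.indicator {y : Fin n → ℝ | ∀ j, 0 < y j} (fun y => (of fun b c : Fin n => mconv h (w b) (y c)).det)) y := by
  have h1 : ∀ c, ∀ᵐ t : ℝ, Integrable fun x => wp (w c) x * kq h x t := by
    intro c
    have h2 := (q_int hh (hwm c) (j := 0) hn (hi c 0 hn))
    rw [Measure.volume_eq_prod] at h2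
    filter_upwards [h2.prod_left_ae] with t ht
    refine ht.congr (evf fun x => ?_)
    simp [mul_comm]
  have h3 : ∀ᵐ y : Fin n → ℝ, ∀ b c, Integrable fun x => wp (w c) x * kq h x (y b) := by
    rw [ae_all_iff]; intro b; rw [ae_all_iff]; intro c
    exact (Measure.quasiMeasurePreserving_eval (fun _ : Fin n => (volume : Measure ℝ)) b).ae (h1 c)
  filter_upwards [h3] with y hy
  have h4 := (det_intK (𝕜 := ℝ) (fun c => wp (w c)) (fun b x => kq h x (y b)) hy).2
  have h5 : ∀ a : Fin n → ℝ, (of fun b c : Fin n => wp (w b) (a c)).det = (of fun b c : Fin n => wp (w c) (a b)).det := fun a => by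
    rw [← det_transpose]; rfl
  simp_rw [h5]
  refine Eq.trans h4 ?_
  by_cases hp : ∀ j, 0 < y j
  · rw [Set.indicator_of_mem (show y ∈ {y : Fin n → ℝ | ∀ j, 0 < y j} from hp), ← det_transpose]
    refine congrArg det ?_
    ext b c
    simp only [transpose_apply, of_apply]
    exact (mconv_kq (hp c)).symm
  · rw [Set.indicator_of_notMem (show y ∉ {y : Fin n → ℝ | ∀ j, 0 < y j} from hp)]
    push Not at hp
    obtain ⟨b, hb⟩ := hp
    refine det_eq_zero_of_row_eq_zero b fun c => ?_
    simp only [of_apply, kq_zero hh _ hb, integral_zero]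

lemma G_int {h : ℝ → ℝ} (hh : NiceH n h) {w : Fin n → ℝ → ℝ} (hwm : ∀ b, Measurable (w b))
    (hi : ∀ b, ∀ j < n, IntegrableOn (fun t : ℝ => t ^ (2 * j) * w b t) (Set.Ioi 0)) :
    Integrable fun p : (Fin n → ℝ) × (Fin n → ℝ) => V0 p.2 * gk h p.1 p.2 * (of fun b c : Fin n => wp (w b) (p.1 c)).det := by
  have h1 : ∀ π τ : Equiv.Perm (Fin n), Integrable fun p : (Fin n → ℝ) × (Fin n → ℝ) =>
      ∏ c, (p.2 c ^ (2 * (π c).val) * kq h (p.1 c) (p.2 c) * wp (w (τ c)) (p.1 c)) := by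
    intro π τ
    have h2 : Integrable fun z : Fin n → ℝ × ℝ => ∏ c, ((z c).2 ^ (2 * (π c).val) * kq h (z c).1 (z c).2 * wp (w (τ c)) (z c).1) := by
      exact Integrable.fintype_prod (μ := fun _ : Fin n => (volume : Measure (ℝ × ℝ)))
        (f := fun c (z : ℝ × ℝ) => z.2 ^ (2 * (π c).val) * kq h z.1 z.2 * wp (w (τ c)) z.1) fun c => q_int hh (hwm _) (π c).2 (hi _ _ (π c).2)
    have h3 := volume_measurePreserving_arrowProdEquivProdArrow ℝ ℝ (Fin n)
    rw [← h3.integrable_comp_emb (MeasurableEquiv.measurableEmbedding _)]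
    exact h2
  have h4 : (fun p : (Fin n → ℝ) × (Fin n → ℝ) => V0 p.2 * gk h p.1 p.2 * (of fun b c : Fin n => wp (w b) (p.1 c)).det) =
      fun p => ∑ π : Equiv.Perm (Fin n), ∑ τ : Equiv.Perm (Fin n), (((Equiv.Perm.sign π : ℤ) : ℝ) * ((Equiv.Perm.sign τ : ℤ) : ℝ)) *
        ∏ c, (p.2 c ^ (2 * (π c).val) * kq h (p.1 c) (p.2 c) * wp (w (τ c)) (p.1 c)) := by
    funext p
    rw [V0_eq, ← det_transpose, det_apply', det_apply', Finset.sum_mul, Finset.sum_mul]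
    refine Finset.sum_congr rfl fun π _ => ?_
    rw [Finset.mul_sum]
    refine Finset.sum_congr rfl fun τ _ => ?_
    rw [Finset.prod_mul_distrib, Finset.prod_mul_distrib, gk]
    simp only [transpose_apply, of_apply]
    ring
  rw [h4]
  exact integrable_finsetSum _ fun π _ => integrable_finsetSum _ fun τ _ => (h1 π τ).const_mul _


lemma avg_inv {P : Mx N → ℝ} (hp : IsProbabilityMeasure (mP P))
    (hinv : ∀ g, ∀ k ∈ Og N, P (g * k) = P g) {φ : Mx N → ℝ} (hφ : IsInvTest N φ) :
    IsInvTest N fun x => ∫ u : Us N, φ (of u * x * (of u)ᵀ) ∂(mP P) := by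
  obtain ⟨B, hB⟩ := hφ.2.1
  refine ⟨?_, ⟨B, fun X => ?_⟩, fun X _ k hk => ?_⟩
  · have h1 : Measurable fun p : Us N × Mx N => φ (of p.1 * p.2 * (of p.1)ᵀ) := hφ.1.comp cj_meas2
    exact (h1.stronglyMeasurable.integral_prod_left (μ := mP P)).measurable
  · have h1 := norm_integral_le_of_norm_le_const (μ := mP P) (f := fun u : Us N => φ (of u * X * (of u)ᵀ)) (C := B) (evf fun u => hB _)
    simpa using h1
  · have h1 := (mP_mp (P := P) (rmE ⟨k, hk⟩) (rmE_mp _) fun u => hinv (of u) k hk).integral_comp' (fun u : Us N => φ (of u * X * (of u)ᵀ))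
    refine Eq.trans ?_ h1
    refine integral_congr_ae (evf fun u => ?_)
    show φ (of u * (k * X * kᵀ) * (of u)ᵀ) = φ ((of u * k) * X * (of u * k)ᵀ)
    rw [transpose_mul]
    simp only [Matrix.mul_assoc]

lemma final_nice (n : ℕ) (hn : 1 ≤ n)
    {P : Mx (2 * n) → ℝ}
    {σw : Mx 2 → ℝ} (hfac : IsFactorizing n P σw)
    {h : ℝ → ℝ} (hdet : IsDetDensity σw h) (hh : NiceH n h) (hmell : ∀ j < n, 0 < ∫ t in Set.Ioi 0, h t * t ^ (2 * j))
    {w : Fin n → ℝ → ℝ} (hwm : ∀ b, Measurable (w b))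
    (hi : ∀ b, ∀ j < n, IntegrableOn (fun t : ℝ => t ^ (2 * j) * w b t) (Set.Ioi 0))
    (C : ℝ)
    (ν : Measure (Mx (2 * n))) (hν : IsProbabilityMeasure ν)
    (hνlaw : ∀ φ : Mx (2 * n) → ℝ, IsInvTest (2 * n) φ →
      (∫ x, φ x ∂ν) =
        C * ∫ a in {a : Fin n → ℝ | ∀ j, 0 < a j},
          φ (Dmat a) * (vdm fun j => (a j) ^ 2) *
            (of fun b c : Fin n => w b (a c)).det)
    {φ : Mx (2 * n) → ℝ} (hφ : IsInvTest (2 * n) φ) :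
      (∫ u : Fin (2 * n) → Fin (2 * n) → ℝ,
          ∫ x, P (of u) * φ (of u * x * (of u)ᵀ) ∂ν) =
        (C / M0 n h) *
          ∫ a in {a : Fin n → ℝ | ∀ j, 0 < a j},
            φ (Dmat a) * (vdm fun j => (a j) ^ 2) *
              (of fun b c : Fin n => mconv h (w b) (a c)).det := by
  have hpr := mP_prob hfac.nonneg hfac.integrable hfac.prob
  have hM : 0 < M0 n h := M0_ne hfac hmell
  obtain ⟨B, hB⟩ := hφ.2.1
  have hS : MeasurableSet {a : Fin n → ℝ | ∀ j, 0 < a j} := by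
    rw [Set.setOf_forall]
    exact MeasurableSet.iInter fun i => measurableSet_lt measurable_const (measurable_pi_apply _)
  have h1 : ∫ u : Us (2*n), ∫ x, P (of u) * φ (of u * x * (of u)ᵀ) ∂ν = ∫ x, ∫ u : Us (2*n), φ (of u * x * (of u)ᵀ) ∂(mP P) ∂ν := by
    rw [← integral_integral_swap (f := fun (u : Us (2*n)) x => φ (of u * x * (of u)ᵀ)), int_mP hfac.nonneg hfac.integrable]
    · simp_rw [integral_const_mul, smul_eq_mul]
    · exact Integrable.of_bound (hφ.1.comp cj_meas2).aestronglyMeasurable B (evf fun p => hB _)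
  refine Eq.trans h1 ?_
  rw [hνlaw _ (avg_inv hpr (fun g k hk => by simpa using hfac.invariant g 1 (one_mem _) k hk) hφ), div_mul_eq_mul_div, mul_div_assoc]
  refine congrArg (C * ·) ?_
  simp only [vdm_V0]
  have h2 : ∫ a in {a : Fin n → ℝ | ∀ j, 0 < a j}, (∫ u : Us (2*n), φ (of u * Dmat a * (of u)ᵀ) ∂(mP P)) * V0 a * (of fun b c : Fin n => w b (a c)).det =
      ∫ a : Fin n → ℝ, (M0 n h)⁻¹ * ∫ y, φ (Dmat y) * (V0 y * gk h a y * (of fun b c : Fin n => wp (w b) (a c)).det) := by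
    rw [← integral_indicator hS]
    refine integral_congr_ae ?_
    filter_upwards [inj_ae n] with a ha
    by_cases hp : ∀ j, 0 < a j
    · rw [Set.indicator_of_mem (show a ∈ {a : Fin n → ℝ | ∀ j, 0 < a j} from hp)]
      have hD : Ds a := ⟨hp, ha⟩
      have hV := V0_ne hD
      rw [kernel hfac hdet hh hn hmell hD hφ, ← integral_mul_const, ← integral_mul_const, ← integral_const_mul]
      refine integral_congr_ae (evf fun y => ?_)
      simp only [wp_pos _ (hp _), smul_eq_mul]
      field_simp
    · rw [Set.indicator_of_notMem (show a ∉ {a : Fin n → ℝ | ∀ j, 0 < a j} from hp)]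
      push Not at hp
      obtain ⟨b, hb⟩ := hp
      have : (of fun b c : Fin n => wp (w b) (a c)).det = 0 := det_eq_zero_of_column_eq_zero b fun c => by
        simp only [of_apply, wp_nonpos _ hb]
      simp [this]
  rw [h2, integral_const_mul, div_eq_inv_mul]
  refine congrArg ((M0 n h)⁻¹ * ·) ?_
  have hfm : Measurable fun p : (Fin n → ℝ) × (Fin n → ℝ) => φ (Dmat p.2) := (hφ.1.comp Dmat_meas).comp measurable_snd
  have h3 : Integrable fun p : (Fin n → ℝ) × (Fin n → ℝ) => φ (Dmat p.2) * (V0 p.2 * gk h p.1 p.2 * (of fun b c : Fin n => wp (w b) (p.1 c)).det) :=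
    (G_int hh hwm hi).bdd_mul (c := B) hfm.aestronglyMeasurable (evf fun p => hB _)
  rw [Measure.volume_eq_prod] at h3
  rw [integral_integral_swap h3, ← integral_indicator hS]
  refine integral_congr_ae ?_
  filter_upwards [inner_int hh hn hwm hi] with y hy
  have h4 : ∀ a : Fin n → ℝ, φ (Dmat y) * (V0 y * gk h a y * (of fun b c : Fin n => wp (w b) (a c)).det) =
    (φ (Dmat y) * V0 y) * ((of fun b c : Fin n => wp (w b) (a c)).det * gk h a y) := fun a => by ring
  simp_rw [h4]
  rw [integral_const_mul, hy]
  exact (Set.indicator_mul_right _ (fun y => φ (Dmat y) * V0 y) _).symm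


lemma nice_exists (hn : 1 ≤ n) {σw : Mx 2 → ℝ} {h : ℝ → ℝ} (hdet : IsDetDensity σw h)
    (hmellint : ∀ j : Fin n, IntegrableOn (fun t : ℝ => h t * t ^ (2 * ((j : ℕ) + 1 : ℝ) - 1 - 1)) (Set.Ioi 0)) :
    ∃ g : ℝ → ℝ, NiceH n g ∧ g =ᵐ[volume.restrict (Set.Ioi 0)] h := by
  have hI : IntegrableOn h (Set.Ioi 0) := by
    refine (hmellint ⟨0, hn⟩).congr (evf fun t => ?_)
    norm_num
  have hA := hI.aestronglyMeasurable.aemeasurable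
  set g : ℝ → ℝ := (Set.Ioi (0:ℝ)).indicator fun t => max (hA.mk h t) 0 with hg
  have hge : g =ᵐ[volume.restrict (Set.Ioi 0)] h := by
    filter_upwards [hA.ae_eq_mk, ae_restrict_mem measurableSet_Ioi] with t h1 h2
    rw [hg, Set.indicator_of_mem h2, ← h1, max_eq_left (hdet.1 t h2)]
  refine ⟨g, ⟨(hA.measurable_mk.max measurable_const).indicator measurableSet_Ioi, fun t => ?_, fun t ht => ?_, fun j hj => ?_⟩, hge⟩
  · exact Set.indicator_nonneg (fun t _ => le_max_right _ _) t
  · exact Set.indicator_of_notMem (by simpa using ht) _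
  · have h1 : IntegrableOn (fun t => g t * t ^ (2*j)) (Set.Ioi 0) := by
      refine (hmellint ⟨j, hj⟩).congr ?_
      filter_upwards [hge, ae_restrict_mem measurableSet_Ioi] with t h1 h2
      rw [h1, show (2 * ((j : ℝ) + 1) - 1 - 1) = ((2 * j : ℕ) : ℝ) by push_cast; ring, Real.rpow_natCast]
    rw [← integrable_indicator_iff measurableSet_Ioi] at h1
    refine h1.congr (evf fun t => ?_)
    by_cases ht : t ∈ Set.Ioi (0:ℝ)
    · rw [Set.indicator_of_mem ht]
    · rw [Set.indicator_of_notMem ht, hg]; simp only [Set.indicator_of_notMem ht, zero_mul]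

lemma mell_pow (g h : ℝ → ℝ) (hge : g =ᵐ[volume.restrict (Set.Ioi 0)] h) (j : ℕ) :
    ∫ t in Set.Ioi 0, g t * t ^ (2 * j) = mellH h (2 * ((j : ℕ) + 1 : ℝ) - 1) := by
  unfold mellH
  refine integral_congr_ae ?_
  filter_upwards [hge] with t h1
  rw [h1, show (2 * ((j : ℝ) + 1) - 1 - 1) = ((2 * j : ℕ) : ℝ) by push_cast; ring, Real.rpow_natCast]

end FPE

/-- Corollary 3.3: a factorizing ensemble times a polynomial ensemble
on `H` is a polynomial ensemble on `H` with weights `h ⊛ w_b`. -/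
theorem factorizing_times_polynomial_ensemble (n : ℕ) (hn : 1 ≤ n)
    (P : Matrix (Fin (2 * n)) (Fin (2 * n)) ℝ → ℝ)
    (σw : Matrix (Fin 2) (Fin 2) ℝ → ℝ) (hfac : IsFactorizing n P σw)
    (h : ℝ → ℝ) (hdet : IsDetDensity σw h)
    (hmellpos : ∀ j : Fin n, 0 < mellH h (2 * ((j : ℕ) + 1 : ℝ) - 1))
    (hmellint : ∀ j : Fin n,
      IntegrableOn (fun t : ℝ => h t * t ^ (2 * ((j : ℕ) + 1 : ℝ) - 1 - 1)) (Set.Ioi 0))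
    (w : Fin n → ℝ → ℝ) (hwm : ∀ b, Measurable (w b))
    (hw0 : ∀ b, ∀ t : ℝ, 0 < t → 0 ≤ w b t)
    (hwint : ∀ u ∈ Set.Icc (1 : ℝ) (2 * (n : ℝ) - 1), ∀ b,
      IntegrableOn (fun t : ℝ => t ^ (u - 1) * w b t) (Set.Ioi 0))
    (C : ℝ) (hC : 0 < C)
    (ν : Measure (Matrix (Fin (2 * n)) (Fin (2 * n)) ℝ)) (hν : IsProbabilityMeasure ν)
    (hνanti : ∀ᵐ x ∂ν, xᵀ = -x)
    (hνlaw : ∀ φ : Matrix (Fin (2 * n)) (Fin (2 * n)) ℝ → ℝ, IsInvTest (2 * n) φ →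
      (∫ x, φ x ∂ν) =
        C * ∫ a in {a : Fin n → ℝ | ∀ j, 0 < a j},
          φ (Dmat a) * (vdm fun j => (a j) ^ 2) *
            (Matrix.of fun b c : Fin n => w b (a c)).det) :
    ∀ φ : Matrix (Fin (2 * n)) (Fin (2 * n)) ℝ → ℝ, IsInvTest (2 * n) φ →
      (∫ u : Fin (2 * n) → Fin (2 * n) → ℝ,
          ∫ x, P (Matrix.of u) * φ (Matrix.of u * x * (Matrix.of u)ᵀ) ∂ν) =
        (C / ∏ j : Fin n, mellH h (2 * ((j : ℕ) + 1 : ℝ) - 1)) *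
          ∫ a in {a : Fin n → ℝ | ∀ j, 0 < a j},
            φ (Dmat a) * (vdm fun j => (a j) ^ 2) *
              (Matrix.of fun b c : Fin n => mconv h (w b) (a c)).det := by
  intro φ hφ
  obtain ⟨g, hg, hge⟩ := FPE.nice_exists hn hdet hmellint
  have hmell : ∀ j < n, 0 < ∫ t in Set.Ioi 0, g t * t ^ (2 * j) := fun j hj => by
    rw [FPE.mell_pow g h hge]; exact hmellpos ⟨j, hj⟩
  have hdet' : IsDetDensity σw g := by
    refine ⟨fun t _ => hg.nonneg t, fun ψ h1 h2 => ?_⟩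
    rw [hdet.2 ψ h1 h2]
    refine integral_congr_ae ?_
    filter_upwards [hge] with t ht
    rw [ht]
  have hmc : ∀ w y, mconv g w y = mconv h w y := fun w y => by
    refine integral_congr_ae ?_
    filter_upwards [hge] with t ht
    rw [ht]
  have hi : ∀ b, ∀ j < n, IntegrableOn (fun t : ℝ => t ^ (2 * j) * w b t) (Set.Ioi 0) := by
    intro b j hj
    have hj' : (j:ℝ) + 1 ≤ n := by exact_mod_cast hj
    have h0 : (0:ℝ) ≤ j := Nat.cast_nonneg j
    refine (hwint (2 * j + 1) ⟨by linarith, by linarith⟩ b).congr (Filter.Eventually.of_forall fun t => ?_)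
    simp only
    rw [show (2 * (j : ℝ) + 1 - 1) = ((2 * j : ℕ) : ℝ) by push_cast; ring, Real.rpow_natCast]
  have hM : FPE.M0 n g = ∏ j : Fin n, mellH h (2 * ((j : ℕ) + 1 : ℝ) - 1) := by
    unfold FPE.M0
    simp_rw [FPE.mell_pow g h hge]
    rw [← Equiv.prod_comp Fin.revPerm]
    refine Finset.prod_congr rfl fun i _ => ?_
    have : n - 1 - (Fin.revPerm i).val = i.val := by
      rw [Fin.revPerm_apply, Fin.val_rev]; have := i.2; omega
    rw [this]
  have key := FPE.final_nice n hn hfac hdet' hg hmell hwm hi C ν hν hνlaw hφ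
  rw [hM] at key
  simp only [hmc] at key
  exact key

end
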